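/- arXiv:1509.00540 — 17 statements merged into one kernel-verified Lean document; each statement's English description precedes it below -/
import Mathlib

section
/- Suppose σ(T₀) ≠ σ([T₀]⁻) for some T₀ ≥ 0. Then σ(τ) ≠ σ([τ]⁻) for every τ ∈ [T₀, [T₀]⁻ + T_s), and consequently, for every t ≥ [T₀]⁻ + T_s, the total mismatch times satisfy μ(t, [T₀]⁻ + T_s) = μ(t, T₀) − ([T₀]⁻ + T_s − T₀). -/
/-- Let `Ts > 0` be the sampling period and `[t]⁻ := Ts⌊t/Ts⌋`.  Let `σ` be a
piecewise-constant (right-continuous) switching signal, given by a strictly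
increasing, unbounded sequence of times `tk` with `tk 0 = 0` and `σ` constant on
each `[tk k, tk (k+1))`, having at most one switching time in each open sampling
interval `(kTs, (k+1)Ts)`.  If `σ(T₀) ≠ σ([T₀]⁻)` for some `T₀ ≥ 0`, then
`σ(τ) ≠ σ([τ]⁻)` for every `τ ∈ [T₀, [T₀]⁻ + Ts)`, and consequently the total
mismatch times satisfy
`μ(t, [T₀]⁻ + Ts) = μ(t, T₀) − ([T₀]⁻ + Ts − T₀)` for every `t ≥ [T₀]⁻ + Ts`. -/
theorem mismatch_time_after_sampling_instant {ι : Type*} [Fintype ι] [Nonempty ι]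
    (Ts : ℝ) (hTs : 0 < Ts)
    (smp : ℝ → ℝ) (hsmp : ∀ t, smp t = Ts * (⌊t / Ts⌋ : ℝ))
    (σ : ℝ → ι)
    (tk : ℕ → ℝ) (htk0 : tk 0 = 0) (htkmono : StrictMono tk)
    (htktop : Filter.Tendsto tk Filter.atTop Filter.atTop)
    (hconst : ∀ k, ∀ s ∈ Set.Ico (tk k) (tk (k + 1)), σ s = σ (tk k))
    (hone : ∀ k : ℕ, ∀ i j : ℕ,
      tk i ∈ Set.Ioo ((k : ℝ) * Ts) (((k : ℝ) + 1) * Ts) →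
      tk j ∈ Set.Ioo ((k : ℝ) * Ts) (((k : ℝ) + 1) * Ts) → i = j)
    (μ : ℝ → ℝ → ℝ)
    (hμ : ∀ t₁ t₂ : ℝ, μ t₁ t₂ =
      (MeasureTheory.volume {τ ∈ Set.Ico t₂ t₁ | σ τ ≠ σ (smp τ)}).toReal)
    (T₀ : ℝ) (hT₀ : 0 ≤ T₀) (hmis : σ T₀ ≠ σ (smp T₀)) :
    (∀ τ ∈ Set.Ico T₀ (smp T₀ + Ts), σ τ ≠ σ (smp τ)) ∧
    (∀ t ≥ smp T₀ + Ts, μ t (smp T₀ + Ts) = μ t T₀ - (smp T₀ + Ts - T₀)) := by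
  obtain ⟨N, hN⟩ : ∃ N : ℕ, ⌊T₀ / Ts⌋ = (N : ℤ) :=
    Int.eq_ofNat_of_zero_le (Int.floor_nonneg.mpr (div_nonneg hT₀ hTs.le))
  have ha : smp T₀ = (N : ℝ) * Ts := by
    rw [hsmp, hN]; push_cast; ring
  have hfl := Int.floor_eq_iff.mp hN
  push_cast at hfl
  have h1 : (N : ℝ) * Ts ≤ T₀ := (le_div_iff₀ hTs).mp hfl.1
  have ha0 : 0 ≤ (N : ℝ) * Ts := by positivity
  have hex : ∀ s, 0 ≤ s → ∃ k, tk k ≤ s ∧ s < tk (k + 1) := by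
    intro s hs
    by_contra! hcon
    have hall : ∀ k, tk k ≤ s := by
      intro k
      induction k with
      | zero => rw [htk0]; exact hs
      | succ k ih => exact hcon k ih
    obtain ⟨k, hk⟩ := (htktop.eventually_gt_atTop s).exists
    exact absurd (hall k) (not_le.mpr hk)
  have hsame : ∀ τ ∈ Set.Ico T₀ (smp T₀ + Ts), smp τ = smp T₀ := by
    intro τ hτ
    rw [ha] at hτ
    have : ⌊τ / Ts⌋ = (N : ℤ) := by
      rw [Int.floor_eq_iff]
      push_cast
      refine ⟨(le_div_iff₀ hTs).mpr (h1.trans hτ.1), (div_lt_iff₀ hTs).mpr ?_⟩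
      linarith [hτ.2]
    rw [hsmp, hsmp, this, hN]
  have hT1 : T₀ < smp T₀ + Ts := by
    have := (div_lt_iff₀ hTs).mp hfl.2
    rw [ha]; linarith
  have key : ∀ τ ∈ Set.Ico T₀ (smp T₀ + Ts), σ τ ≠ σ (smp τ) := by
    intro τ hτ
    rw [hsame τ hτ]
    obtain ⟨i, hi1, hi2⟩ := hex _ ha0
    have hi3 : tk (i + 1) ≤ T₀ := by
      by_contra! hlt
      apply hmis
      rw [ha, hconst i T₀ ⟨hi1.trans h1, hlt⟩, hconst i _ ⟨hi1, hi2⟩]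
    have hi4 : τ < tk (i + 1 + 1) := by
      by_contra! hle
      have hlt := htkmono (Nat.lt_succ_self (i + 1))
      have hτ2 := hτ.2
      rw [ha] at hτ2
      have := hone N (i + 1) (i + 1 + 1) ⟨hi2, by linarith [hτ.1]⟩
        ⟨hi2.trans hlt, by linarith⟩
      omega
    rw [hconst (i + 1) τ ⟨hi3.trans hτ.1, hi4⟩,
      ← hconst (i + 1) T₀ ⟨hi3, hτ.1.trans_lt hi4⟩]
    exact hmis
  refine ⟨key, fun t ht => ?_⟩
  have hset : {τ ∈ Set.Ico T₀ t | σ τ ≠ σ (smp τ)} =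
      {τ ∈ Set.Ico (smp T₀ + Ts) t | σ τ ≠ σ (smp τ)} ∪ Set.Ico T₀ (smp T₀ + Ts) := by
    ext τ
    constructor
    · rintro ⟨⟨h, h'⟩, hne⟩
      rcases lt_or_ge τ (smp T₀ + Ts) with hl | hl
      · exact Or.inr ⟨h, hl⟩
      · exact Or.inl ⟨⟨hl, h'⟩, hne⟩
    · rintro (⟨⟨h, h'⟩, hne⟩ | h)
      · exact ⟨⟨hT1.le.trans h, h'⟩, hne⟩
      · exact ⟨⟨h.1, h.2.trans_le ht⟩, key τ h⟩
  have hdisj : Disjoint {τ ∈ Set.Ico (smp T₀ + Ts) t | σ τ ≠ σ (smp τ)}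
      (Set.Ico T₀ (smp T₀ + Ts)) := by
    rw [Set.disjoint_left]
    rintro τ ⟨h, _⟩ h'
    exact absurd h.1 (not_le.mpr h'.2)
  have hfin : MeasureTheory.volume {τ ∈ Set.Ico (smp T₀ + Ts) t | σ τ ≠ σ (smp τ)} ≠ ⊤ :=
    ne_top_of_le_ne_top (by rw [Real.volume_Ico]; exact ENNReal.ofReal_ne_top)
      (MeasureTheory.measure_mono (Set.sep_subset _ _))
  rw [hμ, hμ, hset, MeasureTheory.measure_union hdisj measurableSet_Ico,
    Real.volume_Ico, ENNReal.toReal_add hfin ENNReal.ofReal_ne_top,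
    ENNReal.toReal_ofReal (by linarith)]
  ring
end

section
/- Suppose Λ > 0, let α₀ > 0 satisfy ‖v_p‖ ≤ α₀‖x(0)‖ for every p ∈ 𝒫, and suppose η := α₀(e^{ΛT_s} − 1)/Λ < 1. Define α₁ := e^{ΛT_s}/(1 − η). Then every trajectory x of the switched system satisfies ‖x(0)‖ ≤ α₁‖x(t)‖ for all t ∈ [0, T_s). -/
open scoped RealInnerProductSpace

/-- Backward Gronwall estimate on a half-open piece, written as a growth inequality. -/
theorem piece_bound_aux {E : Type*} [NormedAddCommGroup E] [NormedSpace ℝ E]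
    (x x' : ℝ → E) (K ε a b : ℝ) (hK : 0 < K)
    (hc : ContinuousOn x (Set.Icc a b))
    (hd : ∀ τ ∈ Set.Ioo a b, HasDerivAt x (x' τ) τ)
    (hb : ∀ τ ∈ Set.Ioo a b, ‖x' τ‖ ≤ K * ‖x τ‖ + ε) :
    ∀ t ∈ Set.Ioo a b,
      (‖x a‖ + ε / K) * Real.exp (K * a) ≤ (‖x t‖ + ε / K) * Real.exp (K * t) := by
  intro t ht
  have h := norm_le_gronwallBound_of_norm_deriv_right_le
    (f := fun τ => x (t - τ)) (f' := fun τ => -x' (t - τ)) (δ := ‖x t‖) (K := K) (ε := ε)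
    (a := 0) (b := t - a) ?_ ?_ (by simp) ?_ (t - a) ⟨by linarith [ht.1], le_rfl⟩
  · rw [gronwallBound_of_K_ne_0 hK.ne'] at h
    simp only [sub_sub_cancel, sub_zero] at h
    have h2 : Real.exp (K * (t - a)) * Real.exp (K * a) = Real.exp (K * t) := by
      rw [← Real.exp_add]; ring_nf
    rw [← h2, ← mul_assoc]
    refine mul_le_mul_of_nonneg_right ?_ (Real.exp_pos _).le
    linarith
  · refine hc.comp (by fun_prop) ?_
    intro τ hτ
    exact ⟨by linarith [hτ.2], by linarith [hτ.1, ht.2]⟩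
  · intro τ hτ
    have := (hd (t - τ) ⟨by linarith [hτ.2], by linarith [hτ.1, ht.2]⟩).scomp τ
      ((hasDerivAt_id τ).const_sub t)
    simpa [Function.comp_def] using this.hasDerivWithinAt
  · intro τ hτ
    rw [norm_neg]
    exact hb _ ⟨by linarith [hτ.2], by linarith [hτ.1, ht.2]⟩

theorem piece_bound {E : Type*} [NormedAddCommGroup E] [NormedSpace ℝ E]
    (x x' : ℝ → E) (K ε a b : ℝ) (hK : 0 < K) (hab : a < b)
    (hc : ContinuousOn x (Set.Icc a b))
    (hd : ∀ τ ∈ Set.Ioo a b, HasDerivAt x (x' τ) τ)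
    (hb : ∀ τ ∈ Set.Ioo a b, ‖x' τ‖ ≤ K * ‖x τ‖ + ε) :
    ∀ t ∈ Set.Icc a b,
      (‖x a‖ + ε / K) * Real.exp (K * a) ≤ (‖x t‖ + ε / K) * Real.exp (K * t) := by
  intro t ht
  have hg : ContinuousOn (fun t => (‖x t‖ + ε / K) * Real.exp (K * t)) (Set.Icc a b) := by
    fun_prop
  refine ContinuousWithinAt.closure_le (s := Set.Ioo a b) (x := t)
    (f := fun _ => (‖x a‖ + ε / K) * Real.exp (K * a))
    (g := fun t => (‖x t‖ + ε / K) * Real.exp (K * t)) ?_ continuousWithinAt_const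
    ((hg t ht).mono Set.Ioo_subset_Icc_self) (piece_bound_aux x x' K ε a b hK hc hd hb)
  rwa [closure_Ioo hab.ne]

/-- Lemma 1 of the paper.  Over one sampling interval `[0, Ts)`, a trajectory of the
switched system `x' = A_{σ(τ)} x + v_{σ(τ)}`, where the constant input vectors satisfy
`‖v_p‖ ≤ α₀ ‖x(0)‖`, fulfils `‖x(0)‖ ≤ α₁ ‖x(t)‖` for all `t ∈ [0, Ts)`, where
`Λ := max_p ‖A_p‖ > 0`, `η := α₀ (e^{Λ Ts} − 1)/Λ < 1` and `α₁ := e^{Λ Ts}/(1 − η)`. -/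
theorem sampled_state_bound {n : ℕ} {ι : Type*} [Fintype ι] [Nonempty ι]
    (A : ι → (EuclideanSpace ℝ (Fin n) →L[ℝ] EuclideanSpace ℝ (Fin n)))
    (Λ : ℝ) (hΛdef : Λ = Finset.univ.sup' Finset.univ_nonempty fun p => ‖A p‖)
    (hΛ : 0 < Λ)
    (Ts : ℝ) (hTs : 0 < Ts)
    (σ : ℝ → ι) (M : ℕ) (s : ℕ → ℝ) (hs0 : s 0 = 0) (hsM : s M = Ts)
    (hsmono : ∀ k < M, s k < s (k + 1))
    (hσconst : ∀ k < M, ∀ τ ∈ Set.Ico (s k) (s (k + 1)), σ τ = σ (s k))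
    (v : ι → EuclideanSpace ℝ (Fin n))
    (x : ℝ → EuclideanSpace ℝ (Fin n))
    (hxc : ContinuousOn x (Set.Icc 0 Ts))
    (hx' : ∀ k < M, ∀ τ ∈ Set.Ioo (s k) (s (k + 1)),
      HasDerivAt x (A (σ τ) (x τ) + v (σ τ)) τ)
    (α₀ : ℝ) (hα₀ : 0 < α₀) (hv : ∀ p : ι, ‖v p‖ ≤ α₀ * ‖x 0‖)
    (η : ℝ) (hη : η = α₀ * (Real.exp (Λ * Ts) - 1) / Λ) (hη1 : η < 1)
    (α₁ : ℝ) (hα₁ : α₁ = Real.exp (Λ * Ts) / (1 - η)) :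
    ∀ t ∈ Set.Ico (0 : ℝ) Ts, ‖x 0‖ ≤ α₁ * ‖x t‖ := by
  have hle : ∀ k ≤ M, ∀ j ≤ k, s j ≤ s k := by
    intro k
    induction k with
    | zero => intro _ j hj; rw [Nat.le_zero.mp hj]
    | succ k ih =>
      intro hk j hj
      rcases Nat.lt_or_ge j (k + 1) with h | h
      · exact (ih (by omega) j (by omega)).trans (hsmono k (by omega)).le
      · rw [le_antisymm hj h]
  have hA : ∀ p, ‖A p‖ ≤ Λ := by
    intro p
    rw [hΛdef]
    exact Finset.le_sup' (fun p => ‖A p‖) (Finset.mem_univ p)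
  have main : ∀ k ≤ M, ∀ t ∈ Set.Icc 0 (s k),
      (‖x 0‖ + α₀ * ‖x 0‖ / Λ) * Real.exp (Λ * 0) ≤
        (‖x t‖ + α₀ * ‖x 0‖ / Λ) * Real.exp (Λ * t) := by
    intro k
    induction k with
    | zero =>
      intro _ t ht
      rw [hs0] at ht
      rw [le_antisymm ht.2 ht.1]
    | succ k ih =>
      intro hk t ht
      have h0 : 0 ≤ s k := hs0 ▸ hle k (by omega) 0 (by omega)
      have h1 : s (k + 1) ≤ Ts := hsM ▸ hle M le_rfl (k + 1) hk
      rcases le_total t (s k) with h | h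
      · exact ih (by omega) t ⟨ht.1, h⟩
      · refine (ih (by omega) (s k) ⟨h0, le_rfl⟩).trans ?_
        refine piece_bound x (fun τ => A (σ τ) (x τ) + v (σ τ)) Λ _ (s k) (s (k + 1)) hΛ
          (hsmono k (by omega)) (hxc.mono (Set.Icc_subset_Icc h0 h1)) (hx' k (by omega)) ?_ t
          ⟨h, ht.2⟩
        intro τ _
        refine (norm_add_le _ _).trans (add_le_add ?_ (hv _))
        exact ((A (σ τ)).le_opNorm _).trans
          (mul_le_mul_of_nonneg_right (hA _) (norm_nonneg _))
  intro t ht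
  have h := main M le_rfl t ⟨ht.1, by rw [hsM]; exact ht.2.le⟩
  have hE : Real.exp (Λ * t) ≤ Real.exp (Λ * Ts) :=
    Real.exp_le_exp.mpr (mul_le_mul_of_nonneg_left ht.2.le hΛ.le)
  have hnn : 0 ≤ ‖x t‖ + α₀ * ‖x 0‖ / Λ := by positivity
  have h2 := h.trans (mul_le_mul_of_nonneg_left hE hnn)
  have h3 : η * ‖x 0‖ = α₀ * ‖x 0‖ / Λ * (Real.exp (Λ * Ts) - 1) := by
    rw [hη]; ring
  rw [mul_zero, Real.exp_zero] at h2
  rw [hα₁, div_mul_eq_mul_div, le_div_iff₀ (by linarith)]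
  linarith
end

section
/- Suppose Λ > 0 and let α₀ > 0 satisfy ‖v_p‖ ≤ α₀‖x(0)‖ for every p ∈ 𝒫. Define β₁ := (e^{ΛT_s} − 1)(1 + α₀/Λ). Then every trajectory x of the switched system satisfies ‖x(t) − x(0)‖ ≤ β₁‖x(0)‖ for all t ∈ [0, T_s). -/
open scoped RealInnerProductSpace

/-- Lemma 2 of the paper.  Over one sampling interval `[0, Ts)`, a trajectory of the
switched system `x' = A_{σ(τ)} x + v_{σ(τ)}`, where the constant input vectors satisfy
`‖v_p‖ ≤ α₀ ‖x(0)‖`, fulfils `‖x(t) − x(0)‖ ≤ β₁ ‖x(0)‖` for all `t ∈ [0, Ts)`, where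
`Λ := max_p ‖A_p‖ > 0` and `β₁ := (e^{Λ Ts} − 1)(1 + α₀/Λ)`. -/
theorem intersample_error_bound {n : ℕ} {ι : Type*} [Fintype ι] [Nonempty ι]
    (A : ι → (EuclideanSpace ℝ (Fin n) →L[ℝ] EuclideanSpace ℝ (Fin n)))
    (Λ : ℝ) (hΛdef : Λ = Finset.univ.sup' Finset.univ_nonempty fun p => ‖A p‖)
    (hΛ : 0 < Λ)
    (Ts : ℝ) (hTs : 0 < Ts)
    (σ : ℝ → ι) (M : ℕ) (s : ℕ → ℝ) (hs0 : s 0 = 0) (hsM : s M = Ts)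
    (hsmono : ∀ k < M, s k < s (k + 1))
    (hσconst : ∀ k < M, ∀ τ ∈ Set.Ico (s k) (s (k + 1)), σ τ = σ (s k))
    (v : ι → EuclideanSpace ℝ (Fin n))
    (x : ℝ → EuclideanSpace ℝ (Fin n))
    (hxc : ContinuousOn x (Set.Icc 0 Ts))
    (hx' : ∀ k < M, ∀ τ ∈ Set.Ioo (s k) (s (k + 1)),
      HasDerivAt x (A (σ τ) (x τ) + v (σ τ)) τ)
    (α₀ : ℝ) (hα₀ : 0 < α₀) (hv : ∀ p : ι, ‖v p‖ ≤ α₀ * ‖x 0‖)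
    (β₁ : ℝ) (hβ₁ : β₁ = (Real.exp (Λ * Ts) - 1) * (1 + α₀ / Λ)) :
    ∀ t ∈ Set.Ico (0 : ℝ) Ts, ‖x t - x 0‖ ≤ β₁ * ‖x 0‖ := by
  have hA : ∀ p, ‖A p‖ ≤ Λ := by
    intro p
    rw [hΛdef]
    exact Finset.le_sup' (fun p => ‖A p‖) (Finset.mem_univ p)
  have hfind : ∀ m ≤ M, ∀ τ, 0 ≤ τ → τ < s m →
      ∃ k < M, τ ∈ Set.Ico (s k) (s (k + 1)) := by
    intro m
    induction m with
    | zero => intro _ τ h1 h2; rw [hs0] at h2; exact absurd h2 (not_lt.mpr h1)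
    | succ m ih =>
      intro hm τ h1 h2
      by_cases h : τ < s m
      · exact ih (by omega) τ h1 h
      · exact ⟨m, by omega, not_lt.mp h, h2⟩
  have hder : ∀ τ ∈ Set.Ico 0 Ts,
      HasDerivWithinAt x (A (σ τ) (x τ) + v (σ τ)) (Set.Ici τ) τ := by
    intro τ hτ
    obtain ⟨k, hk, hτk⟩ := hfind M le_rfl τ hτ.1 (by rw [hsM]; exact hτ.2)
    have hlt : τ < min (s (k + 1)) Ts := lt_min hτk.2 hτ.2
    have hd : ∀ y ∈ Set.Ioo τ (min (s (k + 1)) Ts),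
        HasDerivAt x (A (σ τ) (x y) + v (σ τ)) y := by
      intro y hy
      have hy2 := lt_of_lt_of_le hy.2 (min_le_left _ _)
      have h := hx' k hk y ⟨lt_of_le_of_lt hτk.1 hy.1, hy2⟩
      rwa [hσconst k hk y ⟨hτk.1.trans hy.1.le, hy2⟩, ← hσconst k hk τ hτk] at h
    have hsub : Set.Ioo τ (min (s (k + 1)) Ts) ⊆ Set.Icc 0 Ts := fun y hy =>
      ⟨hτ.1.trans hy.1.le, hy.2.le.trans (min_le_right _ _)⟩
    have hcont : ContinuousWithinAt x (Set.Ioo τ (min (s (k + 1)) Ts)) τ :=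
      (hxc τ ⟨hτ.1, hτ.2.le⟩).mono hsub
    have hmem : Set.Ioo τ (min (s (k + 1)) Ts) ∈ nhdsWithin τ (Set.Ioi τ) :=
      Ioo_mem_nhdsGT hlt
    refine hasDerivWithinAt_Ici_of_tendsto_deriv (s := Set.Ioo τ (min (s (k + 1)) Ts))
      (fun y hy => (hd y hy).differentiableAt.differentiableWithinAt) hcont hmem ?_
    have hx : Filter.Tendsto x (nhdsWithin τ (Set.Ioi τ)) (nhds (x τ)) :=
      hcont.mono_left (nhdsWithin_le_of_mem hmem)
    have h2 := (((A (σ τ)).continuous.tendsto (x τ)).comp hx).add_const (v (σ τ))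
    refine h2.congr' ?_
    filter_upwards [hmem] with y hy
    exact (hd y hy).deriv.symm
  intro t ht
  have key := norm_le_gronwallBound_of_norm_deriv_right_le (f := fun t => x t - x 0)
    (f' := fun τ => A (σ τ) (x τ) + v (σ τ)) (δ := 0) (K := Λ) (ε := (Λ + α₀) * ‖x 0‖)
    (a := 0) (b := Ts) (hxc.sub continuousOn_const) (fun τ hτ => (hder τ hτ).sub_const _)
    (by simp) (by
      intro τ _
      have h1 : ‖A (σ τ) (x τ)‖ ≤ Λ * ‖x τ‖ := (A (σ τ)).le_of_opNorm_le (hA _) _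
      have h2 : ‖x τ‖ ≤ ‖x τ - x 0‖ + ‖x 0‖ := by
        simpa using norm_add_le (x τ - x 0) (x 0)
      have h3 := mul_le_mul_of_nonneg_left h2 hΛ.le
      have h4 := norm_add_le (A (σ τ) (x τ)) (v (σ τ))
      have h5 := hv (σ τ)
      linarith) t ⟨ht.1, ht.2.le⟩
  rw [gronwallBound_of_K_ne_0 hΛ.ne'] at key
  simp only [zero_mul, zero_add, sub_zero] at key
  have he : Real.exp (Λ * t) ≤ Real.exp (Λ * Ts) :=
    Real.exp_le_exp.mpr (mul_le_mul_of_nonneg_left ht.2.le hΛ.le)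
  have hc : 0 ≤ (Λ + α₀) * ‖x 0‖ / Λ := by positivity
  have hfin := mul_le_mul_of_nonneg_left (sub_le_sub_right he 1) hc
  refine key.trans (hfin.trans (le_of_eq ?_))
  rw [hβ₁]
  field_simp
end

section
/- Suppose Λ > 0, let α₀ > 0 satisfy ‖B_{p'} K_{σ(0)} Q(x(0))‖ ≤ α₀‖x(0)‖ for every p' ∈ 𝒫, suppose η := α₀(e^{ΛT_s} − 1)/Λ < 1, and set α₁ := e^{ΛT_s}/(1 − η) and β₁ := (e^{ΛT_s} − 1)(1 + α₀/Λ). Fix p, q ∈ 𝒫 with p ≠ q and let γ₀ > 0 satisfy ‖P B_p K_q (Q(x(0)) − x(0))‖ ≤ γ₀‖x(0)‖. Define γ := α₁(β₁‖P B_p K_q‖ + γ₀). Then every trajectory x of the switched system satisfies ‖P B_p K_q (Q(x(0)) − x(t))‖ ≤ γ‖x(t)‖ for all t ∈ [0, T_s). -/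
open scoped RealInnerProductSpace

open Set Filter Topology in
/-- One-sided derivatives at every point of a piece of a piecewise affine flow. -/
theorem qeb_right_deriv {E : Type*} [NormedAddCommGroup E] [NormedSpace ℝ E]
    (L : E →L[ℝ] E) (c : E) (x : ℝ → E) (a b τ : ℝ) (hτ : τ ∈ Ico a b)
    (hc : ContinuousOn x (Icc a b))
    (hd : ∀ u ∈ Ioo a b, HasDerivAt x (L (x u) + c) u) :
    HasDerivWithinAt x (L (x τ) + c) (Ici τ) τ := by
  have hsub : Ioo τ b ⊆ Icc a b := fun u hu => ⟨hτ.1.trans hu.1.le, hu.2.le⟩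
  have hmem : Ioo τ b ∈ 𝓝[>] τ := Ioo_mem_nhdsGT hτ.2
  have hcw : ContinuousWithinAt x (Ioo τ b) τ := (hc τ ⟨hτ.1, hτ.2.le⟩).mono hsub
  have hd' : ∀ u ∈ Ioo τ b, HasDerivAt x (L (x u) + c) u :=
    fun u hu => hd u ⟨hτ.1.trans_lt hu.1, hu.2⟩
  refine hasDerivWithinAt_Ici_of_tendsto_deriv (s := Ioo τ b)
    (fun u hu => (hd' u hu).differentiableAt.differentiableWithinAt) hcw hmem ?_
  have h1 : Tendsto x (𝓝[>] τ) (𝓝 (x τ)) :=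
    hcw.tendsto.mono_left (nhdsWithin_le_of_mem hmem)
  have h2 : Tendsto (fun u => L (x u) + c) (𝓝[>] τ) (𝓝 (L (x τ) + c)) :=
    ((L.continuous.tendsto _).comp h1).add_const c
  refine h2.congr' ?_
  filter_upwards [hmem] with u hu
  exact (hd' u hu).deriv.symm

open Set Filter Topology in
theorem qeb_left_deriv {E : Type*} [NormedAddCommGroup E] [NormedSpace ℝ E]
    (L : E →L[ℝ] E) (c : E) (x : ℝ → E) (a b τ : ℝ) (hτ : τ ∈ Ioc a b)
    (hc : ContinuousOn x (Icc a b))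
    (hd : ∀ u ∈ Ioo a b, HasDerivAt x (L (x u) + c) u) :
    HasDerivWithinAt x (L (x τ) + c) (Iic τ) τ := by
  have hsub : Ioo a τ ⊆ Icc a b := fun u hu => ⟨hu.1.le, hu.2.le.trans hτ.2⟩
  have hmem : Ioo a τ ∈ 𝓝[<] τ := Ioo_mem_nhdsLT hτ.1
  have hcw : ContinuousWithinAt x (Ioo a τ) τ := (hc τ ⟨hτ.1.le, hτ.2⟩).mono hsub
  have hd' : ∀ u ∈ Ioo a τ, HasDerivAt x (L (x u) + c) u :=
    fun u hu => hd u ⟨hu.1, hu.2.trans_le hτ.2⟩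
  refine hasDerivWithinAt_Iic_of_tendsto_deriv (s := Ioo a τ)
    (fun u hu => (hd' u hu).differentiableAt.differentiableWithinAt) hcw hmem ?_
  have h1 : Tendsto x (𝓝[<] τ) (𝓝 (x τ)) :=
    hcw.tendsto.mono_left (nhdsWithin_le_of_mem hmem)
  have h2 : Tendsto (fun u => L (x u) + c) (𝓝[<] τ) (𝓝 (L (x τ) + c)) :=
    ((L.continuous.tendsto _).comp h1).add_const c
  refine h2.congr' ?_
  filter_upwards [hmem] with u hu
  exact (hd' u hu).deriv.symm

theorem qeb_find_right (s : ℕ → ℝ) (M : ℕ) (τ : ℝ) (h0 : s 0 ≤ τ) (h1 : τ < s M) :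
    ∃ k < M, s k ≤ τ ∧ τ < s (k + 1) := by
  induction M with
  | zero => linarith
  | succ M ih =>
    by_cases h : τ < s M
    · obtain ⟨k, hk, h⟩ := ih h
      exact ⟨k, by omega, h⟩
    · exact ⟨M, by omega, not_lt.mp h, h1⟩

theorem qeb_find_left (s : ℕ → ℝ) (M : ℕ) (τ : ℝ) (h0 : s 0 < τ) (h1 : τ ≤ s M) :
    ∃ k < M, s k < τ ∧ τ ≤ s (k + 1) := by
  induction M with
  | zero => linarith
  | succ M ih =>
    by_cases h : τ ≤ s M
    · obtain ⟨k, hk, h⟩ := ih h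
      exact ⟨k, by omega, h⟩
    · exact ⟨M, by omega, not_le.mp h, h1⟩

theorem qeb_mono (s : ℕ → ℝ) (M : ℕ) (h : ∀ k < M, s k < s (k + 1)) (i j : ℕ)
    (hij : i ≤ j) (hj : j ≤ M) : s i ≤ s j := by
  induction j, hij using Nat.le_induction with
  | base => exact le_rfl
  | succ j hij ih => exact (ih (by omega)).trans (h j (by omega)).le

/-- Lemma 3 of the paper.  Over one sampling interval `[0, Ts)`, along a trajectory of
the quantized sampled-data switched system `x' = A_{σ(τ)} x + B_{σ(τ)} K_{σ(0)} Q(x(0))`,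
the error between the sampled quantized state and the current state satisfies
`‖P B_p K_q (Q(x(0)) − x(t))‖ ≤ γ ‖x(t)‖` for all `t ∈ [0, Ts)`, where `p ≠ q`,
`γ := α₁ (β₁ ‖P B_p K_q‖ + γ₀)`, with `Λ := max ‖A_p‖ > 0`,
`η := α₀ (e^{Λ Ts} − 1)/Λ < 1`, `α₁ := e^{Λ Ts}/(1 − η)` and
`β₁ := (e^{Λ Ts} − 1)(1 + α₀/Λ)`. -/
theorem quantized_error_bound {n m : ℕ} {ι : Type*} [Fintype ι] [Nonempty ι]
    (A : ι → (EuclideanSpace ℝ (Fin n) →L[ℝ] EuclideanSpace ℝ (Fin n)))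
    (B : ι → (EuclideanSpace ℝ (Fin m) →L[ℝ] EuclideanSpace ℝ (Fin n)))
    (K : ι → (EuclideanSpace ℝ (Fin n) →L[ℝ] EuclideanSpace ℝ (Fin m)))
    (P : EuclideanSpace ℝ (Fin n) →L[ℝ] EuclideanSpace ℝ (Fin n))
    (hPsym : ∀ y z : EuclideanSpace ℝ (Fin n), ⟪P y, z⟫ = ⟪y, P z⟫)
    (hPpos : ∀ y : EuclideanSpace ℝ (Fin n), y ≠ 0 → 0 < ⟪y, P y⟫)
    (Q : EuclideanSpace ℝ (Fin n) → EuclideanSpace ℝ (Fin n))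
    (Λ : ℝ) (hΛdef : Λ = Finset.univ.sup' Finset.univ_nonempty fun p => ‖A p‖)
    (hΛ : 0 < Λ)
    (Ts : ℝ) (hTs : 0 < Ts)
    (σ : ℝ → ι) (M : ℕ) (s : ℕ → ℝ) (hs0 : s 0 = 0) (hsM : s M = Ts)
    (hsmono : ∀ k < M, s k < s (k + 1))
    (hσconst : ∀ k < M, ∀ τ ∈ Set.Ico (s k) (s (k + 1)), σ τ = σ (s k))
    (x : ℝ → EuclideanSpace ℝ (Fin n))
    (hxc : ContinuousOn x (Set.Icc 0 Ts))
    (hx' : ∀ k < M, ∀ τ ∈ Set.Ioo (s k) (s (k + 1)),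
      HasDerivAt x (A (σ τ) (x τ) + (B (σ τ)) ((K (σ 0)) (Q (x 0)))) τ)
    (α₀ : ℝ) (hα₀ : 0 < α₀)
    (hquant : ∀ p' : ι, ‖(B p') ((K (σ 0)) (Q (x 0)))‖ ≤ α₀ * ‖x 0‖)
    (η : ℝ) (hη : η = α₀ * (Real.exp (Λ * Ts) - 1) / Λ) (hη1 : η < 1)
    (α₁ : ℝ) (hα₁ : α₁ = Real.exp (Λ * Ts) / (1 - η))
    (β₁ : ℝ) (hβ₁ : β₁ = (Real.exp (Λ * Ts) - 1) * (1 + α₀ / Λ))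
    (p q : ι) (hpq : p ≠ q)
    (γ₀ : ℝ) (hγ₀ : 0 < γ₀)
    (hγ₀bound : ‖(P.comp ((B p).comp (K q))) (Q (x 0) - x 0)‖ ≤ γ₀ * ‖x 0‖)
    (γ : ℝ) (hγ : γ = α₁ * (β₁ * ‖P.comp ((B p).comp (K q))‖ + γ₀)) :
    ∀ t ∈ Set.Ico (0 : ℝ) Ts,
      ‖(P.comp ((B p).comp (K q))) (Q (x 0) - x t)‖ ≤ γ * ‖x t‖ := by
  intro t ht
  have hAΛ : ∀ i, ‖A i‖ ≤ Λ := fun i => by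
    rw [hΛdef]
    exact Finset.le_sup' (fun p => ‖A p‖) (Finset.mem_univ i)
  have hsub : ∀ k < M, Set.Icc (s k) (s (k + 1)) ⊆ Set.Icc 0 Ts := fun k hk => by
    have h1 := qeb_mono s M hsmono 0 k (by omega) (by omega)
    have h2 := qeb_mono s M hsmono (k + 1) M (by omega) (by omega)
    rw [hs0] at h1
    rw [hsM] at h2
    exact Set.Icc_subset_Icc h1 h2
  have hd : ∀ k < M, ∀ u ∈ Set.Ioo (s k) (s (k + 1)),
      HasDerivAt x (A (σ (s k)) (x u) + (B (σ (s k))) ((K (σ 0)) (Q (x 0)))) u := by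
    intro k hk u hu
    have h := hx' k hk u hu
    rwa [hσconst k hk u ⟨hu.1.le, hu.2⟩] at h
  have hR : ∀ τ, ∃ i : ι, τ ∈ Set.Ico 0 Ts →
      HasDerivWithinAt x (A i (x τ) + B i (K (σ 0) (Q (x 0)))) (Set.Ici τ) τ := by
    intro τ
    by_cases hτ : τ ∈ Set.Ico 0 Ts
    · obtain ⟨k, hk, h1, h2⟩ := qeb_find_right s M τ (hs0 ▸ hτ.1) (hsM ▸ hτ.2)
      exact ⟨σ (s k), fun _ => qeb_right_deriv _ _ x (s k) (s (k + 1)) τ ⟨h1, h2⟩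
        (hxc.mono (hsub k hk)) (hd k hk)⟩
    · exact ⟨p, fun h => absurd h hτ⟩
  have hL : ∀ τ, ∃ i : ι, τ ∈ Set.Ioc 0 Ts →
      HasDerivWithinAt x (A i (x τ) + B i (K (σ 0) (Q (x 0)))) (Set.Iic τ) τ := by
    intro τ
    by_cases hτ : τ ∈ Set.Ioc 0 Ts
    · obtain ⟨k, hk, h1, h2⟩ := qeb_find_left s M τ (hs0 ▸ hτ.1) (hsM ▸ hτ.2)
      exact ⟨σ (s k), fun _ => qeb_left_deriv _ _ x (s k) (s (k + 1)) τ ⟨h1, h2⟩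
        (hxc.mono (hsub k hk)) (hd k hk)⟩
    · exact ⟨p, fun h => absurd h hτ⟩
  choose r hr using hR
  choose l hl using hL
  have hnorm : ∀ i y, ‖A i y + B i (K (σ 0) (Q (x 0)))‖ ≤ Λ * ‖y‖ + α₀ * ‖x 0‖ := by
    intro i y
    refine (norm_add_le _ _).trans (add_le_add ?_ (hquant i))
    exact ((A i).le_opNorm y).trans (mul_le_mul_of_nonneg_right (hAΛ i) (norm_nonneg _))
  have hct : ContinuousOn x (Set.Icc 0 t) := hxc.mono (Set.Icc_subset_Icc le_rfl ht.2.le)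
  have hexp : Real.exp (Λ * t) ≤ Real.exp (Λ * Ts) :=
    Real.exp_le_exp.mpr (mul_le_mul_of_nonneg_left ht.2.le hΛ.le)
  -- forward estimate
  have hF : ‖x t - x 0‖ ≤ β₁ * ‖x 0‖ := by
    have h := norm_le_gronwallBound_of_norm_deriv_right_le (f := fun τ => x τ - x 0)
      (f' := fun τ => A (r τ) (x τ) + B (r τ) (K (σ 0) (Q (x 0))))
      (δ := 0) (K := Λ) (ε := (Λ + α₀) * ‖x 0‖) (a := 0) (b := t)
      (hct.sub continuousOn_const)
      (fun τ hτ => (hr τ ⟨hτ.1, hτ.2.trans ht.2⟩).sub_const _) (by simp)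
      (fun τ hτ => by
        refine (hnorm (r τ) (x τ)).trans ?_
        have h3 : ‖x τ‖ ≤ ‖x τ - x 0‖ + ‖x 0‖ := by
          simpa using norm_add_le (x τ - x 0) (x 0)
        nlinarith [mul_le_mul_of_nonneg_left h3 hΛ.le]) t ⟨ht.1, le_rfl⟩
    rw [gronwallBound_of_K_ne_0 hΛ.ne'] at h
    simp only [zero_mul, zero_add, sub_zero] at h
    refine h.trans ?_
    rw [hβ₁]
    have h4 : (Λ + α₀) * ‖x 0‖ / Λ = (1 + α₀ / Λ) * ‖x 0‖ := by field_simp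
    rw [h4]
    have h5 : 0 ≤ (1 + α₀ / Λ) * ‖x 0‖ := by positivity
    nlinarith [mul_le_mul_of_nonneg_left hexp h5]
  -- backward estimate
  have hB : ‖x 0‖ ≤ α₁ * ‖x t‖ := by
    have h := norm_le_gronwallBound_of_norm_deriv_right_le (f := fun τ => x (t - τ))
      (f' := fun τ => -(A (l (t - τ)) (x (t - τ)) + B (l (t - τ)) (K (σ 0) (Q (x 0)))))
      (δ := ‖x t‖) (K := Λ) (ε := α₀ * ‖x 0‖) (a := 0) (b := t)
      (hct.comp (by fun_prop) (fun τ hτ => ⟨by linarith [hτ.2], by linarith [hτ.1]⟩))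
      (fun τ hτ => by
        have h1 := hl (t - τ) ⟨by linarith [hτ.2], by linarith [hτ.1, ht.2]⟩
        have h2 : HasDerivWithinAt (fun u : ℝ => t - u) (-1) (Set.Ici τ) τ :=
          ((hasDerivAt_id τ).const_sub t).hasDerivWithinAt
        have h3 := HasDerivWithinAt.scomp τ h1 h2 (fun u hu => by
          simp only [Set.mem_Ici, Set.mem_Iic] at *
          linarith)
        rw [neg_one_smul] at h3
        exact h3) (by simp)
      (fun τ hτ => by
        rw [norm_neg]
        exact hnorm _ _) t ⟨ht.1, le_rfl⟩
    rw [gronwallBound_of_K_ne_0 hΛ.ne'] at h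
    simp only [sub_self, sub_zero] at h
    have h5 : α₀ * ‖x 0‖ / Λ * (Real.exp (Λ * t) - 1) ≤ η * ‖x 0‖ := by
      have h6 : η * ‖x 0‖ = α₀ * ‖x 0‖ / Λ * (Real.exp (Λ * Ts) - 1) := by
        rw [hη]
        ring
      rw [h6]
      exact mul_le_mul_of_nonneg_left (by linarith) (by positivity)
    have h7 := mul_le_mul_of_nonneg_left hexp (norm_nonneg (x t))
    rw [hα₁, div_mul_eq_mul_div, le_div_iff₀ (by linarith)]
    linarith
  set G := P.comp ((B p).comp (K q)) with hG
  have hβ : 0 ≤ β₁ := by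
    have : 1 ≤ Real.exp (Λ * Ts) := Real.one_le_exp (by positivity)
    rw [hβ₁]
    exact mul_nonneg (by linarith) (by positivity)
  have e : Q (x 0) - x t = (Q (x 0) - x 0) - (x t - x 0) := by abel
  calc ‖G (Q (x 0) - x t)‖ = ‖G (Q (x 0) - x 0) - G (x t - x 0)‖ := by rw [e, map_sub]
    _ ≤ ‖G (Q (x 0) - x 0)‖ + ‖G (x t - x 0)‖ := norm_sub_le _ _
    _ ≤ γ₀ * ‖x 0‖ + ‖G‖ * (β₁ * ‖x 0‖) := add_le_add hγ₀bound
        ((G.le_opNorm _).trans (mul_le_mul_of_nonneg_left hF (norm_nonneg _)))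
    _ = (β₁ * ‖G‖ + γ₀) * ‖x 0‖ := by ring
    _ ≤ (β₁ * ‖G‖ + γ₀) * (α₁ * ‖x t‖) := mul_le_mul_of_nonneg_left hB (by positivity)
    _ = γ * ‖x t‖ := by
      rw [hγ]
      ring
end

section
/- Suppose Λ > 0, let α₀ > 0 satisfy ‖B_{p'} K_{σ(0)} Q(x(0))‖ ≤ α₀‖x(0)‖ for every p' ∈ 𝒫, suppose η := α₀(e^{ΛT_s} − 1)/Λ < 1, and set α₁ := e^{ΛT_s}/(1 − η) and β₁ := (e^{ΛT_s} − 1)(1 + α₀/Λ). Let t ∈ [0, T_s), set p := σ(t) and q := σ(0), and suppose p ≠ q. Let γ₀ > 0 satisfy ‖P B_p K_q (Q(x(0)) − x(0))‖ ≤ γ₀‖x(0)‖, set γ := α₁(β₁‖P B_p K_q‖ + γ₀), and set D := 2(‖P(A_p + B_p K_q)‖ + γ). Then every trajectory x of the switched system satisfies 2⟨x(t), P(A_p x(t) + B_p K_q Q(x(0)))⟩ ≤ D‖x(t)‖², i.e. the time derivative of the Lyapunov function V(y) = yᵀP y along the closed-loop vector field with mismatched controller mode is at most D‖x(t)‖².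 -/
open scoped RealInnerProductSpace


section Helpers
open Set Filter Topology

variable {E : Type*} [NormedAddCommGroup E] [NormedSpace ℝ E]

lemma aux_right {x : ℝ → E} {L : E →L[ℝ] E} {c : E} {a b τ : ℝ}
    (hc : ContinuousOn x (Icc a b))
    (hd : ∀ u ∈ Ioo a b, HasDerivAt x (L (x u) + c) u) (hτ : τ ∈ Ico a b) :
    HasDerivWithinAt x (L (x τ) + c) (Ici τ) τ := by
  have hsub : Ioo τ b ⊆ Ioo a b := Ioo_subset_Ioo_left hτ.1
  have hmem : Ioo τ b ∈ 𝓝[>] τ := Ioo_mem_nhdsGT hτ.2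
  have hcw : ContinuousWithinAt x (Ioo τ b) τ :=
    (hc τ ⟨hτ.1, hτ.2.le⟩).mono (hsub.trans Ioo_subset_Icc_self)
  refine hasDerivWithinAt_Ici_of_tendsto_deriv (s := Ioo τ b)
    (fun u hu => (hd u (hsub hu)).differentiableAt.differentiableWithinAt) hcw hmem ?_
  have h1 : Tendsto x (𝓝[>] τ) (𝓝 (x τ)) := by
    rw [← nhdsWithin_Ioo_eq_nhdsGT hτ.2]; exact hcw
  have h2 : Tendsto (fun u => L (x u) + c) (𝓝[>] τ) (𝓝 (L (x τ) + c)) :=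
    ((L.continuous.tendsto _).comp h1).add_const c
  refine h2.congr' ?_
  filter_upwards [hmem] with u hu
  exact (hd u (hsub hu)).deriv.symm

lemma aux_left {x : ℝ → E} {L : E →L[ℝ] E} {c : E} {a b τ : ℝ}
    (hc : ContinuousOn x (Icc a b))
    (hd : ∀ u ∈ Ioo a b, HasDerivAt x (L (x u) + c) u) (hτ : τ ∈ Ioc a b) :
    HasDerivWithinAt x (L (x τ) + c) (Iic τ) τ := by
  have hsub : Ioo a τ ⊆ Ioo a b := Ioo_subset_Ioo_right hτ.2
  have hmem : Ioo a τ ∈ 𝓝[<] τ := Ioo_mem_nhdsLT hτ.1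
  have hcw : ContinuousWithinAt x (Ioo a τ) τ :=
    (hc τ ⟨hτ.1.le, hτ.2⟩).mono (hsub.trans Ioo_subset_Icc_self)
  refine hasDerivWithinAt_Iic_of_tendsto_deriv (s := Ioo a τ)
    (fun u hu => (hd u (hsub hu)).differentiableAt.differentiableWithinAt) hcw hmem ?_
  have h1 : Tendsto x (𝓝[<] τ) (𝓝 (x τ)) := by
    rw [← nhdsWithin_Ioo_eq_nhdsLT hτ.1]; exact hcw
  have h2 : Tendsto (fun u => L (x u) + c) (𝓝[<] τ) (𝓝 (L (x τ) + c)) :=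
    ((L.continuous.tendsto _).comp h1).add_const c
  refine h2.congr' ?_
  filter_upwards [hmem] with u hu
  exact (hd u (hsub hu)).deriv.symm

lemma aux_loc_Ico (s : ℕ → ℝ) (τ : ℝ) (M : ℕ) (h : τ ∈ Ico (s 0) (s M)) :
    ∃ k < M, τ ∈ Ico (s k) (s (k + 1)) := by
  induction M with
  | zero => exact absurd h.2 (not_lt.2 h.1)
  | succ N ih =>
    rcases lt_or_ge τ (s N) with h1 | h1
    · obtain ⟨k, hk, hk'⟩ := ih ⟨h.1, h1⟩
      exact ⟨k, by omega, hk'⟩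
    · exact ⟨N, by omega, h1, h.2⟩

lemma aux_loc_Ioc (s : ℕ → ℝ) (τ : ℝ) (M : ℕ) (h : τ ∈ Ioc (s 0) (s M)) :
    ∃ k < M, τ ∈ Ioc (s k) (s (k + 1)) := by
  induction M with
  | zero => exact absurd h.1 (not_lt.2 h.2)
  | succ N ih =>
    rcases le_or_gt τ (s N) with h1 | h1
    · obtain ⟨k, hk, hk'⟩ := ih ⟨h.1, h1⟩
      exact ⟨k, by omega, hk'⟩
    · exact ⟨N, by omega, h1, h.2⟩

lemma aux_mono (s : ℕ → ℝ) (M : ℕ) (h : ∀ k < M, s k < s (k + 1)) (j k : ℕ)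
    (hjk : j ≤ k) (hk : k ≤ M) : s j ≤ s k := by
  induction k, hjk using Nat.le_induction with
  | base => exact le_rfl
  | succ k _ ih => exact (ih (by omega)).trans (h k (by omega)).le

end Helpers

/-- Theorem 1 of the paper.  Along a trajectory of the quantized sampled-data switched
system `x' = A_{σ(τ)} x + B_{σ(τ)} K_{σ(0)} Q(x(0))` on a sampling interval `[0, Ts)`,
if at time `t ∈ [0, Ts)` the plant mode `p = σ(t)` differs from the controller mode
`q = σ(0)`, then the time derivative of the Lyapunov function `V(y) = yᵀ P y`, namely
`2⟨x(t), P(A_p x(t) + B_p K_q Q(x(0)))⟩`, is at most `D ‖x(t)‖²`, where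
`D := 2(‖P(A_p + B_p K_q)‖ + γ)` and `γ := α₁ (β₁ ‖P B_p K_q‖ + γ₀)`. -/
theorem lyapunov_growth_rate_mismatch {n m : ℕ} {ι : Type*} [Fintype ι] [Nonempty ι]
    (A : ι → (EuclideanSpace ℝ (Fin n) →L[ℝ] EuclideanSpace ℝ (Fin n)))
    (B : ι → (EuclideanSpace ℝ (Fin m) →L[ℝ] EuclideanSpace ℝ (Fin n)))
    (K : ι → (EuclideanSpace ℝ (Fin n) →L[ℝ] EuclideanSpace ℝ (Fin m)))
    (P : EuclideanSpace ℝ (Fin n) →L[ℝ] EuclideanSpace ℝ (Fin n))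
    (hPsym : ∀ y z : EuclideanSpace ℝ (Fin n), ⟪P y, z⟫ = ⟪y, P z⟫)
    (hPpos : ∀ y : EuclideanSpace ℝ (Fin n), y ≠ 0 → 0 < ⟪y, P y⟫)
    (Q : EuclideanSpace ℝ (Fin n) → EuclideanSpace ℝ (Fin n))
    (Λ : ℝ) (hΛdef : Λ = Finset.univ.sup' Finset.univ_nonempty fun p => ‖A p‖)
    (hΛ : 0 < Λ)
    (Ts : ℝ) (hTs : 0 < Ts)
    (σ : ℝ → ι) (M : ℕ) (s : ℕ → ℝ) (hs0 : s 0 = 0) (hsM : s M = Ts)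
    (hsmono : ∀ k < M, s k < s (k + 1))
    (hσconst : ∀ k < M, ∀ τ ∈ Set.Ico (s k) (s (k + 1)), σ τ = σ (s k))
    (x : ℝ → EuclideanSpace ℝ (Fin n))
    (hxc : ContinuousOn x (Set.Icc 0 Ts))
    (hx' : ∀ k < M, ∀ τ ∈ Set.Ioo (s k) (s (k + 1)),
      HasDerivAt x (A (σ τ) (x τ) + (B (σ τ)) ((K (σ 0)) (Q (x 0)))) τ)
    (α₀ : ℝ) (hα₀ : 0 < α₀)
    (hquant : ∀ p' : ι, ‖(B p') ((K (σ 0)) (Q (x 0)))‖ ≤ α₀ * ‖x 0‖)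
    (η : ℝ) (hη : η = α₀ * (Real.exp (Λ * Ts) - 1) / Λ) (hη1 : η < 1)
    (α₁ : ℝ) (hα₁ : α₁ = Real.exp (Λ * Ts) / (1 - η))
    (β₁ : ℝ) (hβ₁ : β₁ = (Real.exp (Λ * Ts) - 1) * (1 + α₀ / Λ))
    (t : ℝ) (ht : t ∈ Set.Ico (0 : ℝ) Ts)
    (p q : ι) (hp : p = σ t) (hq : q = σ 0) (hpq : p ≠ q)
    (γ₀ : ℝ) (hγ₀ : 0 < γ₀)
    (hγ₀bound : ‖(P.comp ((B p).comp (K q))) (Q (x 0) - x 0)‖ ≤ γ₀ * ‖x 0‖)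
    (γ : ℝ) (hγ : γ = α₁ * (β₁ * ‖P.comp ((B p).comp (K q))‖ + γ₀))
    (D : ℝ) (hD : D = 2 * (‖P.comp (A p + (B p).comp (K q))‖ + γ)) :
    2 * ⟪x t, P (A p (x t) + (B p) ((K q) (Q (x 0))))⟫ ≤ D * ‖x t‖ ^ 2 := by
  have hAΛ : ∀ i, ‖A i‖ ≤ Λ := fun i => by
    rw [hΛdef]; exact Finset.le_sup' (fun p => ‖A p‖) (Finset.mem_univ i)
  set c : ι → EuclideanSpace ℝ (Fin n) := fun i => B i (K (σ 0) (Q (x 0))) with hcdef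
  have hcb : ∀ i, ‖c i‖ ≤ α₀ * ‖x 0‖ := hquant
  have hAb : ∀ i y, ‖A i y‖ ≤ Λ * ‖y‖ := fun i y =>
    (A i).le_of_opNorm_le (hAΛ i) y
  have hck : ∀ k < M, ContinuousOn x (Set.Icc (s k) (s (k + 1))) := fun k hk => by
    refine hxc.mono (Set.Icc_subset_Icc ?_ ?_)
    · rw [← hs0]; exact aux_mono s M hsmono 0 k (Nat.zero_le _) hk.le
    · rw [← hsM]; exact aux_mono s M hsmono (k + 1) M hk le_rfl
  have hdk : ∀ k < M, ∀ u ∈ Set.Ioo (s k) (s (k + 1)),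
      HasDerivAt x (A (σ (s k)) (x u) + c (σ (s k))) u := fun k hk u hu => by
    have := hx' k hk u hu
    rwa [hσconst k hk u ⟨hu.1.le, hu.2⟩] at this
  have hR : ∀ τ, ∃ i, τ ∈ Set.Ico 0 Ts →
      HasDerivWithinAt x (A i (x τ) + c i) (Set.Ici τ) τ := fun τ => by
    by_cases h : τ ∈ Set.Ico 0 Ts
    · rw [← hs0, ← hsM] at h
      obtain ⟨k, hk, hk'⟩ := aux_loc_Ico s τ M h
      exact ⟨σ (s k), fun _ => aux_right (hck k hk) (hdk k hk) hk'⟩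
    · exact ⟨σ 0, fun h' => absurd h' h⟩
  have hL : ∀ τ, ∃ i, τ ∈ Set.Ioc 0 Ts →
      HasDerivWithinAt x (A i (x τ) + c i) (Set.Iic τ) τ := fun τ => by
    by_cases h : τ ∈ Set.Ioc 0 Ts
    · rw [← hs0, ← hsM] at h
      obtain ⟨k, hk, hk'⟩ := aux_loc_Ioc s τ M h
      exact ⟨σ (s k), fun _ => aux_left (hck k hk) (hdk k hk) hk'⟩
    · exact ⟨σ 0, fun h' => absurd h' h⟩
  choose r hr using hR
  choose l hl using hL
  have hexp : Real.exp (Λ * t) ≤ Real.exp (Λ * Ts) :=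
    Real.exp_le_exp.2 (mul_le_mul_of_nonneg_left ht.2.le hΛ.le)
  have hexp1 : 1 ≤ Real.exp (Λ * Ts) := Real.one_le_exp (by positivity)
  have hx0 := norm_nonneg (x 0)
  have hxt := norm_nonneg (x t)
  -- forward estimate
  have hfwd : ‖x t - x 0‖ ≤ β₁ * ‖x 0‖ := by
    have key := norm_le_gronwallBound_of_norm_deriv_right_le (f := fun τ => x τ - x 0)
      (f' := fun τ => A (r τ) (x τ) + c (r τ)) (δ := 0) (K := Λ) (ε := (Λ + α₀) * ‖x 0‖)
      (a := 0) (b := Ts) (hxc.sub continuousOn_const)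
      (fun τ hτ => (hr τ hτ).sub_const _) (by simp)
      (fun τ hτ => by
        have e : A (r τ) (x τ) + c (r τ) = A (r τ) (x τ - x 0) + A (r τ) (x 0) + c (r τ) := by
          rw [map_sub]; abel
        have h3 := norm_add₃_le (a := A (r τ) (x τ - x 0)) (b := A (r τ) (x 0)) (c := c (r τ))
        have h4 := hAb (r τ) (x τ - x 0)
        have h5 := hAb (r τ) (x 0)
        have h6 := hcb (r τ)
        simp only [e]
        linarith)
      t ⟨ht.1, ht.2.le⟩
    rw [gronwallBound_of_K_ne_0 hΛ.ne'] at key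
    simp only [sub_zero, zero_mul, zero_add] at key
    refine key.trans ?_
    rw [hβ₁]
    have e : (Λ + α₀) * ‖x 0‖ / Λ * (Real.exp (Λ * t) - 1)
        = (Real.exp (Λ * t) - 1) * (1 + α₀ / Λ) * ‖x 0‖ := by
      field_simp
    rw [e]
    gcongr
  -- backward estimate
  have hbwd : ‖x 0‖ ≤ α₁ * ‖x t‖ := by
    have key := norm_le_gronwallBound_of_norm_deriv_right_le (f := fun τ => x (t - τ))
      (f' := fun τ => (-1 : ℝ) • (A (l (t - τ)) (x (t - τ)) + c (l (t - τ))))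
      (δ := ‖x t‖) (K := Λ) (ε := α₀ * ‖x 0‖)
      (a := 0) (b := t)
      (hxc.comp (by fun_prop) (fun τ hτ => ⟨by linarith [hτ.2], by linarith [hτ.1, ht.2]⟩))
      (fun τ hτ => by
        have h1 := hl (t - τ) ⟨by linarith [hτ.2], by linarith [hτ.1, ht.2]⟩
        have h2 : HasDerivWithinAt (fun u : ℝ => t - u) (-1) (Set.Ici τ) τ :=
          ((hasDerivAt_id τ).const_sub t).hasDerivWithinAt
        exact HasDerivWithinAt.scomp τ h1 h2 (fun u hu => by
          have : τ ≤ u := hu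
          show t - u ≤ t - τ
          linarith))
      (by simp)
      (fun τ hτ => by
        have h3 := norm_add_le (A (l (t - τ)) (x (t - τ))) (c (l (t - τ)))
        have h4 := hAb (l (t - τ)) (x (t - τ))
        have h6 := hcb (l (t - τ))
        rw [neg_one_smul, norm_neg]
        linarith)
      t ⟨ht.1, le_rfl⟩
    rw [gronwallBound_of_K_ne_0 hΛ.ne'] at key
    simp only [sub_zero, sub_self] at key
    have h1 : ‖x t‖ * Real.exp (Λ * t) ≤ ‖x t‖ * Real.exp (Λ * Ts) := by gcongr
    have h2 : α₀ * ‖x 0‖ / Λ * (Real.exp (Λ * t) - 1) ≤ η * ‖x 0‖ := by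
      have e : η * ‖x 0‖ = α₀ * ‖x 0‖ / Λ * (Real.exp (Λ * Ts) - 1) := by
        rw [hη]; field_simp
      rw [e]; gcongr
    rw [hα₁, div_mul_eq_mul_div, le_div_iff₀ (by linarith)]
    linarith
  set W := P.comp ((B p).comp (K q)) with hW
  set N := P.comp (A p + (B p).comp (K q)) with hN
  have hβ0 : 0 ≤ β₁ := by
    rw [hβ₁]; exact mul_nonneg (by linarith) (by positivity)
  have e : P (A p (x t) + (B p) ((K q) (Q (x 0))))
      = N (x t) + W (x 0 - x t) + W (Q (x 0) - x 0) := by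
    simp only [hN, hW, ContinuousLinearMap.comp_apply, ContinuousLinearMap.add_apply, map_add,
      map_sub]
    abel
  have hn : ‖P (A p (x t) + (B p) ((K q) (Q (x 0))))‖ ≤ (‖N‖ + γ) * ‖x t‖ := by
    rw [e]
    have h1 := norm_add₃_le (a := N (x t)) (b := W (x 0 - x t)) (c := W (Q (x 0) - x 0))
    have h2 := N.le_opNorm (x t)
    have h3 := W.le_opNorm (x 0 - x t)
    rw [norm_sub_rev] at h3
    have h4 : ‖W‖ * ‖x t - x 0‖ ≤ ‖W‖ * (β₁ * ‖x 0‖) := by gcongr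
    have h5 : (β₁ * ‖W‖ + γ₀) * ‖x 0‖ ≤ (β₁ * ‖W‖ + γ₀) * (α₁ * ‖x t‖) := by gcongr
    rw [hγ]
    linarith
  have hi := real_inner_le_norm (x t) (P (A p (x t) + (B p) ((K q) (Q (x 0)))))
  have h6 := mul_le_mul_of_nonneg_left hn hxt
  rw [hD]
  linarith
end

section
/- Let L ∈ [0, C_P/(C_P + D_P)). Suppose μ(t, 0) ≤ L·t for every t > 0 and W(0) < R²·λ_max(P). Then there exists T_r ≥ 0 such that W(T_r) ≤ r²·λ_min(P), and W(t) < R²·λ_max(P) for all t ∈ [0, T_r]. -/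
open scoped RealInnerProductSpace

/-- On an interval where `W > 0` and `W' ≤ c W` in the interior, `log W - c t` does not grow. -/
lemma log_growth_aux (W : ℝ → ℝ) (hWc : Continuous W) (c a b : ℝ) (hab : a ≤ b)
    (hpos : ∀ s ∈ Set.Icc a b, 0 < W s)
    (hd : ∀ s ∈ Set.Ioo a b, ∃ W', HasDerivAt W W' s ∧ W' ≤ c * W s) :
    Real.log (W b) ≤ Real.log (W a) + c * (b - a) := by
  have hder : ∀ s ∈ Set.Ioo a b, ∃ f', HasDerivAt (fun s => Real.log (W s) - c * s) f' s ∧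
      f' ≤ 0 := by
    intro s hs
    obtain ⟨W', h1, h2⟩ := hd s hs
    have hp := hpos s ⟨hs.1.le, hs.2.le⟩
    refine ⟨W' / W s - c * 1, (h1.log hp.ne').sub ((hasDerivAt_id s).const_mul c), ?_⟩
    have : W' / W s ≤ c := by rw [div_le_iff₀ hp]; exact h2
    linarith
  have key : AntitoneOn (fun s => Real.log (W s) - c * s) (Set.Icc a b) := by
    apply antitoneOn_of_deriv_nonpos (convex_Icc a b)
    · apply ContinuousOn.sub
      · exact hWc.continuousOn.log (fun s hs => (hpos s hs).ne')
      · fun_prop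
    · intro s hs
      rw [interior_Icc] at hs
      obtain ⟨f', h1, _⟩ := hder s hs
      exact h1.differentiableAt.differentiableWithinAt
    · intro s hs
      rw [interior_Icc] at hs
      obtain ⟨f', h1, h2⟩ := hder s hs
      rw [h1.deriv]; exact h2
  have := key (Set.left_mem_Icc.2 hab) (Set.right_mem_Icc.2 hab) hab
  simp only at this
  linarith

/-- The mismatch measure is finite. -/
lemma mis_fin (p : ℝ → Prop) (a b : ℝ) :
    MeasureTheory.volume {τ ∈ Set.Ico a b | p τ} ≠ ⊤ :=
  ne_top_of_le_ne_top (by simp : MeasureTheory.volume (Set.Ico a b) ≠ ⊤)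
    (MeasureTheory.measure_mono (fun _ h => h.1))

lemma mis_mono (p : ℝ → Prop) (a b : ℝ) (hab : a ≤ b) :
    (MeasureTheory.volume {τ ∈ Set.Ico 0 a | p τ}).toReal ≤
      (MeasureTheory.volume {τ ∈ Set.Ico 0 b | p τ}).toReal :=
  ENNReal.toReal_mono (mis_fin p 0 b)
    (MeasureTheory.measure_mono (fun _ h => ⟨⟨h.1.1, h.1.2.trans_le hab⟩, h.2⟩))

lemma mis_le (p : ℝ → Prop) (a b : ℝ) (hab : a ≤ b) :
    (MeasureTheory.volume {τ ∈ Set.Ico 0 b | p τ}).toReal ≤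
      (MeasureTheory.volume {τ ∈ Set.Ico 0 a | p τ}).toReal + (b - a) := by
  have h : MeasureTheory.volume {τ ∈ Set.Ico 0 b | p τ} ≤
      MeasureTheory.volume {τ ∈ Set.Ico 0 a | p τ} + MeasureTheory.volume (Set.Ico a b) := by
    refine le_trans (MeasureTheory.measure_mono ?_) (MeasureTheory.measure_union_le _ _)
    rintro τ ⟨⟨h1, h2⟩, h3⟩
    by_cases h : τ < a
    · exact Or.inl ⟨⟨h1, h⟩, h3⟩
    · exact Or.inr ⟨not_lt.1 h, h2⟩
  have h2 := ENNReal.toReal_mono (ENNReal.add_ne_top.2 ⟨mis_fin p 0 a, by simp⟩) h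
  rw [ENNReal.toReal_add (mis_fin p 0 a) (by simp), Real.volume_Ico,
    ENNReal.toReal_ofReal (by linarith)] at h2
  exact h2

lemma mis_ge (p : ℝ → Prop) (a b : ℝ) (ha : 0 ≤ a) (hab : a ≤ b)
    (hp : ∀ s ∈ Set.Ico a b, p s) :
    (MeasureTheory.volume {τ ∈ Set.Ico 0 a | p τ}).toReal + (b - a) ≤
      (MeasureTheory.volume {τ ∈ Set.Ico 0 b | p τ}).toReal := by
  have h : MeasureTheory.volume {τ ∈ Set.Ico 0 a | p τ} + MeasureTheory.volume (Set.Ico a b) ≤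
      MeasureTheory.volume {τ ∈ Set.Ico 0 b | p τ} := by
    rw [← MeasureTheory.measure_union _ measurableSet_Ico]
    · apply MeasureTheory.measure_mono
      rintro τ (⟨⟨h1, h2⟩, h3⟩ | h)
      · exact ⟨⟨h1, h2.trans_le hab⟩, h3⟩
      · exact ⟨⟨ha.trans h.1, h.2⟩, hp τ h⟩
    · rw [Set.disjoint_left]
      rintro τ ⟨⟨h1, h2⟩, h3⟩ h
      exact absurd h.1 (not_le.2 h2)
  have h2 := ENNReal.toReal_mono (mis_fin p 0 b) h
  rw [ENNReal.toReal_add (mis_fin p 0 a) (by simp), Real.volume_Ico,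
    ENNReal.toReal_ofReal (by linarith)] at h2
  exact h2

lemma mis_cont (p : ℝ → Prop) :
    Continuous (fun t : ℝ => (MeasureTheory.volume {τ ∈ Set.Ico 0 t | p τ}).toReal) := by
  refine (LipschitzWith.of_le_add (fun a b => ?_)).continuous
  rcases le_total a b with h | h
  · exact (mis_mono p a b h).trans (le_add_of_nonneg_right dist_nonneg)
  · have := mis_le p b a h
    rwa [Real.dist_eq, abs_of_nonneg (by linarith)]

/-- Lemma 4 of the paper.  With sampling period `Ts > 0`, a piecewise-constant
switching signal `σ`, total mismatch time `μ`, and the Lyapunov function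
`W(t) = x(t)ᵀ P x(t)` decaying at rate `C_P` under mode match (outside
`{W ≤ r²λ_min(P)}`) and growing at rate at most `D_P` under mode mismatch: if
`L ∈ [0, C_P/(C_P+D_P))`, `μ(t,0) ≤ L t` for all `t > 0`, and `W(0) < R²λ_max(P)`,
then there exists `T_r ≥ 0` with `W(T_r) ≤ r²λ_min(P)` and `W(t) < R²λ_max(P)`
for all `t ∈ [0, T_r]`. -/
theorem reach_small_level_set {n : ℕ} {ι : Type*} [Fintype ι] [Nonempty ι]
    (Ts : ℝ) (hTs : 0 < Ts)
    (smp : ℝ → ℝ) (hsmp : ∀ t, smp t = Ts * (⌊t / Ts⌋ : ℝ))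
    (σ : ℝ → ι)
    (tk : ℕ → ℝ) (htk0 : tk 0 = 0) (htkmono : StrictMono tk)
    (htktop : Filter.Tendsto tk Filter.atTop Filter.atTop)
    (hconst : ∀ k, ∀ s ∈ Set.Ico (tk k) (tk (k + 1)), σ s = σ (tk k))
    (μ : ℝ → ℝ → ℝ)
    (hμ : ∀ t₁ t₂ : ℝ, μ t₁ t₂ =
      (MeasureTheory.volume {τ ∈ Set.Ico t₂ t₁ | σ τ ≠ σ (smp τ)}).toReal)
    (CP DP R r : ℝ) (hCP : 0 < CP) (hDP : 0 < DP) (hr : 0 < r) (hrR : r < R)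
    (P : EuclideanSpace ℝ (Fin n) →L[ℝ] EuclideanSpace ℝ (Fin n))
    (hPsym : ∀ y z : EuclideanSpace ℝ (Fin n), ⟪P y, z⟫ = ⟪y, P z⟫)
    (lmin lmax : ℝ) (hlminpos : 0 < lmin)
    (hlmin₁ : ∀ y : EuclideanSpace ℝ (Fin n), lmin * ‖y‖ ^ 2 ≤ ⟪y, P y⟫)
    (hlmin₂ : ∃ y : EuclideanSpace ℝ (Fin n), y ≠ 0 ∧ ⟪y, P y⟫ = lmin * ‖y‖ ^ 2)
    (hlmax₁ : ∀ y : EuclideanSpace ℝ (Fin n), ⟪y, P y⟫ ≤ lmax * ‖y‖ ^ 2)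
    (hlmax₂ : ∃ y : EuclideanSpace ℝ (Fin n), y ≠ 0 ∧ ⟪y, P y⟫ = lmax * ‖y‖ ^ 2)
    (x : ℝ → EuclideanSpace ℝ (Fin n)) (hx : Continuous x)
    (W : ℝ → ℝ) (hW : ∀ t, W t = ⟪x t, P (x t)⟫)
    (hderiv : ∀ t > (0 : ℝ), (∀ k, t ≠ tk k) → (∀ k : ℕ, t ≠ (k : ℝ) * Ts) →
      ∃ W', HasDerivAt W W' t ∧
        (σ t = σ (smp t) → r ^ 2 * lmin < W t → W' ≤ -CP * W t) ∧
        (σ t ≠ σ (smp t) → W' ≤ DP * W t))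
    (L : ℝ) (hL : L ∈ Set.Ico 0 (CP / (CP + DP)))
    (hμL : ∀ t > (0 : ℝ), μ t 0 ≤ L * t)
    (hW0 : W 0 < R ^ 2 * lmax) :
    ∃ Tr ≥ (0 : ℝ), W Tr ≤ r ^ 2 * lmin ∧
      ∀ t ∈ Set.Icc 0 Tr, W t < R ^ 2 * lmax := by
  have hWc : Continuous W := by
    have : W = fun t => ⟪x t, P (x t)⟫ := funext hW
    rw [this]
    exact hx.inner (P.continuous.comp hx)
  have hm : 0 < r ^ 2 * lmin := by positivity
  have hll : lmin ≤ lmax := by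
    obtain ⟨y, hy, hy2⟩ := hlmin₂
    have h1 := hlmax₁ y
    rw [hy2] at h1
    have : 0 < ‖y‖ ^ 2 := by positivity
    exact le_of_mul_le_mul_right h1 this
  have hsmall : r ^ 2 * lmin < R ^ 2 * lmax := by
    have : r ^ 2 < R ^ 2 := by nlinarith
    nlinarith [sq_nonneg R]
  -- the mode structure to the right of any time
  have hlocal : ∀ t ≥ (0 : ℝ), ∃ e > t,
      (∀ s ∈ Set.Ico t e, σ s = σ t ∧ smp s = smp t) ∧
      ∀ s ∈ Set.Ioo t e, (∀ k, s ≠ tk k) ∧ (∀ k : ℕ, s ≠ (k : ℝ) * Ts) := by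
    intro t ht
    have hex : ∃ k, t < tk k := (htktop.eventually_gt_atTop t).exists
    obtain ⟨k, hk1, hk2⟩ : ∃ k, tk k ≤ t ∧ t < tk (k + 1) := by
      classical
      have h1 := Nat.find_spec hex
      have h2 : Nat.find hex ≠ 0 := by
        intro h0
        rw [h0, htk0] at h1
        linarith
      obtain ⟨k, hk⟩ := Nat.exists_eq_succ_of_ne_zero h2
      refine ⟨k, not_lt.1 (Nat.find_min hex (by omega)), ?_⟩
      rw [hk] at h1
      exact h1
    have hm1 : (⌊t / Ts⌋ : ℝ) ≤ t / Ts := Int.floor_le _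
    have hm2 : t / Ts < ⌊t / Ts⌋ + 1 := Int.lt_floor_add_one _
    have hfl : ∀ s, t ≤ s → s < (⌊t / Ts⌋ + 1) * Ts → ⌊s / Ts⌋ = ⌊t / Ts⌋ := by
      intro s h1 h2
      rw [Int.floor_eq_iff]
      refine ⟨hm1.trans (by gcongr), ?_⟩
      rwa [div_lt_iff₀ hTs]
    refine ⟨min (tk (k + 1)) ((⌊t / Ts⌋ + 1) * Ts), ?_, ?_, ?_⟩
    · exact lt_min hk2 ((div_lt_iff₀ hTs).1 hm2)
    · rintro s ⟨h1, h2⟩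
      rw [lt_min_iff] at h2
      refine ⟨?_, ?_⟩
      · rw [hconst k s ⟨hk1.trans h1, h2.1⟩, hconst k t ⟨hk1, hk2⟩]
      · rw [hsmp, hsmp, hfl s h1 h2.2]
    · rintro s ⟨h1, h2⟩
      rw [lt_min_iff] at h2
      refine ⟨?_, ?_⟩
      · intro j hj
        rcases Nat.lt_or_ge k j with h | h
        · have := htkmono.monotone (show k + 1 ≤ j from h)
          linarith
        · have := htkmono.monotone h
          linarith
      · intro j hj
        have h3 := hfl s h1.le h2.2
        rw [hj, mul_div_cancel_right₀ _ hTs.ne', Int.floor_natCast] at h3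
        have h4 : (j : ℝ) ≤ t / Ts := by
          rw [← h3] at hm1
          exact_mod_cast hm1
        rw [le_div_iff₀ hTs] at h4
        linarith
  -- main estimate
  have hmain : ∀ T ≥ (0 : ℝ), (∀ s ∈ Set.Icc 0 T, r ^ 2 * lmin < W s) →
      Real.log (W T) ≤ Real.log (W 0) - CP * T + (CP + DP) * μ T 0 := by
    intro T hT hWT
    have hMc : Continuous (fun t => μ t 0) := by
      have : (fun t => μ t 0) = fun t : ℝ =>
          (MeasureTheory.volume {τ ∈ Set.Ico 0 t | σ τ ≠ σ (smp τ)}).toReal :=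
        funext fun t => hμ t 0
      rw [this]
      exact mis_cont _
    let S : Set ℝ := {s | Real.log (W s) ≤ Real.log (W 0) - CP * s + (CP + DP) * μ s 0}
    have hsub : Set.Icc 0 T ⊆ S := by
      apply IsClosed.Icc_subset_of_forall_exists_gt
      · have hset : S ∩ Set.Icc 0 T = {s ∈ Set.Icc 0 T |
            Real.log (W s) ≤ Real.log (W 0) - CP * s + (CP + DP) * μ s 0} := by
          ext s; exact and_comm
        rw [hset]
        apply isClosed_Icc.isClosed_le
        · exact hWc.continuousOn.log (fun s hs => (hm.trans (hWT s hs)).ne')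
        · exact (Continuous.add (by fun_prop) (continuous_const.mul hMc)).continuousOn
      · have : 0 ≤ μ 0 0 := by rw [hμ]; exact ENNReal.toReal_nonneg
        change Real.log (W 0) ≤ Real.log (W 0) - CP * 0 + (CP + DP) * μ 0 0
        have : 0 ≤ (CP + DP) * μ 0 0 := by positivity
        linarith
      · rintro t ⟨htS, ht0, htT⟩ y hy
        obtain ⟨e, het, he1, he2⟩ := hlocal t ht0
        have hlt : t < min y (min e T) := lt_min hy (lt_min het htT)
        set b := min y (min e T) with hb
        have hby : b ≤ y := min_le_left _ _
        have hbe : b ≤ e := (min_le_right _ _).trans (min_le_left _ _)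
        have hbT : b ≤ T := (min_le_right _ _).trans (min_le_right _ _)
        refine ⟨b, ?_, hlt, hby⟩
        have htS' : Real.log (W t) ≤ Real.log (W 0) - CP * t + (CP + DP) * μ t 0 := htS
        change Real.log (W b) ≤ Real.log (W 0) - CP * b + (CP + DP) * μ b 0
        have hpos : ∀ s ∈ Set.Icc t b, 0 < W s := fun s hs =>
          hm.trans (hWT s ⟨ht0.trans hs.1, hs.2.trans hbT⟩)
        by_cases hc : σ t = σ (smp t)
        · have h1 := log_growth_aux W hWc (-CP) t b hlt.le hpos (by
            intro s hs
            have hse : s < e := hs.2.trans_le hbe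
            obtain ⟨n1, n2⟩ := he2 s ⟨hs.1, hse⟩
            obtain ⟨e1, e2⟩ := he1 s ⟨hs.1.le, hse⟩
            obtain ⟨W', d1, d2, -⟩ := hderiv s (lt_of_le_of_lt ht0 hs.1) n1 n2
            exact ⟨W', d1, d2 (by rw [e1, e2]; exact hc)
              (hWT s ⟨ht0.trans hs.1.le, hs.2.le.trans hbT⟩)⟩)
          have h2 : μ t 0 ≤ μ b 0 := by
            rw [hμ, hμ]; exact mis_mono _ t b hlt.le
          have h3 : (CP + DP) * μ t 0 ≤ (CP + DP) * μ b 0 := by gcongr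
          linarith
        · have h1 := log_growth_aux W hWc DP t b hlt.le hpos (by
            intro s hs
            have hse : s < e := hs.2.trans_le hbe
            obtain ⟨n1, n2⟩ := he2 s ⟨hs.1, hse⟩
            obtain ⟨e1, e2⟩ := he1 s ⟨hs.1.le, hse⟩
            obtain ⟨W', d1, -, d2⟩ := hderiv s (lt_of_le_of_lt ht0 hs.1) n1 n2
            exact ⟨W', d1, d2 (by rw [e1, e2]; exact hc)⟩)
          have h2 : μ t 0 + (b - t) ≤ μ b 0 := by
            rw [hμ, hμ]
            refine mis_ge _ t b ht0 hlt.le ?_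
            intro s hs
            obtain ⟨e1, e2⟩ := he1 s ⟨hs.1, hs.2.trans_le hbe⟩
            rw [e1, e2]; exact hc
          have h3 : (CP + DP) * (μ t 0 + (b - t)) ≤ (CP + DP) * μ b 0 := by gcongr
          linarith
    exact hsub ⟨hT, le_rfl⟩
  -- the net decay rate
  obtain ⟨δ, hδ, hδe⟩ : ∃ δ > 0, δ = CP - (CP + DP) * L := by
    refine ⟨_, ?_, rfl⟩
    have := hL.2
    rw [lt_div_iff₀ (by positivity)] at this
    linarith
  have hdecay : ∀ T ≥ (0 : ℝ), (∀ s ∈ Set.Icc 0 T, r ^ 2 * lmin < W s) →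
      Real.log (W T) ≤ Real.log (W 0) - δ * T := by
    intro T hT hWT
    rcases hT.eq_or_lt with h | h
    · rw [← h]; simp
    · have h1 := hmain T hT hWT
      have h2 : (CP + DP) * μ T 0 ≤ (CP + DP) * (L * T) := by
        have := hμL T h
        gcongr
      rw [hδe]
      linarith
  let A : Set ℝ := {t | 0 ≤ t ∧ W t ≤ r ^ 2 * lmin}
  have hAne : A.Nonempty := by
    by_contra hne
    have hall : ∀ t ≥ (0 : ℝ), r ^ 2 * lmin < W t := by
      intro t ht
      by_contra h
      exact hne ⟨t, ht, not_lt.1 h⟩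
    have hlog := Real.log_lt_log hm (hall 0 le_rfl)
    have hT0 : 0 ≤ (Real.log (W 0) - Real.log (r ^ 2 * lmin)) / δ :=
      div_nonneg (by linarith) hδ.le
    have h1 := hdecay _ hT0 (fun s hs => hall s hs.1)
    rw [mul_div_cancel₀ _ hδ.ne'] at h1
    have h2 := Real.log_lt_log hm (hall _ hT0)
    linarith
  have hAbdd : BddBelow A := ⟨0, fun t ht => ht.1⟩
  have hAcl : IsClosed A :=
    (isClosed_le continuous_const continuous_id).inter (isClosed_le hWc continuous_const)
  have hmem : sInf A ∈ A := hAcl.csInf_mem hAne hAbdd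
  refine ⟨sInf A, hmem.1, hmem.2, ?_⟩
  rintro t ⟨ht0, ht1⟩
  rcases ht1.eq_or_lt with h | h
  · rw [h]; exact hmem.2.trans_lt hsmall
  · have hall : ∀ s ∈ Set.Icc 0 t, r ^ 2 * lmin < W s := by
      intro s hs
      by_contra hcon
      have := csInf_le hAbdd (show s ∈ A from ⟨hs.1, not_lt.1 hcon⟩)
      linarith [hs.2]
    have h1 := hdecay t ht0 hall
    have h2 : Real.log (W t) ≤ Real.log (W 0) := by
      have : 0 ≤ δ * t := by positivity
      linarith
    have h3 := (Real.log_le_log_iff (hm.trans (hall t ⟨ht0, le_rfl⟩))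
      (hm.trans (hall 0 ⟨le_rfl, ht0⟩))).1 h2
    linarith
end

section
/- Assume in addition that σ has at most one discontinuity in each open interval (kT_s, (k+1)T_s), k ∈ ℕ. Suppose there exist T₀ ≥ 0 and δ > 0 such that W(T₀) = r²·λ_min(P) and W(T₀ + ε) > r²·λ_min(P) for all ε ∈ (0, δ). Then σ(T₀) ≠ σ([T₀]⁻). -/
open scoped RealInnerProductSpace

/-- Lemma 5 of the paper.  Under the standing assumptions on the sampled-data
switched system, and assuming at most one switching time in each open sampling
interval, the trajectory can leave the level set `{W ≤ r²λ_min(P)}` at time `T₀`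
only if the plant and controller modes mismatch at `T₀`: `σ(T₀) ≠ σ([T₀]⁻)`. -/
theorem leave_only_at_mismatch {n : ℕ} {ι : Type*} [Fintype ι] [Nonempty ι]
    (Ts : ℝ) (hTs : 0 < Ts)
    (smp : ℝ → ℝ) (hsmp : ∀ t, smp t = Ts * (⌊t / Ts⌋ : ℝ))
    (σ : ℝ → ι)
    (tk : ℕ → ℝ) (htk0 : tk 0 = 0) (htkmono : StrictMono tk)
    (htktop : Filter.Tendsto tk Filter.atTop Filter.atTop)
    (hconst : ∀ k, ∀ s ∈ Set.Ico (tk k) (tk (k + 1)), σ s = σ (tk k))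
    (μ : ℝ → ℝ → ℝ)
    (hμ : ∀ t₁ t₂ : ℝ, μ t₁ t₂ =
      (MeasureTheory.volume {τ ∈ Set.Ico t₂ t₁ | σ τ ≠ σ (smp τ)}).toReal)
    (CP DP R r : ℝ) (hCP : 0 < CP) (hDP : 0 < DP) (hr : 0 < r) (hrR : r < R)
    (P : EuclideanSpace ℝ (Fin n) →L[ℝ] EuclideanSpace ℝ (Fin n))
    (hPsym : ∀ y z : EuclideanSpace ℝ (Fin n), ⟪P y, z⟫ = ⟪y, P z⟫)
    (lmin lmax : ℝ) (hlminpos : 0 < lmin)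
    (hlmin₁ : ∀ y : EuclideanSpace ℝ (Fin n), lmin * ‖y‖ ^ 2 ≤ ⟪y, P y⟫)
    (hlmin₂ : ∃ y : EuclideanSpace ℝ (Fin n), y ≠ 0 ∧ ⟪y, P y⟫ = lmin * ‖y‖ ^ 2)
    (hlmax₁ : ∀ y : EuclideanSpace ℝ (Fin n), ⟪y, P y⟫ ≤ lmax * ‖y‖ ^ 2)
    (hlmax₂ : ∃ y : EuclideanSpace ℝ (Fin n), y ≠ 0 ∧ ⟪y, P y⟫ = lmax * ‖y‖ ^ 2)
    (x : ℝ → EuclideanSpace ℝ (Fin n)) (hx : Continuous x)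
    (W : ℝ → ℝ) (hW : ∀ t, W t = ⟪x t, P (x t)⟫)
    (hderiv : ∀ t > (0 : ℝ), (∀ k, t ≠ tk k) → (∀ k : ℕ, t ≠ (k : ℝ) * Ts) →
      ∃ W', HasDerivAt W W' t ∧
        (σ t = σ (smp t) → r ^ 2 * lmin < W t → W' ≤ -CP * W t) ∧
        (σ t ≠ σ (smp t) → W' ≤ DP * W t))
    (hone : ∀ k : ℕ, ∀ i j : ℕ,
      tk i ∈ Set.Ioo ((k : ℝ) * Ts) (((k : ℝ) + 1) * Ts) →
      tk j ∈ Set.Ioo ((k : ℝ) * Ts) (((k : ℝ) + 1) * Ts) → i = j)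
    (T₀ : ℝ) (hT₀ : 0 ≤ T₀) (δ : ℝ) (hδ : 0 < δ)
    (hWT₀ : W T₀ = r ^ 2 * lmin)
    (hleave : ∀ ε ∈ Set.Ioo (0 : ℝ) δ, r ^ 2 * lmin < W (T₀ + ε)) :
    σ T₀ ≠ σ (smp T₀) := by
  intro heq
  have hWc : Continuous W := by
    have : W = fun t => ⟪x t, P (x t)⟫ := funext hW
    rw [this]
    exact hx.inner (P.continuous.comp hx)
  have hex : ∃ k, T₀ < tk k := (htktop.eventually_gt_atTop T₀).exists
  obtain ⟨k, hk1, hk2⟩ : ∃ k, tk k ≤ T₀ ∧ T₀ < tk (k + 1) := by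
    classical
    have h1 := Nat.find_spec hex
    have h2 : Nat.find hex ≠ 0 := by
      intro h
      rw [h, htk0] at h1
      linarith
    obtain ⟨k, hk⟩ := Nat.exists_eq_succ_of_ne_zero h2
    refine ⟨k, ?_, ?_⟩
    · exact not_lt.mp (Nat.find_min hex (by omega))
    · rw [hk] at h1
      exact h1
  set m : ℤ := ⌊T₀ / Ts⌋ with hm
  have hm1 : (m : ℝ) * Ts ≤ T₀ := (le_div_iff₀ hTs).mp (Int.floor_le _)
  have hm2 : T₀ < ((m : ℝ) + 1) * Ts := (div_lt_iff₀ hTs).mp (Int.lt_floor_add_one _)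
  obtain ⟨b, hb0, hb⟩ := exists_between
    (lt_min (lt_min hk2 hm2) (show T₀ < T₀ + δ by linarith))
  rw [lt_min_iff, lt_min_iff] at hb
  obtain ⟨⟨hb1, hb2⟩, hb3⟩ := hb
  have key : ∀ t ∈ Set.Ioo T₀ b, deriv W t ≤ 0 := by
    rintro t ⟨ht1, ht2⟩
    have hfl : ⌊t / Ts⌋ = m := by
      rw [Int.floor_eq_iff]
      exact ⟨(le_div_iff₀ hTs).mpr (by linarith), (div_lt_iff₀ hTs).mpr (by linarith)⟩
    have hs : σ t = σ (smp t) := by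
      rw [hconst k t ⟨by linarith, by linarith⟩, ← hconst k T₀ ⟨hk1, hk2⟩, heq, hsmp, hsmp, hfl]
    have hWt : r ^ 2 * lmin < W t := by
      have := hleave (t - T₀) ⟨by linarith, by linarith⟩
      simpa using this
    obtain ⟨W', hW', h1, -⟩ := hderiv t (by linarith) (by
      intro j hj
      have a1 : k < j := htkmono.lt_iff_lt.mp (by linarith)
      have a2 : j < k + 1 := htkmono.lt_iff_lt.mp (by linarith)
      omega) (by
      intro j hj
      have a1 : (m : ℝ) < ((j : ℤ) : ℝ) := by
        push_cast
        exact lt_of_mul_lt_mul_right (by linarith) hTs.le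
      have a2 : ((j : ℤ) : ℝ) < (m : ℝ) + 1 := by
        push_cast
        exact lt_of_mul_lt_mul_right (by linarith) hTs.le
      have b1 : m < (j : ℤ) := by exact_mod_cast a1
      have b2 : (j : ℤ) < m + 1 := by exact_mod_cast a2
      omega)
    rw [hW'.deriv]
    have hpos : 0 < W t := lt_trans (by positivity) hWt
    have := h1 hs hWt
    nlinarith [mul_pos hCP hpos]
  have hdiff : ∀ t ∈ Set.Ioo T₀ b, DifferentiableAt ℝ W t := by
    rintro t ⟨ht1, ht2⟩
    obtain ⟨W', hW', -⟩ := hderiv t (by linarith) (by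
      intro j hj
      have a1 : k < j := htkmono.lt_iff_lt.mp (by linarith)
      have a2 : j < k + 1 := htkmono.lt_iff_lt.mp (by linarith)
      omega) (by
      intro j hj
      have a1 : (m : ℝ) < ((j : ℤ) : ℝ) := by
        push_cast
        exact lt_of_mul_lt_mul_right (by linarith) hTs.le
      have a2 : ((j : ℤ) : ℝ) < (m : ℝ) + 1 := by
        push_cast
        exact lt_of_mul_lt_mul_right (by linarith) hTs.le
      have b1 : m < (j : ℤ) := by exact_mod_cast a1
      have b2 : (j : ℤ) < m + 1 := by exact_mod_cast a2
      omega)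
    exact hW'.differentiableAt
  have hanti : AntitoneOn W (Set.Icc T₀ b) := by
    apply antitoneOn_of_deriv_nonpos (convex_Icc _ _) hWc.continuousOn
    · rw [interior_Icc]
      exact fun t ht => (hdiff t ht).differentiableWithinAt
    · rw [interior_Icc]
      exact key
  have h1 := hanti (Set.left_mem_Icc.mpr hb0.le) (Set.right_mem_Icc.mpr hb0.le) hb0.le
  have h2 := hleave (b - T₀) ⟨by linarith, by linarith⟩
  rw [add_sub_cancel] at h2
  linarith
end

section
/- Let κ > 1 satisfy κ²·r²·λ_min(P) < R²·λ_max(P), set f(κ) := 2·log κ/(C_P + D_P), and let L ∈ [0, C_P/(C_P + D_P)). Suppose T₀ ≥ 0 satisfies W(T₀) = r²·λ_min(P) and there exists δ > 0 with W(T₀ + ε) > r²·λ_min(P) for all ε ∈ (0, δ), and suppose μ(t, T₀) ≤ f(κ) + L·(t − T₀) for all t > T₀. Then there exists T₁ > T₀ such that W(T₁) ≤ r²·λ_min(P), and W(t) < κ²·r²·λ_min(P) for all t ∈ [T₀, T₁]. -/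
open scoped RealInnerProductSpace


open MeasureTheory Filter Topology Set

/-- Antitone in the endpoints, with finitely many exceptional points. -/
theorem aux_le_of_finite (S : Finset ℝ) (G : ℝ → ℝ) : ∀ a b : ℝ, a ≤ b →
    ContinuousOn G (Icc a b) →
    (∀ t ∈ Ioo a b, t ∉ S → ∃ G', HasDerivAt G G' t ∧ G' ≤ 0) → G b ≤ G a := by
  classical
  induction S using Finset.induction_on with
  | empty =>
    intro a b hab hc hd
    have : AntitoneOn G (Icc a b) := by
      apply antitoneOn_of_deriv_nonpos (convex_Icc a b) hc
      · intro t ht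
        rw [interior_Icc] at ht
        obtain ⟨G', h, _⟩ := hd t ht (by simp)
        exact h.differentiableAt.differentiableWithinAt
      · intro t ht
        rw [interior_Icc] at ht
        obtain ⟨G', h, h'⟩ := hd t ht (by simp)
        rw [h.deriv]; exact h'
    exact this (left_mem_Icc.2 hab) (right_mem_Icc.2 hab) hab
  | insert s S hs ih =>
    intro a b hab hc hd
    by_cases h : s ∈ Ioo a b
    · have h1 : G s ≤ G a := by
        apply ih a s h.1.le (hc.mono (Icc_subset_Icc_right h.2.le))
        intro t ht htS
        apply hd t ⟨ht.1, ht.2.trans h.2⟩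
        simp [htS, ht.2.ne]
      have h2 : G b ≤ G s := by
        apply ih s b h.2.le (hc.mono (Icc_subset_Icc_left h.1.le))
        intro t ht htS
        apply hd t ⟨h.1.trans ht.1, ht.2⟩
        simp [htS, ht.1.ne']
      exact h2.trans h1
    · apply ih a b hab hc
      intro t ht htS
      apply hd t ht
      have : t ≠ s := fun e => h (e ▸ ht)
      simp [htS, this]

/-- Mismatch measure. -/
noncomputable def auxM (A : Set ℝ) (a b : ℝ) : ℝ := (volume (Ico a b ∩ A)).toReal

theorem auxM_ne_top (A : Set ℝ) (a b : ℝ) : volume (Ico a b ∩ A) ≠ ⊤ :=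
  ((measure_mono inter_subset_left).trans_lt (by simp)).ne

theorem auxM_add (A : Set ℝ) {a b c : ℝ} (hab : a ≤ b) (hbc : b ≤ c) :
    auxM A a c = auxM A a b + auxM A b c := by
  unfold auxM
  rw [← ENNReal.toReal_add (auxM_ne_top _ _ _) (auxM_ne_top _ _ _)]
  congr 1
  rw [← measure_inter_add_sdiff (Ico a c ∩ A) (measurableSet_Iio (a := b))]
  congr 2
  · ext t; simp only [mem_inter_iff, mem_Ico, mem_Iio]
    constructor
    · rintro ⟨⟨⟨h1, h2⟩, h3⟩, h4⟩; exact ⟨⟨h1, h4⟩, h3⟩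
    · rintro ⟨⟨h1, h4⟩, h3⟩; exact ⟨⟨⟨h1, h4.trans_le hbc⟩, h3⟩, h4⟩
  · ext t; simp only [mem_inter_iff, mem_Ico, mem_Iio, Set.mem_sdiff, not_lt]
    constructor
    · rintro ⟨⟨⟨h1, h2⟩, h3⟩, h4⟩; exact ⟨⟨h4, h2⟩, h3⟩
    · rintro ⟨⟨h1, h4⟩, h3⟩; exact ⟨⟨⟨hab.trans h1, h4⟩, h3⟩, h1⟩

theorem auxM_nonneg (A : Set ℝ) (a b : ℝ) : 0 ≤ auxM A a b := ENNReal.toReal_nonneg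

theorem auxM_le (A : Set ℝ) {a b : ℝ} (h : a ≤ b) : auxM A a b ≤ b - a := by
  unfold auxM
  have := ENNReal.toReal_mono (by simp) (measure_mono (μ := volume) (inter_subset_left (s := Ico a b) (t := A)))
  rwa [Real.volume_Ico, ENNReal.toReal_ofReal (by linarith)] at this

theorem auxM_full (A : Set ℝ) {a b : ℝ} (h : a ≤ b) (hA : Ico a b ⊆ A) : auxM A a b = b - a := by
  unfold auxM
  rw [inter_eq_left.2 hA, Real.volume_Ico, ENNReal.toReal_ofReal (by linarith)]

theorem auxM_empty (A : Set ℝ) {a b : ℝ} (hA : ∀ t ∈ Ico a b, t ∉ A) : auxM A a b = 0 := by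
  unfold auxM
  have : Ico a b ∩ A = ∅ := by
    ext t; simp only [mem_inter_iff, mem_empty_iff_false, iff_false]; exact fun h => hA t h.1 h.2
  simp [this]

theorem auxM_cont (A : Set ℝ) (a : ℝ) : ContinuousOn (auxM A a) (Ici a) := by
  have : LipschitzOnWith 1 (auxM A a) (Ici a) := by
    apply LipschitzOnWith.of_dist_le_mul
    have key : ∀ s t, a ≤ s → s ≤ t → |auxM A a s - auxM A a t| ≤ |s - t| := by
      intro s t hs hst
      rw [auxM_add A hs hst, abs_of_nonpos (by linarith [auxM_nonneg A s t]),
        abs_of_nonpos (by linarith)]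
      linarith [auxM_le A hst]
    intro s hs t ht
    rw [Real.dist_eq, Real.dist_eq]
    simp only [NNReal.coe_one, one_mul]
    rcases le_total s t with h | h
    · exact key s t hs h
    · rw [abs_sub_comm, abs_sub_comm s]; exact key t s ht h
  exact this.continuousOn

theorem auxM_deriv (A : Set ℝ) {a t e : ℝ} (hat : a < t)
    (he : ∃ ε > 0, ∀ u v, u ≤ v → t - ε < u → v < t + ε → auxM A u v = e * (v - u)) :
    HasDerivAt (auxM A a) e t := by
  obtain ⟨ε, hε, he⟩ := he
  have h1 : HasDerivAt (fun s => auxM A a t + e * (s - t)) e t := by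
    simpa using (((hasDerivAt_id t).sub_const t).const_mul e).const_add (auxM A a t)
  apply h1.congr_of_eventuallyEq
  filter_upwards [Ioo_mem_nhds (show t - ε < t by linarith) (show t < t + ε by linarith),
    Ioi_mem_nhds hat] with s hs has
  rcases le_total s t with h | h
  · have := auxM_add A (le_of_lt has) h
    rw [he s t h hs.1 (by linarith)] at this
    linarith
  · have := auxM_add A hat.le h
    rw [he t s h (by linarith) hs.2] at this
    linarith

/-- Lemma 6 of the paper.  Let `κ > 1` satisfy `κ²r²λ_min(P) < R²λ_max(P)`, set
`f(κ) := 2 log κ/(C_P+D_P)` and `L ∈ [0, C_P/(C_P+D_P))`.  If the trajectory leaves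
the level set `{W ≤ r²λ_min(P)}` at time `T₀` and `μ(t,T₀) ≤ f(κ) + L(t−T₀)` for all
`t > T₀`, then the trajectory returns to `{W ≤ r²λ_min(P)}` at some `T₁ > T₀` while
staying in `{W < κ²r²λ_min(P)}` on `[T₀, T₁]`. -/
theorem stay_in_enlarged_level_set {n : ℕ} {ι : Type*} [Fintype ι] [Nonempty ι]
    (Ts : ℝ) (hTs : 0 < Ts)
    (smp : ℝ → ℝ) (hsmp : ∀ t, smp t = Ts * (⌊t / Ts⌋ : ℝ))
    (σ : ℝ → ι)
    (tk : ℕ → ℝ) (htk0 : tk 0 = 0) (htkmono : StrictMono tk)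
    (htktop : Filter.Tendsto tk Filter.atTop Filter.atTop)
    (hconst : ∀ k, ∀ s ∈ Set.Ico (tk k) (tk (k + 1)), σ s = σ (tk k))
    (μ : ℝ → ℝ → ℝ)
    (hμ : ∀ t₁ t₂ : ℝ, μ t₁ t₂ =
      (MeasureTheory.volume {τ ∈ Set.Ico t₂ t₁ | σ τ ≠ σ (smp τ)}).toReal)
    (CP DP R r : ℝ) (hCP : 0 < CP) (hDP : 0 < DP) (hr : 0 < r) (hrR : r < R)
    (P : EuclideanSpace ℝ (Fin n) →L[ℝ] EuclideanSpace ℝ (Fin n))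
    (hPsym : ∀ y z : EuclideanSpace ℝ (Fin n), ⟪P y, z⟫ = ⟪y, P z⟫)
    (lmin lmax : ℝ) (hlminpos : 0 < lmin)
    (hlmin₁ : ∀ y : EuclideanSpace ℝ (Fin n), lmin * ‖y‖ ^ 2 ≤ ⟪y, P y⟫)
    (hlmin₂ : ∃ y : EuclideanSpace ℝ (Fin n), y ≠ 0 ∧ ⟪y, P y⟫ = lmin * ‖y‖ ^ 2)
    (hlmax₁ : ∀ y : EuclideanSpace ℝ (Fin n), ⟪y, P y⟫ ≤ lmax * ‖y‖ ^ 2)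
    (hlmax₂ : ∃ y : EuclideanSpace ℝ (Fin n), y ≠ 0 ∧ ⟪y, P y⟫ = lmax * ‖y‖ ^ 2)
    (x : ℝ → EuclideanSpace ℝ (Fin n)) (hx : Continuous x)
    (W : ℝ → ℝ) (hW : ∀ t, W t = ⟪x t, P (x t)⟫)
    (hderiv : ∀ t > (0 : ℝ), (∀ k, t ≠ tk k) → (∀ k : ℕ, t ≠ (k : ℝ) * Ts) →
      ∃ W', HasDerivAt W W' t ∧
        (σ t = σ (smp t) → r ^ 2 * lmin < W t → W' ≤ -CP * W t) ∧
        (σ t ≠ σ (smp t) → W' ≤ DP * W t))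
    (κ : ℝ) (hκ : 1 < κ) (hκrR : κ ^ 2 * r ^ 2 * lmin < R ^ 2 * lmax)
    (fκ : ℝ) (hfκ : fκ = 2 * Real.log κ / (CP + DP))
    (L : ℝ) (hL : L ∈ Set.Ico 0 (CP / (CP + DP)))
    (T₀ : ℝ) (hT₀ : 0 ≤ T₀)
    (hWT₀ : W T₀ = r ^ 2 * lmin)
    (hleave : ∃ δ > (0 : ℝ), ∀ ε ∈ Set.Ioo (0 : ℝ) δ, r ^ 2 * lmin < W (T₀ + ε))
    (hμT₀ : ∀ t > T₀, μ t T₀ ≤ fκ + L * (t - T₀)) :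
    ∃ T₁ > T₀, W T₁ ≤ r ^ 2 * lmin ∧
      ∀ t ∈ Set.Icc T₀ T₁, W t < κ ^ 2 * r ^ 2 * lmin := by
  classical
  set c := r ^ 2 * lmin with hc
  have hcpos : 0 < c := by positivity
  have hWc : Continuous W := by
    have : W = fun t => ⟪x t, P (x t)⟫ := funext hW
    rw [this]; fun_prop
  set A : Set ℝ := {τ | σ τ ≠ σ (smp τ)} with hA
  have hμA : ∀ t, μ t T₀ = auxM A T₀ t := by
    intro t; rw [hμ]; rfl
  -- local constancy
  have hloc : ∀ t > (0 : ℝ), (∀ k, t ≠ tk k) → (∀ k : ℕ, t ≠ (k : ℝ) * Ts) →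
      ∃ ε > 0, ∀ s, t - ε < s → s < t + ε → (σ s = σ t ∧ smp s = smp t) := by
    intro t ht h1 h2
    have e1 : ∀ᶠ s in 𝓝 t, σ s = σ t := by
      have hex : ∃ k, t < tk k := (htktop.eventually_gt_atTop t).exists
      obtain ⟨k, hk⟩ : ∃ k, Nat.find hex = k + 1 := by
        apply Nat.exists_eq_succ_of_ne_zero
        intro h0
        have := Nat.find_spec hex
        rw [h0, htk0] at this
        linarith
      have hk1 : t < tk (k + 1) := hk ▸ Nat.find_spec hex
      have hk2 : tk k < t := by
        have := Nat.find_min hex (m := k) (by omega)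
        exact lt_of_le_of_ne (not_lt.1 this) (h1 k).symm
      filter_upwards [Ioo_mem_nhds hk2 hk1] with s hs
      rw [hconst k s ⟨hs.1.le, hs.2⟩, hconst k t ⟨hk2.le, hk1⟩]
    have e2 : ∀ᶠ s in 𝓝 t, smp s = smp t := by
      have hq0 : 0 ≤ ⌊t / Ts⌋ := Int.floor_nonneg.2 (by positivity)
      have a1 : (⌊t / Ts⌋ : ℝ) * Ts < t := by
        refine lt_of_le_of_ne ((le_div_iff₀ hTs).1 (Int.floor_le _)) ?_
        intro e
        apply h2 (⌊t / Ts⌋.toNat)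
        have : ((⌊t / Ts⌋.toNat : ℤ) : ℝ) = (⌊t / Ts⌋ : ℝ) := by rw [Int.toNat_of_nonneg hq0]
        rw [← Int.cast_natCast, this, e]
      have a2 : t < ((⌊t / Ts⌋ : ℝ) + 1) * Ts := (div_lt_iff₀ hTs).1 (Int.lt_floor_add_one _)
      filter_upwards [Ioo_mem_nhds a1 a2] with s hs
      rw [hsmp, hsmp]
      have : ⌊s / Ts⌋ = ⌊t / Ts⌋ := by
        rw [Int.floor_eq_iff]
        exact ⟨(le_div_iff₀ hTs).2 hs.1.le, (div_lt_iff₀ hTs).2 hs.2⟩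
      rw [this]
    obtain ⟨ε, hε, h⟩ := Metric.eventually_nhds_iff.1 (e1.and e2)
    refine ⟨ε, hε, fun s h3 h4 => h ?_⟩
    rw [Real.dist_eq, abs_lt]; constructor <;> linarith
  have key : ∀ b > T₀, (∀ t ∈ Ioo T₀ b, c < W t) →
      W b * Real.exp (CP * (b - T₀) - (CP + DP) * auxM A T₀ b) ≤ c := by
    intro b hb hWb
    have fin1 : {k | tk k ≤ b}.Finite := by
      have := htktop.eventually_gt_atTop b
      rw [← Nat.cofinite_eq_atTop] at this
      simpa [Filter.eventually_cofinite] using this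
    have fin2 : {k : ℕ | (k : ℝ) * Ts ≤ b}.Finite := by
      have := (tendsto_natCast_atTop_atTop.atTop_mul_const hTs).eventually_gt_atTop b
      rw [← Nat.cofinite_eq_atTop] at this
      simpa [Filter.eventually_cofinite] using this
    have hfin := aux_le_of_finite
      (fin1.toFinset.image tk ∪ fin2.toFinset.image (fun k : ℕ => (k : ℝ) * Ts))
      (fun t => W t * Real.exp (CP * (t - T₀) - (CP + DP) * auxM A T₀ t)) T₀ b hb.le ?_ ?_
    · have h0 : auxM A T₀ T₀ = 0 := auxM_empty A (by simp)
      simp only [h0, sub_self, mul_zero, Real.exp_zero, mul_one, hWT₀] at hfin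
      exact hfin
    · have hm : ContinuousOn (auxM A T₀) (Icc T₀ b) := (auxM_cont A T₀).mono Icc_subset_Ici_self
      have hw := hWc.continuousOn (s := Icc T₀ b)
      fun_prop
    · intro t ht htS
      have ht0 : 0 < t := hT₀.trans_lt ht.1
      have h1 : ∀ k, t ≠ tk k := by
        intro k e; apply htS
        simp only [Finset.mem_union, Finset.mem_image, Set.Finite.mem_toFinset]
        exact Or.inl ⟨k, e.symm.le.trans ht.2.le, e.symm⟩
      have h2 : ∀ k : ℕ, t ≠ (k : ℝ) * Ts := by
        intro k e; apply htS
        simp only [Finset.mem_union, Finset.mem_image, Set.Finite.mem_toFinset]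
        exact Or.inr ⟨k, e.symm.le.trans ht.2.le, e.symm⟩
      obtain ⟨W', hW', hi, hii⟩ := hderiv t ht0 h1 h2
      obtain ⟨ε, hε, hl⟩ := hloc t ht0 h1 h2
      have hsm : ∀ s, t - ε < s → s < t + ε → σ (smp s) = σ (smp t) := by
        intro s h3 h4; rw [(hl s h3 h4).2]
      have hG : ∀ e, HasDerivAt (auxM A T₀) e t →
          HasDerivAt (fun t => W t * Real.exp (CP * (t - T₀) - (CP + DP) * auxM A T₀ t))
            ((W' + W t * (CP - (CP + DP) * e)) *
              Real.exp (CP * (t - T₀) - (CP + DP) * auxM A T₀ t)) t := by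
        intro e he
        have := hW'.mul ((((hasDerivAt_id t).sub_const T₀).const_mul CP).sub
          (he.const_mul (CP + DP))).exp
        refine this.congr_deriv ?_
        simp only [id, Pi.sub_apply]
        ring
      by_cases hm : σ t = σ (smp t)
      · refine ⟨_, hG 0 (auxM_deriv A ht.1 ⟨ε, hε, ?_⟩), ?_⟩
        · intro u v _ hu hv
          rw [zero_mul]
          apply auxM_empty
          intro s hs
          have h3 : t - ε < s := hu.trans_le hs.1
          have h4 : s < t + ε := hs.2.trans hv
          simp only [hA, mem_ofPred_eq, not_not]
          rw [hsm s h3 h4, (hl s h3 h4).1, hm]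
        · apply mul_nonpos_of_nonpos_of_nonneg _ (Real.exp_pos _).le
          have := hi hm (hWb t ht)
          linarith
      · refine ⟨_, hG 1 (auxM_deriv A ht.1 ⟨ε, hε, ?_⟩), ?_⟩
        · intro u v huv hu hv
          rw [one_mul]
          apply auxM_full A huv
          intro s hs
          have h3 : t - ε < s := hu.trans_le hs.1
          have h4 : s < t + ε := hs.2.trans hv
          simp only [hA, mem_ofPred_eq]
          rw [hsm s h3 h4, (hl s h3 h4).1]; exact hm
        · apply mul_nonpos_of_nonpos_of_nonneg _ (Real.exp_pos _).le
          have := hii hm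
          linarith
  have hsum : 0 < CP + DP := by linarith
  have hα : 0 < CP - (CP + DP) * L := by
    have := (lt_div_iff₀ hsum).1 hL.2
    linarith
  have hlog : Real.exp (2 * Real.log κ) = κ ^ 2 := by
    rw [two_mul, Real.exp_add, Real.exp_log (by linarith)]; ring
  have key2 : ∀ b > T₀, (∀ t ∈ Ioo T₀ b, c < W t) →
      W b ≤ κ ^ 2 * c * Real.exp (-((CP - (CP + DP) * L) * (b - T₀))) := by
    intro b hb hWb
    have h1 := key b hb hWb
    have h2 := hμT₀ b hb
    rw [hμA] at h2
    have h3 : (CP + DP) * auxM A T₀ b ≤ 2 * Real.log κ + (CP + DP) * (L * (b - T₀)) := by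
      have := mul_le_mul_of_nonneg_left h2 hsum.le
      rw [hfκ, mul_add, mul_div_cancel₀ _ hsum.ne'] at this
      exact this
    have h4 : W b ≤ c * Real.exp (-(CP * (b - T₀) - (CP + DP) * auxM A T₀ b)) := by
      rw [Real.exp_neg, ← div_eq_mul_inv, le_div_iff₀ (Real.exp_pos _)]
      exact h1
    refine h4.trans ?_
    rw [← hlog, mul_comm _ c, mul_assoc c, ← Real.exp_add]
    gcongr
    nlinarith
  have key3 : ∀ b > T₀, (∀ t ∈ Ioo T₀ b, c < W t) → W b < κ ^ 2 * c := by
    intro b hb hWb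
    refine (key2 b hb hWb).trans_lt ?_
    apply mul_lt_of_lt_one_right (by positivity)
    rw [Real.exp_lt_one_iff]
    have : 0 < (CP - (CP + DP) * L) * (b - T₀) := mul_pos hα (by linarith)
    linarith
  obtain ⟨δ, hδ, hδW⟩ := hleave
  have hδW' : ∀ t, T₀ < t → t < T₀ + δ → c < W t := by
    intro t h1 h2
    have := hδW (t - T₀) ⟨by linarith, by linarith⟩
    rwa [add_sub_cancel] at this
  set S : Set ℝ := {t | T₀ + δ ≤ t ∧ W t ≤ c} with hS
  have hSne : S.Nonempty := by
    by_contra hne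
    have hall : ∀ t > T₀, c < W t := by
      intro t ht
      by_contra hcon
      apply hne
      refine ⟨t, ?_, not_lt.1 hcon⟩
      by_contra h
      exact hcon (hδW' t ht (not_le.1 h))
    have hlogpos : 0 < Real.log κ := Real.log_pos hκ
    set b := T₀ + 2 * Real.log κ / (CP - (CP + DP) * L) with hb
    have hbT : b > T₀ := by
      have : 0 < 2 * Real.log κ / (CP - (CP + DP) * L) := by positivity
      linarith
    have h1 := key2 b hbT (fun t ht => hall t ht.1)
    have h2 : (CP - (CP + DP) * L) * (b - T₀) = 2 * Real.log κ := by
      rw [hb, add_sub_cancel_left, mul_div_cancel₀ _ hα.ne']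
    rw [h2, Real.exp_neg, hlog] at h1
    have h3 : κ ^ 2 * c * (κ ^ 2)⁻¹ = c := by
      have : κ ≠ 0 := by linarith
      field_simp
    linarith [hall b hbT]
  have hSclosed : IsClosed S :=
    (isClosed_le continuous_const continuous_id).inter (isClosed_le hWc continuous_const)
  have hSbdd : BddBelow S := ⟨T₀ + δ, fun t ht => ht.1⟩
  have hmem := hSclosed.csInf_mem hSne hSbdd
  have hlt : ∀ t ∈ Ioo T₀ (sInf S), c < W t := by
    intro t ht
    by_contra hcon
    have : t ∈ S := by
      refine ⟨?_, not_lt.1 hcon⟩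
      by_contra h
      exact hcon (hδW' t ht.1 (not_le.1 h))
    exact absurd (csInf_le hSbdd this) (not_le.2 ht.2)
  refine ⟨sInf S, by linarith [hmem.1], hmem.2, ?_⟩
  intro t ht
  rw [mul_assoc, ← hc]
  rcases eq_or_lt_of_le ht.1 with h | h
  · rw [← h, hWT₀]
    exact lt_mul_of_one_lt_left hcpos (by nlinarith)
  · exact key3 t h (fun s hs => hlt s ⟨hs.1, hs.2.trans_le ht.2⟩)
end

section
/- Assume in addition that σ has at most one discontinuity in each open interval (kT_s, (k+1)T_s), k ∈ ℕ. Let L ∈ [0, C_P/(C_P + D_P)), let κ > 1 satisfy κ²·r²·λ_min(P) < R²·λ_max(P), and set f(κ) := 2·log κ/(C_P + D_P). Suppose: (a) μ(t, 0) ≤ L·t for every t > 0; (b) for each T₀ ≥ 0 with σ(T₀) ≠ σ([T₀]⁻), μ(t, T₀) ≤ f(κ) + L·(t − T₀) for every t > T₀; and (c) W(0) < R²·λ_max(P). Then there exists T_r ≥ 0 such that W(t) < κ²·r²·λ_min(P) for all t ≥ T_r; moreover, W(t) < R²·λ_max(P) for all t ≥ 0. -/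
open scoped RealInnerProductSpace

open MeasureTheory Set in
lemma mm_fin (M : Set ℝ) (a b : ℝ) : volume (Ico a b ∩ M) ≠ ⊤ :=
  ne_top_of_le_ne_top (by simp) (measure_mono inter_subset_left)

open MeasureTheory Set in
lemma mm_add (M : Set ℝ) {a b c : ℝ} (hab : a ≤ b) (hbc : b ≤ c) :
    (volume (Ico a c ∩ M)).toReal = (volume (Ico a b ∩ M)).toReal
      + (volume (Ico b c ∩ M)).toReal := by
  have h := measure_inter_add_diff (μ := volume) (Ico a c ∩ M) (measurableSet_Ico (a := a) (b := b))
  have h1 : Ico a c ∩ M ∩ Ico a b = Ico a b ∩ M := by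
    ext x; simp only [mem_inter_iff, mem_Ico]
    constructor
    · rintro ⟨⟨_, h⟩, h'⟩; exact ⟨h', h⟩
    · rintro ⟨h, h'⟩; exact ⟨⟨⟨h.1, by linarith [h.2]⟩, h'⟩, h⟩
  have h2 : (Ico a c ∩ M) \ Ico a b = Ico b c ∩ M := by
    ext x; simp only [mem_inter_iff, mem_diff, mem_Ico]
    constructor
    · rintro ⟨⟨h, h'⟩, h3⟩
      refine ⟨⟨?_, h.2⟩, h'⟩
      by_contra hh
      exact h3 ⟨h.1, not_le.mp hh⟩
    · rintro ⟨h, h'⟩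
      exact ⟨⟨⟨by linarith [h.1], h.2⟩, h'⟩, fun h3 => by linarith [h3.2, h.1]⟩
  rw [h1, h2] at h
  rw [← h, ENNReal.toReal_add (mm_fin M _ _) (mm_fin M _ _)]

open MeasureTheory Set in
lemma mm_le (M : Set ℝ) {a b : ℝ} (hab : a ≤ b) :
    (volume (Ico a b ∩ M)).toReal ≤ b - a := by
  have h : volume (Ico a b ∩ M) ≤ volume (Ico a b) := measure_mono inter_subset_left
  have := ENNReal.toReal_mono (by simp) h
  simpa [hab] using this

open MeasureTheory Set in
lemma mm_cont (M : Set ℝ) (a b : ℝ) :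
    ContinuousOn (fun t => (volume (Ico a t ∩ M)).toReal) (Icc a b) := by
  have : LipschitzOnWith 1 (fun t => (volume (Ico a t ∩ M)).toReal) (Icc a b) := by
    apply LipschitzOnWith.of_le_add_mul
    intro x hx y hy
    simp only [NNReal.coe_one, one_mul, Real.dist_eq]
    rcases le_total x y with h | h
    · rw [mm_add M hx.1 h]
      have : 0 ≤ (volume (Ico x y ∩ M)).toReal := ENNReal.toReal_nonneg
      linarith [abs_nonneg (x - y)]
    · rw [mm_add M hy.1 h]
      linarith [mm_le M h, le_abs_self (x - y)]
  exact this.continuousOn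

open MeasureTheory Set in
lemma log_step (W : ℝ → ℝ) (hc : Continuous W) (c t u : ℝ) (htu : t ≤ u)
    (hpos : ∀ τ ∈ Icc t u, 0 < W τ)
    (hd : ∀ τ ∈ Ioo t u, ∃ W', HasDerivAt W W' τ ∧ W' ≤ c * W τ) :
    Real.log (W u) - Real.log (W t) ≤ c * (u - t) := by
  have hanti : AntitoneOn (fun τ => Real.log (W τ) - c * τ) (Icc t u) := by
    have hder : ∀ τ ∈ Ioo t u, ∃ d, HasDerivAt (fun τ => Real.log (W τ) - c * τ) d τ ∧ d ≤ 0 := by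
      intro τ hτ
      obtain ⟨W', h1, h2⟩ := hd τ hτ
      have hp := hpos τ (Ioo_subset_Icc_self hτ)
      refine ⟨W' / W τ - c * 1, (h1.log hp.ne').sub ((hasDerivAt_id τ).const_mul c), ?_⟩
      have : W' / W τ ≤ c := by rwa [div_le_iff₀ hp]
      linarith
    apply antitoneOn_of_deriv_nonpos (convex_Icc t u)
    · apply ContinuousOn.sub
      · exact hc.continuousOn.log fun τ hτ => (hpos τ hτ).ne'
      · fun_prop
    · rw [interior_Icc]
      intro τ hτ
      obtain ⟨d, h, _⟩ := hder τ hτ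
      exact h.differentiableAt.differentiableWithinAt
    · rw [interior_Icc]
      intro τ hτ
      obtain ⟨d, h, h'⟩ := hder τ hτ
      rwa [h.deriv]
  have := hanti (left_mem_Icc.2 htu) (right_mem_Icc.2 htu) htu
  simp only at this
  linarith

open MeasureTheory Set in
lemma log_bound (W : ℝ → ℝ) (hc : Continuous W) (M : Set ℝ) (CP DP q : ℝ) (hq : 0 < q)
    (hloc : ∀ t ≥ (0 : ℝ), ∃ δ > 0, ∀ τ ∈ Ioo t (t + δ), (τ ∈ M ↔ t ∈ M) ∧
      ∃ W', HasDerivAt W W' τ ∧ (τ ∉ M → q < W τ → W' ≤ -CP * W τ) ∧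
        (τ ∈ M → W' ≤ DP * W τ))
    (a b : ℝ) (ha : 0 ≤ a) (hab : a ≤ b) (hWa : 0 < W a) (hWq : ∀ τ ∈ Ioc a b, q < W τ) :
    Real.log (W b) - Real.log (W a) ≤
      -CP * (b - a) + (CP + DP) * (volume (Ico a b ∩ M)).toReal := by
  have hpos : ∀ τ ∈ Icc a b, 0 < W τ := by
    intro τ hτ
    rcases hτ.1.eq_or_lt with h | h
    · rwa [← h]
    · exact hq.trans (hWq τ ⟨h, hτ.2⟩)
  let S : Set ℝ := {t | Real.log (W t) - Real.log (W a) ≤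
      -CP * (t - a) + (CP + DP) * (volume (Ico a t ∩ M)).toReal}
  have hsub : Icc a b ⊆ S := by
    apply IsClosed.Icc_subset_of_forall_exists_gt
    · have h1 : ContinuousOn (fun t => Real.log (W t) - Real.log (W a)) (Icc a b) :=
        (hc.continuousOn.log fun τ hτ => (hpos τ hτ).ne').sub continuousOn_const
      have h2 : ContinuousOn (fun t => -CP * (t - a) +
          (CP + DP) * (volume (Ico a t ∩ M)).toReal) (Icc a b) :=
        (by fun_prop : ContinuousOn (fun t => -CP * (t - a)) (Icc a b)).add
          (continuousOn_const.mul (mm_cont M a b))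
      have := isClosed_Icc.isClosed_le h1 h2
      convert this using 1
      ext t; simp only [S, mem_inter_iff, mem_setOf_eq, and_comm]
    · simp [S]
    · rintro t ⟨htS, hta, htb⟩ y hy
      obtain ⟨δ, hδ, hl⟩ := hloc t (ha.trans hta)
      have hy' : t < y := hy
      obtain ⟨u, hu1, hu2⟩ : ∃ u, t < u ∧ u < min (min y b) (t + δ) :=
        exists_between (by simp only [lt_min_iff]; exact ⟨⟨hy', htb⟩, by linarith⟩)
      simp only [lt_min_iff] at hu2
      refine ⟨u, ?_, hu1, hu2.1.1.le⟩
      have hadd := mm_add M hta hu1.le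
      have hpos' : ∀ τ ∈ Icc t u, 0 < W τ := fun τ hτ =>
        hpos τ ⟨hta.trans hτ.1, hτ.2.trans hu2.1.2.le⟩
      have htS' : Real.log (W t) - Real.log (W a) ≤
        -CP * (t - a) + (CP + DP) * (volume (Ico a t ∩ M)).toReal := htS
      change Real.log (W u) - Real.log (W a) ≤
        -CP * (u - a) + (CP + DP) * (volume (Ico a u ∩ M)).toReal
      rw [hadd]
      by_cases hM : t ∈ M
      · have hset : Ico t u ∩ M = Ico t u := by
          apply inter_eq_left.2
          intro τ hτ
          rcases hτ.1.eq_or_lt with h | h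
          · rwa [← h]
          · exact (hl τ ⟨h, hτ.2.trans hu2.2⟩).1.2 hM
        have hv : (volume (Ico t u ∩ M)).toReal = u - t := by
          rw [hset]; simp [hu1.le]
        have := log_step W hc DP t u hu1.le hpos' (by
          intro τ hτ
          obtain ⟨h1, W', h2, _, h4⟩ := hl τ ⟨hτ.1, hτ.2.trans hu2.2⟩
          exact ⟨W', h2, h4 (h1.2 hM)⟩)
        rw [hv]
        linarith
      · have := log_step W hc (-CP) t u hu1.le hpos' (by
          intro τ hτ
          obtain ⟨h1, W', h2, h3, _⟩ := hl τ ⟨hτ.1, hτ.2.trans hu2.2⟩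
          exact ⟨W', h2, h3 (fun h => hM (h1.1 h))
            (hWq τ ⟨hta.trans_lt hτ.1, (hτ.2.trans hu2.1.2).le⟩)⟩)
        have hset : Ico t u ∩ M = ∅ := by
          rw [eq_empty_iff_forall_notMem]
          rintro τ ⟨hτ, hτM⟩
          rcases hτ.1.eq_or_lt with h | h
          · rw [← h] at hτM; exact hM hτM
          · exact hM ((hl τ ⟨h, hτ.2.trans hu2.2⟩).1.1 hτM)
        rw [hset]
        simp only [measure_empty, ENNReal.toReal_zero]
        linarith
  exact hsub (right_mem_Icc.2 hab)

open MeasureTheory Set in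
lemma mm_first (M : Set ℝ) 
    (hloc : ∀ t ≥ (0 : ℝ), ∃ δ > 0, ∀ τ ∈ Ioo t (t + δ), (τ ∈ M ↔ t ∈ M))
    (f L : ℝ) (hf : 0 ≤ f) (hL : 0 ≤ L)
    (hb : ∀ T₀ ≥ (0 : ℝ), T₀ ∈ M → ∀ t > T₀, (volume (Ico T₀ t ∩ M)).toReal ≤ f + L * (t - T₀))
    (s t : ℝ) (hs : 0 ≤ s) (hst : s ≤ t) :
    (volume (Ico s t ∩ M)).toReal ≤ f + L * (t - s) := by
  rcases (Ico s t ∩ M).eq_empty_or_nonempty with h | h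
  · rw [h]
    simp only [measure_empty, ENNReal.toReal_zero]
    have : 0 ≤ L * (t - s) := mul_nonneg hL (by linarith)
    linarith
  · have hbd : BddBelow (Ico s t ∩ M) := ⟨s, fun x hx => hx.1.1⟩
    set T := sInf (Ico s t ∩ M) with hT
    have hsT : s ≤ T := le_csInf h fun x hx => hx.1.1
    have hTt : T < t := by
      obtain ⟨x, hx⟩ := h
      exact (csInf_le hbd hx).trans_lt hx.1.2
    have hTM : T ∈ M := by
      by_contra hTM
      obtain ⟨δ, hδ, hl⟩ := hloc T (hs.trans hsT)
      obtain ⟨x, hx, hxT⟩ := exists_lt_of_csInf_lt h (show sInf (Ico s t ∩ M) < T + δ by linarith)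
      have hTx : T ≤ x := csInf_le hbd hx
      rcases hTx.eq_or_lt with h' | h'
      · rw [h'] at hTM; exact hTM hx.2
      · exact hTM ((hl x ⟨h', hxT⟩).1 hx.2)
    have h0 : Ico s T ∩ M = ∅ := by
      rw [eq_empty_iff_forall_notMem]
      rintro x ⟨hx, hxM⟩
      have := csInf_le hbd (show x ∈ Ico s t ∩ M from ⟨⟨hx.1, hx.2.trans hTt⟩, hxM⟩)
      exact absurd hx.2 (not_lt.2 this)
    rw [mm_add M hsT hTt.le, h0]
    simp only [measure_empty, ENNReal.toReal_zero]
    have := hb T (hs.trans hsT) hTM t hTt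
    have : L * (t - T) ≤ L * (t - s) := mul_le_mul_of_nonneg_left (by linarith) hL
    linarith

open MeasureTheory Set in
lemma abstract_main (W : ℝ → ℝ) (hc : Continuous W) (M : Set ℝ) (CP DP q : ℝ) (hq : 0 < q)
    (hCP : 0 < CP) (hDP : 0 < DP)
    (hloc : ∀ t ≥ (0 : ℝ), ∃ δ > 0, ∀ τ ∈ Ioo t (t + δ), (τ ∈ M ↔ t ∈ M) ∧
      ∃ W', HasDerivAt W W' τ ∧ (τ ∉ M → q < W τ → W' ≤ -CP * W τ) ∧
        (τ ∈ M → W' ≤ DP * W τ))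
    (L : ℝ) (hL0 : 0 ≤ L) (hL : L < CP / (CP + DP)) (κ : ℝ) (hκ : 1 < κ) (Q : ℝ)
    (hQ : κ ^ 2 * q < Q) (f : ℝ) (hf : f = 2 * Real.log κ / (CP + DP))
    (h0 : ∀ t > (0 : ℝ), (volume (Ico 0 t ∩ M)).toReal ≤ L * t)
    (hb : ∀ T₀ ≥ (0 : ℝ), T₀ ∈ M → ∀ t > T₀, (volume (Ico T₀ t ∩ M)).toReal ≤ f + L * (t - T₀))
    (hW0 : W 0 < Q) :
    (∃ Tr ≥ (0 : ℝ), ∀ t ≥ Tr, W t < κ ^ 2 * q) ∧ ∀ t ≥ (0 : ℝ), W t < Q := by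
  have hS : 0 < CP + DP := by linarith
  have hlk : 0 < Real.log κ := Real.log_pos hκ
  have hf0 : 0 ≤ f := by rw [hf]; positivity
  have hfS : (CP + DP) * f = 2 * Real.log κ := by rw [hf]; field_simp
  set α := CP - (CP + DP) * L with hα
  have hαpos : 0 < α := by
    rw [lt_div_iff₀ hS] at hL
    linarith
  -- once below, bounded
  have ph2 : ∀ T ≥ 0, W T ≤ q → ∀ t ≥ T, W t < κ ^ 2 * q := by
    intro T hT hWT t ht
    by_contra hcon
    push Not at hcon
    have hκ2 : 1 < κ ^ 2 := by nlinarith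
    have hqt : q < W t := by nlinarith
    let A : Set ℝ := Icc T t ∩ {s | W s ≤ q}
    have hAc : IsCompact A := isCompact_Icc.inter_right (isClosed_le hc continuous_const)
    have hAn : A.Nonempty := ⟨T, ⟨le_rfl, ht⟩, hWT⟩
    obtain ⟨s, ⟨hs1, hs2⟩, hsmax⟩ := hAc.exists_isGreatest hAn
    have hs2' : W s ≤ q := hs2
    have hab : ∀ τ ∈ Ioc s t, q < W τ := by
      intro τ hτ
      by_contra h
      have : τ ≤ s := hsmax ⟨⟨hs1.1.trans hτ.1.le, hτ.2⟩, not_lt.1 h⟩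
      exact absurd hτ.1 (not_lt.2 this)
    have hst : s < t := by
      rcases hs1.2.eq_or_lt with h | h
      · rw [h] at hs2'; linarith
      · exact h
    have hsq : q ≤ W s := by
      have hcl : IsClosed {τ | q ≤ W τ} := isClosed_le continuous_const hc
      have : closure (Ioc s t) ⊆ {τ | q ≤ W τ} :=
        closure_minimal (fun τ hτ => (hab τ hτ).le) hcl
      rw [closure_Ioc hst.ne] at this
      exact this (left_mem_Icc.2 hst.le)
    have hs0 : 0 ≤ s := le_trans hT hs1.1
    have hWs : W s = q := le_antisymm hs2' hsq
    have h1 := log_bound W hc M CP DP q hq hloc s t hs0 hst.le (by rw [hWs]; exact hq) hab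
    have h2 := mm_first M (fun t ht => by
      obtain ⟨δ, hδ, h⟩ := hloc t ht
      exact ⟨δ, hδ, fun τ hτ => (h τ hτ).1⟩) f L hf0 hL0 hb s t hs0 hst.le
    have h3 := mul_le_mul_of_nonneg_left h2 hS.le
    have h4 : Real.log (κ ^ 2 * q) ≤ Real.log (W t) := Real.log_le_log (by positivity) hcon
    rw [Real.log_mul (by positivity) hq.ne', Real.log_pow] at h4
    push_cast at h4
    rw [hWs] at h1
    have h5 : 0 < α * (t - s) := mul_pos hαpos (by linarith)
    rw [hα] at h5
    nlinarith
  -- before reaching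
  have ph1 : ∀ t ≥ 0, (∀ τ ∈ Icc 0 t, q < W τ) → Real.log (W t) ≤ Real.log (W 0) - α * t := by
    intro t ht h
    rcases ht.eq_or_lt with h' | h'
    · rw [← h']; simp
    have hp : 0 < W 0 := hq.trans (h 0 ⟨le_rfl, ht⟩)
    have h1 := log_bound W hc M CP DP q hq hloc 0 t le_rfl ht hp
      (fun τ hτ => h τ (Ioc_subset_Icc_self hτ))
    have h3 := mul_le_mul_of_nonneg_left (h0 t h') hS.le
    rw [hα]
    nlinarith
  constructor
  · have : ∃ T ≥ 0, W T ≤ q := by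
      by_contra hcon
      push Not at hcon
      have hp : 0 < W 0 := hq.trans (hcon 0 le_rfl)
      have hlog : Real.log q < Real.log (W 0) := Real.log_lt_log hq (hcon 0 le_rfl)
      let t := (Real.log (W 0) - Real.log q) / α
      have ht : 0 ≤ t := div_nonneg (by linarith) hαpos.le
      have h1 := ph1 t ht (fun τ hτ => hcon τ hτ.1)
      have h2 : α * t = Real.log (W 0) - Real.log q := by
        simp only [t]; field_simp
      have h3 := Real.log_lt_log hq (hcon t ht)
      linarith
    obtain ⟨T, hT, hWT⟩ := this
    exact ⟨T, hT, ph2 T hT hWT⟩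
  · intro t ht
    by_cases h : ∃ T ∈ Icc 0 t, W T ≤ q
    · obtain ⟨T, hT, hWT⟩ := h
      exact (ph2 T hT.1 hWT t hT.2).trans hQ
    · push Not at h
      have h1 := ph1 t ht h
      have hp : 0 < W 0 := hq.trans (h 0 ⟨le_rfl, ht⟩)
      have hp' : 0 < W t := hq.trans (h t ⟨ht, le_rfl⟩)
      have h2 : 0 ≤ α * t := mul_nonneg hαpos.le ht
      have : W t ≤ W 0 := (Real.log_le_log_iff hp' hp).1 (by linarith)
      linarith

/-- Theorem 2, the main stability theorem of the paper.  Under the standing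
assumptions, at most one switch per sampling interval, `L ∈ [0, C_P/(C_P+D_P))`,
`κ > 1` with `κ²r²λ_min(P) < R²λ_max(P)` and `f(κ) := 2 log κ/(C_P+D_P)`: if
(a) `μ(t,0) ≤ L t` for all `t > 0`, (b) `μ(t,T₀) ≤ f(κ) + L(t−T₀)` for all `t > T₀`
whenever `σ(T₀) ≠ σ([T₀]⁻)`, and (c) `W(0) < R²λ_max(P)`, then there exists
`T_r ≥ 0` with `W(t) < κ²r²λ_min(P)` for all `t ≥ T_r`, and moreover
`W(t) < R²λ_max(P)` for all `t ≥ 0`. -/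
theorem main_stability_theorem {n : ℕ} {ι : Type*} [Fintype ι] [Nonempty ι]
    (Ts : ℝ) (hTs : 0 < Ts)
    (smp : ℝ → ℝ) (hsmp : ∀ t, smp t = Ts * (⌊t / Ts⌋ : ℝ))
    (σ : ℝ → ι)
    (tk : ℕ → ℝ) (htk0 : tk 0 = 0) (htkmono : StrictMono tk)
    (htktop : Filter.Tendsto tk Filter.atTop Filter.atTop)
    (hconst : ∀ k, ∀ s ∈ Set.Ico (tk k) (tk (k + 1)), σ s = σ (tk k))
    (μ : ℝ → ℝ → ℝ)
    (hμ : ∀ t₁ t₂ : ℝ, μ t₁ t₂ =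
      (MeasureTheory.volume {τ ∈ Set.Ico t₂ t₁ | σ τ ≠ σ (smp τ)}).toReal)
    (CP DP R r : ℝ) (hCP : 0 < CP) (hDP : 0 < DP) (hr : 0 < r) (hrR : r < R)
    (P : EuclideanSpace ℝ (Fin n) →L[ℝ] EuclideanSpace ℝ (Fin n))
    (hPsym : ∀ y z : EuclideanSpace ℝ (Fin n), ⟪P y, z⟫ = ⟪y, P z⟫)
    (lmin lmax : ℝ) (hlminpos : 0 < lmin)
    (hlmin₁ : ∀ y : EuclideanSpace ℝ (Fin n), lmin * ‖y‖ ^ 2 ≤ ⟪y, P y⟫)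
    (hlmin₂ : ∃ y : EuclideanSpace ℝ (Fin n), y ≠ 0 ∧ ⟪y, P y⟫ = lmin * ‖y‖ ^ 2)
    (hlmax₁ : ∀ y : EuclideanSpace ℝ (Fin n), ⟪y, P y⟫ ≤ lmax * ‖y‖ ^ 2)
    (hlmax₂ : ∃ y : EuclideanSpace ℝ (Fin n), y ≠ 0 ∧ ⟪y, P y⟫ = lmax * ‖y‖ ^ 2)
    (x : ℝ → EuclideanSpace ℝ (Fin n)) (hx : Continuous x)
    (W : ℝ → ℝ) (hW : ∀ t, W t = ⟪x t, P (x t)⟫)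
    (hderiv : ∀ t > (0 : ℝ), (∀ k, t ≠ tk k) → (∀ k : ℕ, t ≠ (k : ℝ) * Ts) →
      ∃ W', HasDerivAt W W' t ∧
        (σ t = σ (smp t) → r ^ 2 * lmin < W t → W' ≤ -CP * W t) ∧
        (σ t ≠ σ (smp t) → W' ≤ DP * W t))
    (hone : ∀ k : ℕ, ∀ i j : ℕ,
      tk i ∈ Set.Ioo ((k : ℝ) * Ts) (((k : ℝ) + 1) * Ts) →
      tk j ∈ Set.Ioo ((k : ℝ) * Ts) (((k : ℝ) + 1) * Ts) → i = j)
    (L : ℝ) (hL : L ∈ Set.Ico 0 (CP / (CP + DP)))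
    (κ : ℝ) (hκ : 1 < κ) (hκrR : κ ^ 2 * r ^ 2 * lmin < R ^ 2 * lmax)
    (fκ : ℝ) (hfκ : fκ = 2 * Real.log κ / (CP + DP))
    (hμL : ∀ t > (0 : ℝ), μ t 0 ≤ L * t)
    (hμf : ∀ T₀ ≥ (0 : ℝ), σ T₀ ≠ σ (smp T₀) →
      ∀ t > T₀, μ t T₀ ≤ fκ + L * (t - T₀))
    (hW0 : W 0 < R ^ 2 * lmax) :
    (∃ Tr ≥ (0 : ℝ), ∀ t ≥ Tr, W t < κ ^ 2 * r ^ 2 * lmin) ∧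
      ∀ t ≥ (0 : ℝ), W t < R ^ 2 * lmax := by
  have hWc : Continuous W := by
    have : W = fun t => ⟪x t, P (x t)⟫ := funext hW
    rw [this]
    exact hx.inner (P.continuous.comp hx)
  have hloc : ∀ t ≥ (0 : ℝ), ∃ δ > 0, ∀ τ ∈ Set.Ioo t (t + δ),
      (τ ∈ {τ | σ τ ≠ σ (smp τ)} ↔ t ∈ {τ | σ τ ≠ σ (smp τ)}) ∧
      ∃ W', HasDerivAt W W' τ ∧ (τ ∉ {τ | σ τ ≠ σ (smp τ)} → r ^ 2 * lmin < W τ →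
        W' ≤ -CP * W τ) ∧ (τ ∈ {τ | σ τ ≠ σ (smp τ)} → W' ≤ DP * W τ) := by
    intro t ht
    obtain ⟨k, hk1, hk2⟩ : ∃ k, tk k ≤ t ∧ t < tk (k + 1) := by
      have hex : ∃ j, t < tk j := (htktop.eventually_gt_atTop t).exists
      classical
      have h1 := Nat.find_spec hex
      have h2 : Nat.find hex ≠ 0 := by
        intro h
        rw [h, htk0] at h1
        linarith
      obtain ⟨k, hk⟩ := Nat.exists_eq_succ_of_ne_zero h2
      refine ⟨k, ?_, ?_⟩
      · exact not_lt.1 (Nat.find_min hex (by omega))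
      · rw [hk] at h1; exact h1
    have hm1 : (⌊t / Ts⌋ : ℝ) * Ts ≤ t := (le_div_iff₀ hTs).1 (Int.floor_le _)
    have hm2 : t < ((⌊t / Ts⌋ : ℝ) + 1) * Ts := (div_lt_iff₀ hTs).1 (Int.lt_floor_add_one _)
    refine ⟨min (tk (k + 1) - t) (((⌊t / Ts⌋ : ℝ) + 1) * Ts - t),
      lt_min (by linarith) (by linarith), ?_⟩
    rintro τ ⟨hτ1, hτ2⟩
    have hτk : τ < tk (k + 1) := by
      linarith [min_le_left (tk (k + 1) - t) (((⌊t / Ts⌋ : ℝ) + 1) * Ts - t)]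
    have hτm : τ < ((⌊t / Ts⌋ : ℝ) + 1) * Ts := by
      linarith [min_le_right (tk (k + 1) - t) (((⌊t / Ts⌋ : ℝ) + 1) * Ts - t)]
    have hfl : ⌊τ / Ts⌋ = ⌊t / Ts⌋ := by
      rw [Int.floor_eq_iff]
      exact ⟨(le_div_iff₀ hTs).2 (by linarith), (div_lt_iff₀ hTs).2 hτm⟩
    have hsm : smp τ = smp t := by rw [hsmp, hsmp, hfl]
    have hσ : σ τ = σ t := by
      rw [hconst k τ ⟨by linarith, hτk⟩, hconst k t ⟨hk1, hk2⟩]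
    have hiff : (τ ∈ {τ | σ τ ≠ σ (smp τ)} ↔ t ∈ {τ | σ τ ≠ σ (smp τ)}) := by
      simp only [Set.mem_setOf_eq, hsm, hσ]
    refine ⟨hiff, ?_⟩
    obtain ⟨W', h1, h2, h3⟩ := hderiv τ (by linarith) (by
      intro j hj
      have ha : k < j := htkmono.lt_iff_lt.1 (by linarith)
      have hb : j < k + 1 := htkmono.lt_iff_lt.1 (by linarith)
      omega) (by
      intro j hj
      have ha : (⌊t / Ts⌋ : ℝ) < (j : ℝ) := lt_of_mul_lt_mul_right (by linarith) hTs.le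
      have hb : (j : ℝ) < (⌊t / Ts⌋ : ℝ) + 1 := lt_of_mul_lt_mul_right (by linarith) hTs.le
      have ha' : ⌊t / Ts⌋ < (j : ℤ) := by exact_mod_cast ha
      have hb' : (j : ℤ) < ⌊t / Ts⌋ + 1 := by exact_mod_cast hb
      omega)
    exact ⟨W', h1, fun h => h2 (not_not.1 h), h3⟩
  have key := abstract_main W hWc {τ | σ τ ≠ σ (smp τ)} CP DP (r ^ 2 * lmin) (by positivity)
    hCP hDP hloc L hL.1 hL.2 κ hκ (R ^ 2 * lmax) (by rw [← mul_assoc]; exact hκrR) fκ hfκ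
    (fun t ht => by
      have := hμL t ht
      rw [hμ] at this
      exact this)
    (fun T₀ hT hm t ht => by
      have := hμf T₀ hT hm t ht
      rw [hμ] at this
      exact this) hW0
  simpa only [← mul_assoc] using key
end

section
/- Let n ∈ ℕ satisfy n > 1 + D_P/C_P, set κ := exp(T_s·(C_P + D_P)/2), and suppose κ²·r²·λ_min(P) < R²·λ_max(P) and W(0) < R²·λ_max(P). Suppose σ has dwell time n·T_s, i.e. there exists a strictly increasing sequence 0 = t₀ < t₁ < t₂ < ⋯ with t_{k+1} − t_k ≥ n·T_s for all k and σ constant on each [t_k, t_{k+1}). Then there exists T_r ≥ 0 such that W(t) < κ²·r²·λ_min(P) for all t ≥ T_r; moreover, W(t) < R²·λ_max(P) for all t ≥ 0. -/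
open scoped RealInnerProductSpace

theorem aux_anti (S : Finset ℝ) : ∀ (f : ℝ → ℝ) (u v : ℝ), u ≤ v → Continuous f →
    (∀ t ∈ Set.Ioo u v, t ∉ S → ∃ d, HasDerivAt f d t ∧ d ≤ 0) → f v ≤ f u := by
  induction S using Finset.induction_on with
  | empty =>
    intro f u v huv hf h
    have hanti : AntitoneOn f (Set.Icc u v) := by
      apply antitoneOn_of_deriv_nonpos (convex_Icc u v) hf.continuousOn
      · intro t ht
        rw [interior_Icc] at ht
        obtain ⟨d, hd, _⟩ := h t ht (by simp)
        exact hd.differentiableAt.differentiableWithinAt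
      · intro t ht
        rw [interior_Icc] at ht
        obtain ⟨d, hd, hd0⟩ := h t ht (by simp)
        rw [hd.deriv]; exact hd0
    exact hanti ⟨le_refl u, huv⟩ ⟨huv, le_refl v⟩ huv
  | insert p S hp ih =>
    intro f u v huv hf h
    by_cases hpm : p ∈ Set.Ioo u v
    · have h1 : f p ≤ f u := by
        apply ih f u p hpm.1.le hf
        intro t ht hts
        apply h t ⟨ht.1, ht.2.trans hpm.2⟩
        simp only [Finset.mem_insert, not_or]
        exact ⟨ht.2.ne, hts⟩
      have h2 : f v ≤ f p := by
        apply ih f p v hpm.2.le hf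
        intro t ht hts
        apply h t ⟨hpm.1.trans ht.1, ht.2⟩
        simp only [Finset.mem_insert, not_or]
        exact ⟨ht.1.ne', hts⟩
      exact h2.trans h1
    · apply ih f u v huv hf
      intro t ht hts
      apply h t ht
      simp only [Finset.mem_insert, not_or]
      exact ⟨fun e => hpm (e ▸ ht), hts⟩

theorem aux_exp (S : Finset ℝ) (f : ℝ → ℝ) (c u v : ℝ) (huv : u ≤ v) (hf : Continuous f)
    (h : ∀ t ∈ Set.Ioo u v, t ∉ S → ∃ d, HasDerivAt f d t ∧ d ≤ c * f t) :
    f v ≤ f u * Real.exp (c * (v - u)) := by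
  have key := aux_anti S (fun t => f t * Real.exp (-(c * t))) u v huv (by fun_prop) (by
    intro t ht hts
    obtain ⟨d, hd, hd'⟩ := h t ht hts
    have he : HasDerivAt (fun t : ℝ => Real.exp (-(c * t))) (Real.exp (-(c * t)) * (-(c * 1))) t :=
      (((hasDerivAt_id t).const_mul c).neg).exp
    refine ⟨_, hd.mul he, ?_⟩
    have : 0 < Real.exp (-(c * t)) := Real.exp_pos _
    nlinarith)
  have key2 : f v * Real.exp (-(c * v)) ≤ f u * Real.exp (-(c * u)) := key
  have e1 : f v = f v * Real.exp (-(c * v)) * Real.exp (c * v) := by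
    rw [mul_assoc, ← Real.exp_add]; simp
  have e2 : f u * Real.exp (c * (v - u)) = f u * Real.exp (-(c * u)) * Real.exp (c * v) := by
    rw [mul_assoc, ← Real.exp_add]; congr 2; ring
  rw [e1, e2]
  exact mul_le_mul_of_nonneg_right key2 (Real.exp_pos _).le

theorem aux_comp (S : Finset ℝ) (f : ℝ → ℝ) (a c u v : ℝ) (huv : u ≤ v) (hf : Continuous f)
    (h : ∀ t ∈ Set.Ioo u v, t ∉ S → ∃ d, HasDerivAt f d t ∧ (a < f t → d ≤ c * f t)) :
    f v ≤ f u * Real.exp (c * (v - u)) ∨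
      ∃ τ ∈ Set.Icc u v, f v ≤ a * Real.exp (c * (v - τ)) := by
  by_cases hex : ∃ t ∈ Set.Icc u v, f t ≤ a
  · right
    have hc : IsCompact (Set.Icc u v ∩ {t | f t ≤ a}) :=
      isCompact_Icc.inter_right (isClosed_le hf continuous_const)
    obtain ⟨τ, ⟨hτ, hτa⟩, hub⟩ := hc.exists_isGreatest (by
      obtain ⟨t, ht, hta⟩ := hex
      exact ⟨t, ht, hta⟩)
    refine ⟨τ, hτ, ?_⟩
    have := aux_exp S f c τ v hτ.2 hf (by
      intro t ht hts
      obtain ⟨d, hd, hd'⟩ := h t ⟨hτ.1.trans_lt ht.1, ht.2⟩ hts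
      refine ⟨d, hd, hd' ?_⟩
      by_contra hcon
      have := hub ⟨⟨hτ.1.trans ht.1.le, ht.2.le⟩, not_lt.mp hcon⟩
      exact absurd ht.1 (not_lt.mpr this))
    exact this.trans (mul_le_mul_of_nonneg_right hτa (Real.exp_pos _).le)
  · left
    push Not at hex
    apply aux_exp S f c u v huv hf
    intro t ht hts
    obtain ⟨d, hd, hd'⟩ := h t ht hts
    exact ⟨d, hd, hd' (hex t ⟨ht.1.le, ht.2.le⟩)⟩

theorem aux_decay (S : Finset ℝ) (f : ℝ → ℝ) (a C u v : ℝ) (ha : 0 < a) (hC : 0 < C)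
    (huv : u ≤ v) (hf : Continuous f)
    (h : ∀ t ∈ Set.Ioo u v, t ∉ S → ∃ d, HasDerivAt f d t ∧ (a < f t → d ≤ -C * f t)) :
    f v ≤ max a (f u * Real.exp (-C * (v - u))) := by
  rcases aux_comp S f a (-C) u v huv hf h with h1 | ⟨τ, hτ, h1⟩
  · exact h1.trans (le_max_right _ _)
  · refine le_trans (h1.trans ?_) (le_max_left _ _)
    have : Real.exp (-C * (v - τ)) ≤ 1 := by
      rw [Real.exp_le_one_iff]; nlinarith [hτ.2]
    nlinarith

theorem aux_grow (S : Finset ℝ) (f : ℝ → ℝ) (a D u v : ℝ) (ha : 0 < a) (hD : 0 < D)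
    (huv : u ≤ v) (hf : Continuous f)
    (h : ∀ t ∈ Set.Ioo u v, t ∉ S → ∃ d, HasDerivAt f d t ∧ (a < f t → d ≤ D * f t)) :
    f v ≤ max a (f u) * Real.exp (D * (v - u)) := by
  rcases aux_comp S f a D u v huv hf h with h1 | ⟨τ, hτ, h1⟩
  · exact h1.trans (mul_le_mul_of_nonneg_right (le_max_right _ _) (Real.exp_pos _).le)
  · refine h1.trans ?_
    apply mul_le_mul (le_max_left _ _) _ (Real.exp_pos _).le (ha.le.trans (le_max_left _ _))
    rw [Real.exp_le_exp]
    exact mul_le_mul_of_nonneg_left (by linarith [hτ.1]) hD.le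

set_option maxHeartbeats 2000000 in
/-- Theorem 3 of the paper.  Let `N ∈ ℕ` satisfy `N > 1 + D_P/C_P`, set
`κ := exp(Ts (C_P+D_P)/2)`, and suppose `κ²r²λ_min(P) < R²λ_max(P)` and
`W(0) < R²λ_max(P)`.  If the switching signal `σ` has dwell time `N Ts`, then there
exists `T_r ≥ 0` with `W(t) < κ²r²λ_min(P)` for all `t ≥ T_r`, and moreover
`W(t) < R²λ_max(P)` for all `t ≥ 0`. -/
theorem dwell_time_stability {n : ℕ} {ι : Type*} [Fintype ι] [Nonempty ι]
    (N : ℕ)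
    (Ts : ℝ) (hTs : 0 < Ts)
    (smp : ℝ → ℝ) (hsmp : ∀ t, smp t = Ts * (⌊t / Ts⌋ : ℝ))
    (σ : ℝ → ι)
    (tk : ℕ → ℝ) (htk0 : tk 0 = 0) (htkmono : StrictMono tk)
    (htkdwell : ∀ k, (N : ℝ) * Ts ≤ tk (k + 1) - tk k)
    (hconst : ∀ k, ∀ s ∈ Set.Ico (tk k) (tk (k + 1)), σ s = σ (tk k))
    (CP DP R r : ℝ) (hCP : 0 < CP) (hDP : 0 < DP) (hr : 0 < r) (hrR : r < R)
    (P : EuclideanSpace ℝ (Fin n) →L[ℝ] EuclideanSpace ℝ (Fin n))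
    (hPsym : ∀ y z : EuclideanSpace ℝ (Fin n), ⟪P y, z⟫ = ⟪y, P z⟫)
    (lmin lmax : ℝ) (hlminpos : 0 < lmin)
    (hlmin₁ : ∀ y : EuclideanSpace ℝ (Fin n), lmin * ‖y‖ ^ 2 ≤ ⟪y, P y⟫)
    (hlmin₂ : ∃ y : EuclideanSpace ℝ (Fin n), y ≠ 0 ∧ ⟪y, P y⟫ = lmin * ‖y‖ ^ 2)
    (hlmax₁ : ∀ y : EuclideanSpace ℝ (Fin n), ⟪y, P y⟫ ≤ lmax * ‖y‖ ^ 2)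
    (hlmax₂ : ∃ y : EuclideanSpace ℝ (Fin n), y ≠ 0 ∧ ⟪y, P y⟫ = lmax * ‖y‖ ^ 2)
    (x : ℝ → EuclideanSpace ℝ (Fin n)) (hx : Continuous x)
    (W : ℝ → ℝ) (hW : ∀ t, W t = ⟪x t, P (x t)⟫)
    (hderiv : ∀ t > (0 : ℝ), (∀ k, t ≠ tk k) → (∀ k : ℕ, t ≠ (k : ℝ) * Ts) →
      ∃ W', HasDerivAt W W' t ∧
        (σ t = σ (smp t) → r ^ 2 * lmin < W t → W' ≤ -CP * W t) ∧
        (σ t ≠ σ (smp t) → W' ≤ DP * W t))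
    (hN : (1 : ℝ) + DP / CP < (N : ℝ))
    (κ : ℝ) (hκ : κ = Real.exp (Ts * (CP + DP) / 2))
    (hκrR : κ ^ 2 * r ^ 2 * lmin < R ^ 2 * lmax)
    (hW0 : W 0 < R ^ 2 * lmax) :
    (∃ Tr ≥ (0 : ℝ), ∀ t ≥ Tr, W t < κ ^ 2 * r ^ 2 * lmin) ∧
      ∀ t ≥ (0 : ℝ), W t < R ^ 2 * lmax := by
  set a := r ^ 2 * lmin with ha_def
  have ha : 0 < a := by positivity
  have hK : κ ^ 2 * r ^ 2 * lmin = Real.exp (Ts * (CP + DP)) * a := by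
    have : κ ^ 2 = Real.exp (Ts * (CP + DP)) := by
      rw [hκ, sq, ← Real.exp_add]; congr 1; ring
    rw [this, ha_def]; ring
  rw [hK] at hκrR ⊢
  have hWc : Continuous W := by
    have : W = fun t => ⟪x t, P (x t)⟫ := funext hW
    rw [this]; fun_prop
  have hWnn : ∀ t, 0 ≤ W t := fun t => by
    rw [hW t]
    exact le_trans (by positivity) (hlmin₁ (x t))
  have hDC : CP + DP < CP * N := by
    have := mul_lt_mul_of_pos_left hN hCP
    rw [mul_add, mul_one, mul_div_cancel₀ _ hCP.ne'] at this
    exact this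
  have hN1 : (1 : ℝ) < N := by
    have : 0 < DP / CP := by positivity
    linarith
  have htknn : ∀ k, 0 ≤ tk k := fun k => htk0 ▸ htkmono.monotone (Nat.zero_le k)
  set s : ℕ → ℝ := fun k => Ts * (⌈tk k / Ts⌉ : ℝ) with hs_def
  have hs1 : ∀ k, tk k ≤ s k := fun k => by
    have := Int.le_ceil (tk k / Ts)
    rw [div_le_iff₀ hTs] at this
    simp only [hs_def]; linarith
  have hs2 : ∀ k, s k < tk k + Ts := fun k => by
    have := Int.ceil_lt_add_one (tk k / Ts)
    have := mul_lt_mul_of_pos_left this hTs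
    rw [mul_add, mul_div_cancel₀ _ hTs.ne'] at this
    simp only [hs_def]; linarith
  have hs3 : ∀ k, s k ≤ tk (k + 1) := fun k => by
    have := htkdwell k; have := hs2 k
    nlinarith
  have hs0 : s 0 = 0 := by simp [hs_def, htk0]
  -- the exceptional set
  set E : ℕ → Finset ℝ := fun k =>
    (Finset.range (⌈tk (k + 1) / Ts⌉₊ + 1)).image (fun j : ℕ => (j : ℝ) * Ts) with hE
  have hder : ∀ k, ∀ t ∈ Set.Ioo (tk k) (tk (k + 1)), t ∉ E k → ∃ W', HasDerivAt W W' t ∧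
        (σ t = σ (smp t) → a < W t → W' ≤ -CP * W t) ∧
        (σ t ≠ σ (smp t) → W' ≤ DP * W t) := by
    intro k t ht htE
    apply hderiv t ((htknn k).trans_lt ht.1)
    · intro j hj
      rw [hj] at ht
      have h1 := htkmono.lt_iff_lt.mp ht.1
      have h2 := htkmono.lt_iff_lt.mp ht.2
      omega
    · intro j hj
      apply htE
      simp only [hE, Finset.mem_image, Finset.mem_range]
      refine ⟨j, ?_, hj.symm⟩
      have h1 : (j : ℝ) < tk (k + 1) / Ts := by
        rw [lt_div_iff₀ hTs, ← hj]; exact ht.2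
      have h2 : (j : ℝ) < (⌈tk (k + 1) / Ts⌉₊ : ℝ) := h1.trans_le (Nat.le_ceil _)
      have := Nat.cast_lt.mp h2
      omega
  have hA : ∀ k, ∀ t ∈ Set.Icc (tk k) (s k),
      W t ≤ max a (W (tk k)) * Real.exp (DP * (t - tk k)) := by
    intro k t ht
    apply aux_grow (E k) W a DP _ _ ha hDP ht.1 hWc
    intro y hy hyE
    obtain ⟨d, hd, h1, h2⟩ := hder k y ⟨hy.1, hy.2.trans_le (ht.2.trans (hs3 k))⟩ hyE
    refine ⟨d, hd, fun hay => ?_⟩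
    by_cases hσ : σ y = σ (smp y)
    · have := h1 hσ hay
      nlinarith [hWnn y]
    · exact h2 hσ
  have hB : ∀ k, ∀ t ∈ Set.Icc (s k) (tk (k + 1)),
      W t ≤ max a (W (s k) * Real.exp (-CP * (t - s k))) := by
    intro k t ht
    apply aux_decay (E k) W a CP _ _ ha hCP ht.1 hWc
    intro y hy hyE
    have hym : y ∈ Set.Ioo (tk k) (tk (k + 1)) :=
      ⟨(hs1 k).trans_lt hy.1, hy.2.trans_le ht.2⟩
    obtain ⟨d, hd, h1, h2⟩ := hder k y hym hyE
    refine ⟨d, hd, h1 ?_⟩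
    have hsy : s k ≤ smp y := by
      rw [hsmp]
      apply mul_le_mul_of_nonneg_left _ hTs.le
      rw [Int.cast_le, Int.le_floor, le_div_iff₀ hTs, mul_comm]
      exact hy.1.le
    have hsy2 : smp y ≤ y := by
      rw [hsmp]
      have := Int.floor_le (y / Ts)
      rw [le_div_iff₀ hTs] at this
      linarith
    rw [hconst k y ⟨hym.1.le, hym.2⟩,
      hconst k (smp y) ⟨(hs1 k).trans hsy, hsy2.trans_lt hym.2⟩]
  set ε := CP * N * Ts - (CP + DP) * Ts with hε_def
  have hε : 0 < ε := by
    have := mul_lt_mul_of_pos_right hDC hTs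
    linarith
  have hDT : 0 < DP * Ts := by positivity
  have hCT : 0 < CP * Ts := by positivity
  -- overall bound on one dwell interval
  have hAB : ∀ k, ∀ t ∈ Set.Icc (tk k) (tk (k + 1)),
      W t ≤ max a (W (tk k)) * Real.exp (DP * Ts) := by
    intro k t ht
    have hM : 0 < max a (W (tk k)) := lt_max_of_lt_left ha
    have hE1 : 1 ≤ Real.exp (DP * Ts) := Real.one_le_exp hDT.le
    have hup : ∀ y ∈ Set.Icc (tk k) (s k), W y ≤ max a (W (tk k)) * Real.exp (DP * Ts) := by
      intro y hy
      refine (hA k y hy).trans (mul_le_mul_of_nonneg_left ?_ hM.le)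
      rw [Real.exp_le_exp]
      exact mul_le_mul_of_nonneg_left (by linarith [hy.2, hs2 k]) hDP.le
    rcases le_total t (s k) with h | h
    · exact hup t ⟨ht.1, h⟩
    · refine (hB k t ⟨h, ht.2⟩).trans (max_le ?_ ?_)
      · nlinarith [le_max_left a (W (tk k))]
      · refine le_trans ?_ (hup (s k) ⟨hs1 k, le_refl _⟩)
        have : Real.exp (-CP * (t - s k)) ≤ 1 := by
          rw [Real.exp_le_one_iff]; nlinarith
        nlinarith [hWnn (s k)]
  have hstep : ∀ k, W (tk (k + 1)) ≤ max a (max a (W (tk k)) * Real.exp (-ε)) := by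
    intro k
    have hM : 0 < max a (W (tk k)) := lt_max_of_lt_left ha
    refine (hB k _ ⟨hs3 k, le_refl _⟩).trans (max_le_max (le_refl _) ?_)
    refine (mul_le_mul_of_nonneg_right (hA k (s k) ⟨hs1 k, le_refl _⟩)
      (Real.exp_pos _).le).trans ?_
    rw [mul_assoc, ← Real.exp_add]
    apply mul_le_mul_of_nonneg_left _ hM.le
    rw [Real.exp_le_exp]
    have h1 := mul_le_mul_of_nonneg_left (htkdwell k) hCP.le
    have h2 := mul_le_mul_of_nonneg_left (hs2 k).le hCP.le
    have h3 := mul_le_mul_of_nonneg_left (hs2 k).le hDP.le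
    nlinarith
  have hV : ∀ k, W (tk (k + 1)) ≤ max a (W 0 * Real.exp (-ε * (k + 1) - DP * Ts)) := by
    intro k
    induction k with
    | zero =>
      refine (hB 0 _ ⟨hs3 0, le_refl _⟩).trans (max_le_max (le_refl _) ?_)
      rw [hs0]
      apply mul_le_mul_of_nonneg_left _ (hWnn 0)
      rw [Real.exp_le_exp]
      have h1 := mul_le_mul_of_nonneg_left (htkdwell 0) hCP.le
      rw [htk0] at h1
      push_cast
      nlinarith
    | succ k ih =>
      refine (hstep (k + 1)).trans (max_le (le_max_left _ _) ?_)
      have h1 : Real.exp (-ε) ≤ 1 := by rw [Real.exp_le_one_iff]; linarith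
      refine (mul_le_mul_of_nonneg_right (max_le (le_max_left _ _) ih)
        (Real.exp_pos _).le).trans ?_
      rw [max_mul_of_nonneg _ _ (Real.exp_pos _).le]
      apply max_le_max
      · nlinarith
      · rw [mul_assoc, ← Real.exp_add]
        apply le_of_eq
        congr 2
        push_cast
        ring
  have hbound : ∀ k, ∀ t ∈ Set.Icc (tk (k + 1)) (tk (k + 1 + 1)),
      W t ≤ max (a * Real.exp (DP * Ts)) (W 0 * Real.exp (-ε * (k + 1))) := by
    intro k t ht
    refine (hAB (k + 1) t ht).trans ?_
    refine (mul_le_mul_of_nonneg_right (max_le (le_max_left _ _) (hV k))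
        (Real.exp_pos _).le).trans ?_
    rw [max_mul_of_nonneg _ _ (Real.exp_pos _).le, mul_assoc (W 0), ← Real.exp_add,
      sub_add_cancel]
  have haK : a * Real.exp (DP * Ts) < Real.exp (Ts * (CP + DP)) * a := by
    rw [mul_comm a]
    apply mul_lt_mul_of_pos_right _ ha
    rw [Real.exp_lt_exp]; linarith
  have hgrow : ∀ k : ℕ, (k : ℝ) * Ts ≤ tk k := by
    intro k
    induction k with
    | zero => simp [htk0]
    | succ k ih =>
      have := htkdwell k
      push_cast
      nlinarith
  have hfind : ∀ t ≥ (0 : ℝ), ∃ k, tk k ≤ t ∧ t < tk (k + 1) := by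
    intro t ht
    have hex : ∃ m, t < tk m := by
      obtain ⟨m, hm⟩ := exists_nat_gt (t / Ts)
      rw [div_lt_iff₀ hTs] at hm
      exact ⟨m, hm.trans_le (hgrow m)⟩
    classical
    have hsp := Nat.find_spec hex
    have hne : Nat.find hex ≠ 0 := by
      intro h0
      rw [h0, htk0] at hsp
      linarith
    obtain ⟨m, hm⟩ := Nat.exists_eq_succ_of_ne_zero hne
    refine ⟨m, ?_, ?_⟩
    · exact not_lt.mp (Nat.find_min hex (by omega))
    · rw [hm] at hsp; exact hsp
  constructor
  · obtain ⟨m, hm⟩ := exists_nat_gt (W 0 / (a * ε))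
    rw [div_lt_iff₀ (by positivity)] at hm
    refine ⟨tk (m + 1), htknn _, ?_⟩
    intro t ht
    obtain ⟨k, hk1, hk2⟩ := hfind t ((htknn _).trans ht)
    have hmk : m + 1 < k + 1 := htkmono.lt_iff_lt.mp (lt_of_le_of_lt ht hk2)
    obtain ⟨j, rfl⟩ : ∃ j, k = j + 1 := ⟨k - 1, by omega⟩
    refine (hbound j t ⟨hk1, hk2.le⟩).trans_lt (max_lt haK ?_)
    refine lt_of_le_of_lt ?_ haK
    have hmj : (m : ℝ) ≤ (j : ℝ) + 1 := by
      have : m ≤ j + 1 := by omega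
      exact_mod_cast this
    have h1 : W 0 ≤ a * Real.exp (ε * (j + 1)) := by
      have h2 := Real.add_one_le_exp (ε * ((j : ℝ) + 1))
      have h3 := mul_le_mul_of_nonneg_left h2 ha.le
      have h4 := mul_le_mul_of_nonneg_right hmj (mul_pos ha hε).le
      nlinarith
    have h2 : W 0 * Real.exp (-ε * (j + 1)) ≤ a := by
      have := mul_le_mul_of_nonneg_right h1 (Real.exp_pos (-ε * (j + 1))).le
      rw [mul_assoc a, ← Real.exp_add] at this
      simpa using this
    have hE1 : 1 ≤ Real.exp (DP * Ts) := Real.one_le_exp hDT.le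
    nlinarith
  · intro t ht
    obtain ⟨k, hk1, hk2⟩ := hfind t ht
    rcases k with _ | j
    · refine (hB 0 t ⟨by rw [hs0]; exact ht, hk2.le⟩).trans_lt (max_lt ?_ ?_)
      · refine lt_of_le_of_lt ?_ (haK.trans hκrR)
        have hE1 : 1 ≤ Real.exp (DP * Ts) := Real.one_le_exp hDT.le
        nlinarith
      · rw [hs0]
        refine lt_of_le_of_lt ?_ hW0
        have : Real.exp (-CP * (t - 0)) ≤ 1 := by
          rw [Real.exp_le_one_iff]; nlinarith
        nlinarith [hWnn 0]
    · refine (hbound j t ⟨hk1, hk2.le⟩).trans_lt (max_lt (haK.trans hκrR) ?_)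
      refine lt_of_le_of_lt ?_ hW0
      have : Real.exp (-ε * (j + 1)) ≤ 1 := by
        rw [Real.exp_le_one_iff]
        have : (0 : ℝ) ≤ ε * (j + 1) := by positivity
        linarith
      nlinarith [hWnn 0]
end

section
/- Let σ be a switching signal with dwell time n·T_s. Then the total mismatch time satisfies μ(t, 0) < t/n for every t > 0. -/
/-- First assertion of Proposition 2 of the paper.  For every switching signal `σ`
with dwell time `N Ts`, the total mismatch time satisfies `μ(t,0) < t/N` for every
`t > 0`. -/
theorem mismatch_time_bound_of_dwell {ι : Type*} [Fintype ι] [Nonempty ι]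
    (Ts : ℝ) (hTs : 0 < Ts) (N : ℕ) (hN : 0 < N)
    (smp : ℝ → ℝ) (hsmp : ∀ t, smp t = Ts * (⌊t / Ts⌋ : ℝ))
    (σ : ℝ → ι)
    (tk : ℕ → ℝ) (htk0 : tk 0 = 0) (htkmono : StrictMono tk)
    (htkdwell : ∀ k, (N : ℝ) * Ts ≤ tk (k + 1) - tk k)
    (hconst : ∀ k, ∀ s ∈ Set.Ico (tk k) (tk (k + 1)), σ s = σ (tk k))
    (μ : ℝ → ℝ → ℝ)
    (hμ : ∀ t₁ t₂ : ℝ, μ t₁ t₂ =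
      (MeasureTheory.volume {τ ∈ Set.Ico t₂ t₁ | σ τ ≠ σ (smp τ)}).toReal)
 :
    ∀ t > (0 : ℝ), μ t 0 < t / N := by
  have hNTs : 0 < (N : ℝ) * Ts := by positivity
  have hgrow : ∀ k : ℕ, (k : ℝ) * (N * Ts) ≤ tk k := by
    intro k
    induction k with
    | zero => simp [htk0]
    | succ k ih =>
      have := htkdwell k
      push_cast
      linarith
  have hfind : ∀ s : ℝ, 0 ≤ s → ∃ k, tk k ≤ s ∧ s < tk (k + 1) := by
    intro s hs
    have hex : ∃ n, s < tk n := by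
      obtain ⟨n, hn⟩ := exists_nat_gt (s / (N * Ts))
      rw [div_lt_iff₀ hNTs] at hn
      exact ⟨n, hn.trans_le (hgrow n)⟩
    classical
    have h1 := Nat.find_spec hex
    have h2 : ∀ m, m < Nat.find hex → ¬ s < tk m := fun m hm => Nat.find_min hex hm
    generalize Nat.find hex = n at h1 h2
    cases n with
    | zero => rw [htk0] at h1; linarith
    | succ k => exact ⟨k, not_lt.mp (h2 k (Nat.lt_succ_self k)), h1⟩
  intro t ht
  obtain ⟨K, hK1, hK2⟩ := hfind t ht.le
  have hsub : {τ ∈ Set.Ico 0 t | σ τ ≠ σ (smp τ)} ⊆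
      ⋃ k ∈ Finset.range K, Set.Ico (tk (k + 1)) (Ts * (⌈tk (k + 1) / Ts⌉ : ℝ)) := by
    rintro τ ⟨⟨h0, h1⟩, hne⟩
    obtain ⟨k, hk1, hk2⟩ := hfind τ h0
    have hle : smp τ ≤ τ := by
      rw [hsmp, mul_comm, ← le_div_iff₀ hTs]
      exact Int.floor_le _
    have hlt : smp τ < tk k := by
      by_contra hcon
      push Not at hcon
      exact hne ((hconst k τ ⟨hk1, hk2⟩).trans
        (hconst k _ ⟨hcon, hle.trans_lt hk2⟩).symm)
    have hkK : k < K + 1 := htkmono.lt_iff_lt.mp (hk1.trans_lt (h1.trans hK2))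
    have hk0 : k ≠ 0 := by
      rintro rfl
      rw [htk0, hsmp] at hlt
      have : (0 : ℝ) ≤ (⌊τ / Ts⌋ : ℝ) := by
        exact_mod_cast Int.floor_nonneg.mpr (by positivity)
      have := mul_nonneg hTs.le this
      linarith
    obtain ⟨j, rfl⟩ := Nat.exists_eq_succ_of_ne_zero hk0
    simp only [Set.mem_iUnion, Finset.mem_range]
    refine ⟨j, by omega, hk1, ?_⟩
    have h3 : (⌊τ / Ts⌋ : ℝ) < tk (j + 1) / Ts := by
      rw [lt_div_iff₀ hTs, mul_comm, ← hsmp]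
      exact hlt
    have h4 : ⌊τ / Ts⌋ < ⌈tk (j + 1) / Ts⌉ := Int.lt_ceil.mpr h3
    have h5 : τ / Ts < (⌈tk (j + 1) / Ts⌉ : ℝ) := Int.floor_lt.mp h4
    rw [div_lt_iff₀ hTs] at h5
    linarith
  have hd : ∀ k, MeasureTheory.volume.real
      (Set.Ico (tk (k + 1)) (Ts * (⌈tk (k + 1) / Ts⌉ : ℝ))) < Ts := by
    intro k
    rw [Real.volume_real_Ico]
    refine max_lt ?_ hTs
    have h := mul_lt_mul_of_pos_left (Int.ceil_lt_add_one (tk (k + 1) / Ts)) hTs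
    have h' : Ts * (tk (k + 1) / Ts + 1) = tk (k + 1) + Ts := by field_simp
    linarith
  have hb : μ t 0 ≤ ∑ k ∈ Finset.range K, MeasureTheory.volume.real
      (Set.Ico (tk (k + 1)) (Ts * (⌈tk (k + 1) / Ts⌉ : ℝ))) := by
    rw [hμ]
    refine le_trans (MeasureTheory.measureReal_mono hsub ?_)
      (MeasureTheory.measureReal_biUnion_finset_le _ _)
    refine ((MeasureTheory.measure_biUnion_lt_top (Finset.finite_toSet _) ?_)).ne
    intro i _
    exact measure_Ico_lt_top
  have hN' : (0 : ℝ) < N := by exact_mod_cast hN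
  rcases Nat.eq_zero_or_pos K with rfl | hKpos
  · simp only [Finset.range_zero, Finset.sum_empty] at hb
    exact hb.trans_lt (by positivity)
  · refine hb.trans_lt ((Finset.sum_lt_sum_of_nonempty
      (Finset.nonempty_range_iff.mpr hKpos.ne') (fun k _ => hd k)).trans_le ?_)
    rw [Finset.sum_const, Finset.card_range, nsmul_eq_mul, le_div_iff₀ hN']
    have := hgrow K
    linarith
end

section
/- Let σ be a switching signal with dwell time n·T_s and suppose T₀ ≥ 0 satisfies σ(T₀) ≠ σ([T₀]⁻). Then the total mismatch time satisfies μ(t, T₀) < T_s + (t − T₀)/n for every t > T₀. -/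
/-- Second assertion of Proposition 2 of the paper.  For every switching signal `σ`
with dwell time `N Ts` and every `T₀ ≥ 0` with `σ(T₀) ≠ σ([T₀]⁻)`, the total
mismatch time satisfies `μ(t,T₀) < Ts + (t − T₀)/N` for every `t > T₀`. -/
theorem mismatch_time_bound_of_dwell_from_mismatch {ι : Type*} [Fintype ι] [Nonempty ι]
    (Ts : ℝ) (hTs : 0 < Ts) (N : ℕ) (hN : 0 < N)
    (smp : ℝ → ℝ) (hsmp : ∀ t, smp t = Ts * (⌊t / Ts⌋ : ℝ))
    (σ : ℝ → ι)
    (tk : ℕ → ℝ) (htk0 : tk 0 = 0) (htkmono : StrictMono tk)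
    (htkdwell : ∀ k, (N : ℝ) * Ts ≤ tk (k + 1) - tk k)
    (hconst : ∀ k, ∀ s ∈ Set.Ico (tk k) (tk (k + 1)), σ s = σ (tk k))
    (μ : ℝ → ℝ → ℝ)
    (hμ : ∀ t₁ t₂ : ℝ, μ t₁ t₂ =
      (MeasureTheory.volume {τ ∈ Set.Ico t₂ t₁ | σ τ ≠ σ (smp τ)}).toReal)
    (T₀ : ℝ) (hT₀ : 0 ≤ T₀) (hmis : σ T₀ ≠ σ (smp T₀)) :
    ∀ t > T₀, μ t T₀ < Ts + (t - T₀) / N := by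
  intro t ht
  have hN1 : (1 : ℝ) ≤ N := by exact_mod_cast hN
  have hgrow : ∀ k d : ℕ, (d : ℝ) * (N * Ts) ≤ tk (k + d) - tk k := by
    intro k d
    induction d with
    | zero => simp
    | succ d ih =>
      have := htkdwell (k + d)
      rw [← add_assoc]
      push_cast
      linarith
  have hloc : ∀ x : ℝ, 0 ≤ x → ∃ k, tk k ≤ x ∧ x < tk (k + 1) := by
    intro x hx
    have hex : ∃ k, x < tk k := by
      obtain ⟨d, hd⟩ := exists_nat_gt (x / (N * Ts))
      refine ⟨d, ?_⟩
      have h1 := hgrow 0 d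
      rw [zero_add, htk0, sub_zero] at h1
      rw [div_lt_iff₀ (by positivity)] at hd
      linarith
    classical
    have hpos : Nat.find hex ≠ 0 := by
      intro h
      have := Nat.find_spec hex
      rw [h, htk0] at this
      linarith
    obtain ⟨k, hk⟩ := Nat.exists_eq_succ_of_ne_zero hpos
    refine ⟨k, ?_, ?_⟩
    · exact not_lt.mp (Nat.find_min hex (by omega))
    · have := Nat.find_spec hex
      rwa [hk] at this
  have hsmple : ∀ x, smp x ≤ x := by
    intro x
    rw [hsmp]
    have := Int.floor_le (x / Ts)
    rw [le_div_iff₀ hTs] at this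
    linarith
  -- a mismatch in the k-th interval happens before the first sample after the switch
  have hmiss : ∀ k x, tk k ≤ x → x < tk (k + 1) → σ x ≠ σ (smp x) →
      x < Ts * (⌈tk k / Ts⌉ : ℝ) := by
    intro k x h1 h2 h3
    by_contra hcon
    push Not at hcon
    apply h3
    have hc : ⌈tk k / Ts⌉ ≤ ⌊x / Ts⌋ := by
      rw [Int.le_floor, le_div_iff₀ hTs]
      linarith
    have hc' : tk k ≤ smp x := by
      rw [hsmp]
      have h4 := Int.le_ceil (tk k / Ts)
      rw [div_le_iff₀ hTs] at h4
      have h5 : (⌈tk k / Ts⌉ : ℝ) ≤ (⌊x / Ts⌋ : ℝ) := by exact_mod_cast hc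
      nlinarith
    rw [hconst k x ⟨h1, h2⟩, hconst k (smp x) ⟨hc', (hsmple x).trans_lt h2⟩]
  have hceil : ∀ k, Ts * (⌈tk k / Ts⌉ : ℝ) < tk k + Ts := by
    intro k
    have h := Int.ceil_lt_add_one (tk k / Ts)
    have h2 : tk k / Ts * Ts = tk k := div_mul_cancel₀ _ hTs.ne'
    nlinarith
  obtain ⟨k, hk1, hk2⟩ := hloc T₀ hT₀
  obtain ⟨m, hm1, hm2⟩ := hloc t (hT₀.trans ht.le)
  have hkm : k ≤ m := by
    have : tk k < tk (m + 1) := by linarith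
    have := htkmono.lt_iff_lt.mp this
    omega
  obtain ⟨d, rfl⟩ := Nat.exists_eq_add_of_le hkm
  have hT₀c := hmiss k T₀ hk1 hk2 hmis
  have hsub : {τ ∈ Set.Ico T₀ t | σ τ ≠ σ (smp τ)} ⊆
      Set.Ico T₀ (Ts * (⌈tk k / Ts⌉ : ℝ)) ∪
        ⋃ j ∈ Finset.range d, Set.Ico (tk (k + j + 1)) (tk (k + j + 1) + Ts) := by
    rintro x ⟨⟨hx1, hx2⟩, hx3⟩
    obtain ⟨l, hl1, hl2⟩ := hloc x (hT₀.trans hx1)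
    have hlc := hmiss l x hl1 hl2 hx3
    have hkl : k < l + 1 := htkmono.lt_iff_lt.mp (by linarith)
    have hlm : l < k + d + 1 := htkmono.lt_iff_lt.mp (by linarith)
    rcases Nat.eq_or_lt_of_le (Nat.le_of_lt_succ hkl) with rfl | hlt
    · exact Or.inl ⟨hx1, hlc⟩
    · right
      obtain ⟨j, rfl⟩ := Nat.exists_eq_add_of_lt hlt
      simp only [Set.mem_iUnion]
      exact ⟨j, Finset.mem_range.mpr (by omega), hl1, hlc.trans (hceil _)⟩
  have hvol : MeasureTheory.volume {τ ∈ Set.Ico T₀ t | σ τ ≠ σ (smp τ)} ≤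
      ENNReal.ofReal ((Ts * (⌈tk k / Ts⌉ : ℝ) - T₀) + d * Ts) := by
    refine (MeasureTheory.measure_mono hsub).trans ?_
    refine (MeasureTheory.measure_union_le _ _).trans ?_
    rw [ENNReal.ofReal_add (by linarith) (by positivity), Real.volume_Ico]
    gcongr
    refine (MeasureTheory.measure_biUnion_finset_le _ _).trans ?_
    simp [Real.volume_Ico, ENNReal.ofReal_mul]
  have hle : μ t T₀ ≤ (Ts * (⌈tk k / Ts⌉ : ℝ) - T₀) + d * Ts := by
    rw [hμ]
    refine ENNReal.toReal_le_of_le_ofReal ?_ hvol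
    have : 0 ≤ (d : ℝ) * Ts := by positivity
    linarith
  have hd : (d : ℝ) * Ts ≤ (t - tk k) / N := by
    rw [le_div_iff₀ (by linarith)]
    have := hgrow k d
    linarith
  have hs : (t - tk k) / N = (t - T₀) / N + (T₀ - tk k) / N := by ring
  have hs2 : (T₀ - tk k) / N ≤ T₀ - tk k := div_le_self (by linarith) hN1
  have := hceil k
  linarith
end

section
/- Fix ε > 0 and a positive integer n. For every T ≥ 0 there exist a switching signal σ with dwell time n·T_s and a real t ≥ T such that μ(t, 0) ≥ t/n − (T_s/n + ε). -/
/-- First assertion of Proposition 3 of the paper.  Fix `ε > 0` and a positive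
integer `N`.  For every `T ≥ 0` there exist a switching signal `σ` with dwell time
`N Ts` and a time `t ≥ T` such that `μ(t,0) ≥ t/N − (Ts/N + ε)`. -/
theorem mismatch_time_lower_bound {ι : Type*} [Fintype ι]
    (hcard : 1 < Fintype.card ι)
    (Ts : ℝ) (hTs : 0 < Ts) (N : ℕ) (hN : 0 < N)
    (ε : ℝ) (hε : 0 < ε) :
    ∀ T ≥ (0 : ℝ), ∃ (σ : ℝ → ι) (tk : ℕ → ℝ),
      tk 0 = 0 ∧ StrictMono tk ∧
      (∀ k, (N : ℝ) * Ts ≤ tk (k + 1) - tk k) ∧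
      (∀ k, ∀ s ∈ Set.Ico (tk k) (tk (k + 1)), σ s = σ (tk k)) ∧
      ∃ t ≥ T,
        t / N - (Ts / N + ε) ≤
          (MeasureTheory.volume
            {τ ∈ Set.Ico (0 : ℝ) t | σ τ ≠ σ (Ts * (⌊τ / Ts⌋ : ℝ))}).toReal := by
  classical
  intro T hT
  obtain ⟨a, b, hab⟩ := Fintype.one_lt_card_iff.mp hcard
  obtain ⟨K₀, hK₀⟩ := exists_nat_ge (T / Ts)
  set K : ℕ := K₀ + 1 with hK
  have hK1 : (1 : ℝ) ≤ K := by rw [hK]; push_cast; linarith [Nat.cast_nonneg (α := ℝ) K₀]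
  have hKT : T ≤ K * Ts := by
    rw [div_le_iff₀ hTs] at hK₀
    rw [hK]; push_cast; linarith
  have hN1 : (1 : ℝ) ≤ N := by exact_mod_cast hN
  obtain ⟨δ, hδ, hδ1, hδ2⟩ : ∃ δ : ℝ, 0 < δ ∧ K * δ ≤ Ts ∧ K * (K * δ) ≤ ε := by
    have hm : 0 < min Ts ε := lt_min hTs hε
    have e : (K : ℝ) * (K * (min Ts ε / (K * K))) = min Ts ε := by field_simp
    have hp : 0 < min Ts ε / ((K : ℝ) * K) := by positivity
    refine ⟨min Ts ε / (K * K), hp, ?_, ?_⟩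
    · have h1 : 0 < (K : ℝ) * (min Ts ε / (K * K)) := by positivity
      have := min_le_left Ts ε
      nlinarith
    · rw [e]; exact min_le_right _ _
  set L : ℝ := N * Ts + δ with hL
  have hNTs : Ts ≤ N * Ts := by nlinarith
  have hL0 : 0 < L := by linarith
  have key : ∀ (k : ℤ) (s : ℝ), k * L ≤ s → s < (k + 1) * L → ⌊s / L⌋ = k := by
    intro k s h1 h2
    rw [Int.floor_eq_iff, le_div_iff₀ hL0, div_lt_iff₀ hL0]
    exact ⟨h1, h2⟩
  set σ : ℝ → ι := fun s => if Even ⌊s / L⌋ then a else b with hσ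
  refine ⟨σ, fun k => k * L, by simp, ?_, ?_, ?_, (K * N + 1) * Ts, ?_, ?_⟩
  · intro i j hij
    have : (i : ℝ) < j := by exact_mod_cast hij
    exact mul_lt_mul_of_pos_right this hL0
  · intro k
    push_cast
    linarith
  · intro k s hs
    obtain ⟨h1, h2⟩ := hs
    push_cast at h2
    have e1 := key k s (by exact_mod_cast h1) (by exact_mod_cast h2)
    have e2 := key k (k * L) (by simp) (by push_cast; linarith)
    simp only [hσ, e1, e2]
  · nlinarith
  · set S := {τ ∈ Set.Ico (0 : ℝ) ((K * N + 1) * Ts) | σ τ ≠ σ (Ts * (⌊τ / Ts⌋ : ℝ))} with hS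
    have hSfin : MeasureTheory.volume S ≠ ⊤ := by
      refine ne_top_of_le_ne_top ?_ (MeasureTheory.measure_mono (Set.sep_subset _ _))
      simp
    set I : ℕ → Set ℝ := fun i => Set.Ico (((i : ℝ) + 1) * L) ((((i : ℝ) + 1) * N + 1) * Ts) with hI
    have hfl : ∀ i < K, ∀ τ ∈ I i, ⌊τ / Ts⌋ = ((i : ℤ) + 1) * N ∧ ⌊τ / L⌋ = (i : ℤ) + 1 := by
      intro i hi τ hτ
      obtain ⟨h1, h2⟩ := hτ
      have hi0 : (0 : ℝ) ≤ i := Nat.cast_nonneg i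
      have hp : 0 ≤ ((i : ℝ) + 1) * δ := by positivity
      constructor
      · rw [Int.floor_eq_iff, le_div_iff₀ hTs, div_lt_iff₀ hTs]
        push_cast
        refine ⟨?_, h2⟩
        rw [hL] at h1
        nlinarith
      · apply key
        · push_cast; exact h1
        · push_cast
          rw [hL]
          nlinarith
    have hsub : (⋃ i ∈ Finset.range K, I i) ⊆ S := by
      intro τ hτ
      simp only [Set.mem_iUnion, Finset.mem_range] at hτ
      obtain ⟨i, hi, hτ⟩ := hτ
      obtain ⟨f1, f2⟩ := hfl i hi τ hτ
      obtain ⟨h1, h2⟩ := hτ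
      have hi0 : (0 : ℝ) ≤ i := Nat.cast_nonneg i
      have hiK : (i : ℝ) + 1 ≤ K := by exact_mod_cast hi
      have hp : 0 < ((i : ℝ) + 1) * δ := by positivity
      have hp2 : ((i : ℝ) + 1) * δ ≤ K * δ := mul_le_mul_of_nonneg_right hiK hδ.le
      refine ⟨⟨le_trans (by positivity) h1, lt_of_lt_of_le h2 ?_⟩, ?_⟩
      · gcongr
      · have f3 : ⌊(Ts * (((i : ℤ) + 1) * N : ℤ) : ℝ) / L⌋ = (i : ℤ) := by
          apply key
          · push_cast
            rw [hL]
            nlinarith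
          · push_cast
            rw [hL]
            nlinarith
        rw [f1]
        simp only [hσ, f2, f3]
        by_cases he : Even (i : ℤ)
        · have : ¬ Even ((i : ℤ) + 1) := by rw [Int.even_add_one]; simpa using he
          rw [if_neg this, if_pos he]; exact hab.symm
        · have : Even ((i : ℤ) + 1) := by rw [Int.even_add_one]; exact he
          rw [if_neg he, if_pos this]; exact hab
    have hdisj : Set.PairwiseDisjoint (↑(Finset.range K)) I := by
      intro i hi j hj hij
      rw [Function.onFun, Set.disjoint_left]
      intro τ h1 h2
      have g1 := (hfl i (by simpa using hi) τ h1).2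
      have g2 := (hfl j (by simpa using hj) τ h2).2
      apply hij
      omega
    have hvol : MeasureTheory.volume.real (⋃ i ∈ Finset.range K, I i)
        = ∑ i ∈ Finset.range K, MeasureTheory.volume.real (I i) :=
      MeasureTheory.measureReal_biUnion_finset hdisj (fun i _ => measurableSet_Ico)
        (fun i _ => by simp [hI])
    have hle : MeasureTheory.volume.real (⋃ i ∈ Finset.range K, I i) ≤ MeasureTheory.volume.real S :=
      MeasureTheory.measureReal_mono hsub hSfin
    have hsum : ∑ i ∈ Finset.range K, (Ts - K * δ) ≤
        ∑ i ∈ Finset.range K, MeasureTheory.volume.real (I i) := by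
      apply Finset.sum_le_sum
      intro i hi
      have hiK : (i : ℝ) + 1 ≤ K := by exact_mod_cast Finset.mem_range.mp hi
      have hp2 : ((i : ℝ) + 1) * δ ≤ K * δ := mul_le_mul_of_nonneg_right hiK hδ.le
      rw [hI, MeasureTheory.measureReal_def, Real.volume_Ico]
      refine le_trans ?_ (le_trans (le_max_left _ 0) (ENNReal.toReal_ofReal' ).ge)
      rw [hL]
      nlinarith
    rw [Finset.sum_const, Finset.card_range, nsmul_eq_mul] at hsum
    have e : (K * N + 1) * Ts / N - (Ts / N + ε) = K * Ts - ε := by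
      field_simp
      ring
    rw [e]
    change _ ≤ MeasureTheory.volume.real S
    nlinarith
end

section
/- Fix ε > 0 and a positive integer n. For every T ≥ 0 there exist a switching signal σ with dwell time n·T_s, a real T₀ ≥ 0 with σ(T₀) ≠ σ([T₀]⁻), and a real t ≥ T₀ + T such that μ(t, T₀) ≥ T_s + (t − T₀)/n − (T_s/n + ε). -/
/-- Second assertion of Proposition 3 of the paper.  Fix `ε > 0` and a positive
integer `N`.  For every `T ≥ 0` there exist a switching signal `σ` with dwell time
`N Ts`, a time `T₀ ≥ 0` with `σ(T₀) ≠ σ([T₀]⁻)`, and a time `t ≥ T₀ + T` such that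
`μ(t,T₀) ≥ Ts + (t − T₀)/N − (Ts/N + ε)`. -/
theorem mismatch_time_lower_bound_from_mismatch {ι : Type*} [Fintype ι]
    (hcard : 1 < Fintype.card ι)
    (Ts : ℝ) (hTs : 0 < Ts) (N : ℕ) (hN : 0 < N)
    (ε : ℝ) (hε : 0 < ε) :
    ∀ T ≥ (0 : ℝ), ∃ (σ : ℝ → ι) (tk : ℕ → ℝ),
      tk 0 = 0 ∧ StrictMono tk ∧
      (∀ k, (N : ℝ) * Ts ≤ tk (k + 1) - tk k) ∧
      (∀ k, ∀ s ∈ Set.Ico (tk k) (tk (k + 1)), σ s = σ (tk k)) ∧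
      ∃ T₀ ≥ (0 : ℝ), σ T₀ ≠ σ (Ts * (⌊T₀ / Ts⌋ : ℝ)) ∧
        ∃ t ≥ T₀ + T,
          Ts + (t - T₀) / N - (Ts / N + ε) ≤
            (MeasureTheory.volume
              {τ ∈ Set.Ico T₀ t | σ τ ≠ σ (Ts * (⌊τ / Ts⌋ : ℝ))}).toReal := by
  intro T hT
  obtain ⟨a, b, hab⟩ := Fintype.one_lt_card_iff.mp hcard
  have hN1 : (1 : ℝ) ≤ N := by exact_mod_cast hN
  have hN0 : (0 : ℝ) < N := by linarith
  obtain ⟨m, hm⟩ := exists_nat_ge (T / Ts)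
  rw [div_le_iff₀ hTs] at hm
  have hm0 : (0 : ℝ) ≤ m := Nat.cast_nonneg m
  obtain ⟨δ, hδ0, hδT, hδε⟩ : ∃ δ : ℝ, 0 < δ ∧ δ < Ts ∧ ((m : ℝ) + 1) * δ ≤ ε := by
    refine ⟨min (Ts / 2) (ε / (m + 1)), by positivity, ?_, ?_⟩
    · exact lt_of_le_of_lt (min_le_left _ _) (by linarith)
    · calc ((m : ℝ) + 1) * min (Ts / 2) (ε / (m + 1)) ≤ (m + 1) * (ε / (m + 1)) := by
            gcongr; exact min_le_right _ _
        _ = ε := by field_simp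
  set P : ℝ := N * Ts with hP
  have hPT : Ts ≤ P := by nlinarith
  have hP0 : 0 < P := by linarith
  let σ : ℝ → ι := fun s => if Even ⌊(s - δ) / P⌋₊ then a else b
  have key : ∀ (k : ℕ) (s : ℝ), k * P + δ ≤ s → s < (k + 1) * P + δ →
      ⌊(s - δ) / P⌋₊ = k := by
    intro k s h1 h2
    have h3 : (k : ℝ) ≤ (s - δ) / P := by rw [le_div_iff₀ hP0]; linarith
    rw [Nat.floor_eq_iff (le_trans (Nat.cast_nonneg k) h3)]
    exact ⟨h3, by rw [div_lt_iff₀ hP0]; linarith⟩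
  have key0 : ∀ s : ℝ, s < P + δ → ⌊(s - δ) / P⌋₊ = 0 := by
    intro s h
    rw [Nat.floor_eq_zero, div_lt_iff₀ hP0]; linarith
  have hmis : ∀ (j : ℕ) (τ : ℝ), (j + 1) * P + δ ≤ τ → τ < (j + 1) * P + Ts →
      σ τ ≠ σ (Ts * (⌊τ / Ts⌋ : ℝ)) := by
    intro j τ h1 h2
    have hf : ⌊τ / Ts⌋ = (((j + 1) * N : ℕ) : ℤ) := by
      rw [Int.floor_eq_iff]
      push_cast
      rw [le_div_iff₀ hTs, div_lt_iff₀ hTs]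
      constructor <;> nlinarith
    have e1 : ⌊(τ - δ) / P⌋₊ = j + 1 := by
      apply key <;> push_cast <;> linarith
    have hv : Ts * (⌊τ / Ts⌋ : ℝ) = (j + 1) * P := by
      rw [hf]; push_cast; rw [hP]; ring
    have e2 : ⌊((j + 1) * P - δ) / P⌋₊ = j := by
      apply key <;> linarith
    rw [hv]
    simp only [σ, e1, e2]
    by_cases hj : Even j
    · simp [hj, Nat.even_add_one, hab.symm]
    · simp [hj, Nat.even_add_one, hab]
  let tk : ℕ → ℝ := fun k => if k = 0 then 0 else k * P + δ
  have hgap : ∀ k, P ≤ tk (k + 1) - tk k := by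
    intro k
    rcases k with _ | k
    · simp [tk]; linarith
    · simp [tk]; linarith
  refine ⟨σ, tk, by simp [tk], strictMono_nat_of_lt_succ fun k => by linarith [hgap k],
    hgap, ?_, P + δ, by positivity, ?_, (m + 1) * P + Ts, ?_, ?_⟩
  · intro k s hs
    rcases k with _ | k
    · simp [tk] at hs
      have e1 := key0 s (by linarith)
      have e2 := key0 0 (by linarith)
      simp only [σ, tk, if_true, e1, e2]
    · simp [tk] at hs
      have e1 := key (k + 1) s (by push_cast; linarith) (by push_cast; linarith)
      have e2 := key (k + 1) ((k + 1) * P + δ) (by push_cast; linarith) (by push_cast; linarith)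
      have e3 : tk (k + 1) = (k + 1) * P + δ := by simp [tk]
      rw [e3]
      simp only [σ, e1, e2]
  · exact hmis 0 _ (by simp) (by simp; linarith)
  · nlinarith
  · let I : ℕ → Set ℝ := fun j => Set.Ico ((j + 1) * P + δ) ((j + 1) * P + Ts)
    have hdis : Set.PairwiseDisjoint (↑(Finset.range (m + 1))) I := by
      intro i _ j _ hij
      refine Set.disjoint_left.mpr fun x hx hy => hij ?_
      have e1 := key (i + 1) x (by push_cast; linarith [hx.1]) (by push_cast; linarith [hx.2])
      have e2 := key (j + 1) x (by push_cast; linarith [hy.1]) (by push_cast; linarith [hy.2])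
      omega
    have hvol : MeasureTheory.volume (⋃ j ∈ Finset.range (m + 1), I j)
        = ENNReal.ofReal ((m + 1) * (Ts - δ)) := by
      rw [MeasureTheory.measure_biUnion_finset hdis fun j _ => measurableSet_Ico]
      have : ∀ j, MeasureTheory.volume (I j) = ENNReal.ofReal (Ts - δ) := by
        intro j
        simp only [I, Real.volume_Ico]
        congr 1; ring
      simp only [this, Finset.sum_const, Finset.card_range]
      rw [← ENNReal.ofReal_nsmul]
      simp
    have hsub : (⋃ j ∈ Finset.range (m + 1), I j) ⊆
        {τ ∈ Set.Ico (P + δ) ((m + 1) * P + Ts) | σ τ ≠ σ (Ts * (⌊τ / Ts⌋ : ℝ))} := by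
      intro x hx
      simp only [Set.mem_iUnion, Finset.mem_range] at hx
      obtain ⟨j, hj, hx1, hx2⟩ := hx
      have hj' : (j : ℝ) ≤ m := by exact_mod_cast Nat.lt_succ_iff.mp hj
      have hj0 : (0 : ℝ) ≤ j := Nat.cast_nonneg j
      exact ⟨⟨by nlinarith, by nlinarith⟩, hmis j x hx1 hx2⟩
    have hfin : MeasureTheory.volume
        {τ ∈ Set.Ico (P + δ) ((m + 1) * P + Ts) | σ τ ≠ σ (Ts * (⌊τ / Ts⌋ : ℝ))} ≠ ⊤ :=
      ne_top_of_le_ne_top (by simp) (MeasureTheory.measure_mono (Set.sep_subset _ _))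
    have hle := ENNReal.toReal_mono hfin (MeasureTheory.measure_mono hsub)
    rw [hvol, ENNReal.toReal_ofReal (mul_nonneg (by linarith) (by linarith))] at hle
    refine le_trans ?_ hle
    have e : ((m + 1) * P + Ts - (P + δ)) / N = m * Ts + Ts / N - δ / N := by
      rw [hP]; field_simp; ring
    have : 0 ≤ δ / N := by positivity
    rw [e]
    linarith
end

section
/- For every ε > 0 and every T ≥ 0 there exist a switching signal σ with dwell time T_s and a real t ≥ T such that μ(t, 0) ≥ t − T_s − ε; that is, when the dwell time equals the sampling period, the total mismatch time can be arbitrarily close to the full elapsed time. -/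
/-- Corollary 1 of the paper (the case `n = 1` of Proposition 3).  For every `ε > 0`
and every `T ≥ 0` there exist a switching signal `σ` with dwell time `Ts` and a time
`t ≥ T` such that `μ(t,0) ≥ t − Ts − ε`: when the dwell time equals the sampling
period, the total mismatch time can be arbitrarily close to the full elapsed time. -/
theorem mismatch_time_almost_full {ι : Type*} [Fintype ι]
    (hcard : 1 < Fintype.card ι)
    (Ts : ℝ) (hTs : 0 < Ts)
    (ε : ℝ) (hε : 0 < ε) :
    ∀ T ≥ (0 : ℝ), ∃ (σ : ℝ → ι) (tk : ℕ → ℝ),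
      tk 0 = 0 ∧ StrictMono tk ∧
      (∀ k, Ts ≤ tk (k + 1) - tk k) ∧
      (∀ k, ∀ s ∈ Set.Ico (tk k) (tk (k + 1)), σ s = σ (tk k)) ∧
      ∃ t ≥ T,
        t - Ts - ε ≤
          (MeasureTheory.volume
            {τ ∈ Set.Ico (0 : ℝ) t | σ τ ≠ σ (Ts * (⌊τ / Ts⌋ : ℝ))}).toReal := by
  classical
  intro T hT
  obtain ⟨a, b, hab⟩ := Fintype.one_lt_card_iff.mp hcard
  obtain ⟨N, hN⟩ := exists_nat_ge (T / Ts)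
  have hN0 : (0 : ℝ) ≤ N := Nat.cast_nonneg N
  obtain ⟨δ, hδ, hδε, hδT⟩ : ∃ δ : ℝ, 0 < δ ∧ (N + 1) * (N * δ) ≤ ε ∧ N * δ ≤ Ts := by
    have hm : 0 < min ε Ts := lt_min hε hTs
    refine ⟨min ε Ts / ((N + 1) * (N + 1)), by positivity, ?_, ?_⟩
    · refine le_trans ?_ (min_le_left ε Ts)
      rw [← mul_assoc, mul_div_assoc', div_le_iff₀ (by positivity)]
      nlinarith
    · refine le_trans ?_ (min_le_right ε Ts)
      rw [mul_div_assoc', div_le_iff₀ (by positivity)]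
      nlinarith [mul_nonneg hN0 hm.le, mul_nonneg hN0 (mul_nonneg hN0 hm.le)]
  have hD : 0 < Ts + δ := by linarith
  have hfl : ∀ (k : ℤ) (s : ℝ), k * (Ts + δ) ≤ s → s < (k + 1) * (Ts + δ) →
      ⌊s / (Ts + δ)⌋ = k := by
    intro k s h1 h2
    rw [Int.floor_eq_iff]
    exact ⟨(le_div_iff₀ hD).2 h1, (div_lt_iff₀ hD).2 h2⟩
  refine ⟨fun s => if Even ⌊s / (Ts + δ)⌋ then a else b, fun k => k * (Ts + δ), by simp,
    ?_, ?_, ?_, (N + 1) * Ts, ?_, ?_⟩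
  · intro i j hij
    have : (i : ℝ) < j := by exact_mod_cast hij
    exact mul_lt_mul_of_pos_right this hD
  · intro k
    push_cast
    linarith
  · intro k s hs
    have h1 := hs.1
    have h2 := hs.2
    simp only [] at h1 h2
    push_cast at h2
    have e1 := hfl k s (by exact_mod_cast h1) (by exact_mod_cast h2)
    have e2 := hfl k (k * (Ts + δ)) (by simp) (by push_cast; linarith)
    simp only [e1, e2]
  · have := (div_le_iff₀ hTs).1 hN
    linarith
  · set S : Set ℝ := {τ ∈ Set.Ico (0 : ℝ) ((N + 1) * Ts) |
      (if Even ⌊τ / (Ts + δ)⌋ then a else b) ≠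
        (if Even ⌊(Ts * (⌊τ / Ts⌋ : ℝ)) / (Ts + δ)⌋ then a else b)} with hS
    have hsub : Set.Ico (0 : ℝ) ((N + 1) * Ts) ⊆
        S ∪ (Set.Ico 0 Ts ∪ ⋃ k ∈ Finset.range (N + 1),
          Set.Ico ((k : ℝ) * Ts) (k * Ts + N * δ)) := by
      intro τ hτ
      by_cases hτ1 : τ < Ts
      · exact Or.inr (Or.inl ⟨hτ.1, hτ1⟩)
      push Not at hτ1
      obtain ⟨k, hk⟩ : ∃ k : ℕ, ⌊τ / Ts⌋ = k :=
        Int.eq_ofNat_of_zero_le (Int.floor_nonneg.2 (div_nonneg hτ.1 hTs.le))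
      have hk' := Int.floor_eq_iff.1 hk
      have h1 := (le_div_iff₀ hTs).1 hk'.1
      have h2 := (div_lt_iff₀ hTs).1 hk'.2
      push_cast at h1 h2
      have hkN : k < N + 1 := by
        have : (k : ℝ) < N + 1 := lt_of_mul_lt_mul_right (h1.trans_lt hτ.2) hTs.le
        exact_mod_cast this
      have hk1 : 1 ≤ k := by
        have : (1 : ℝ) < k + 1 := by
          apply lt_of_mul_lt_mul_right _ hTs.le
          linarith
        have : 1 < k + 1 := by exact_mod_cast this
        omega
      by_cases hc : τ < k * Ts + N * δ
      · refine Or.inr (Or.inr ?_)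
        simp only [Set.mem_iUnion]
        exact ⟨k, Finset.mem_range.2 hkN, h1, hc⟩
      push Not at hc
      refine Or.inl ⟨hτ, ?_⟩
      have hkN' : (k : ℝ) ≤ N := by exact_mod_cast Nat.lt_succ_iff.1 hkN
      have hk1' : (1 : ℝ) ≤ k := by exact_mod_cast hk1
      have hkδ : k * δ ≤ N * δ := mul_le_mul_of_nonneg_right hkN' hδ.le
      have hkδ0 : 0 < k * δ := by positivity
      have e1 := hfl k τ (by push_cast; linarith) (by push_cast; linarith)
      have e2 := hfl (k - 1) (Ts * k) (by push_cast; linarith) (by push_cast; linarith)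
      rw [hk, e1, Int.cast_natCast, e2]
      by_cases hev : Even (k : ℤ)
      · have : ¬ Even ((k : ℤ) - 1) := by
          intro h
          have := Int.even_sub_one.1 h
          exact this hev
        simp [hev, this, hab]
      · have : Even ((k : ℤ) - 1) := Int.even_sub_one.2 hev
        simp [hev, this, hab.symm]
    have hfin : MeasureTheory.volume S ≠ ⊤ := by
      refine ne_top_of_le_ne_top ?_ (MeasureTheory.measure_mono
        (show S ⊆ Set.Ico (0 : ℝ) ((N + 1) * Ts) from fun x hx => hx.1))
      simp
    have hle : ENNReal.ofReal ((N + 1) * Ts) ≤ MeasureTheory.volume S +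
        (ENNReal.ofReal Ts + ENNReal.ofReal ((N + 1) * (N * δ))) := by
      calc ENNReal.ofReal ((N + 1) * Ts)
          = MeasureTheory.volume (Set.Ico (0 : ℝ) ((N + 1) * Ts)) := by simp
        _ ≤ _ := MeasureTheory.measure_mono hsub
        _ ≤ _ := MeasureTheory.measure_union_le _ _
        _ ≤ _ := by
          gcongr
          refine (MeasureTheory.measure_union_le _ _).trans ?_
          refine add_le_add (by simp) ?_
          refine (MeasureTheory.measure_biUnion_finset_le _ _).trans ?_
          simp only [Real.volume_Ico, add_sub_cancel_left, Finset.sum_const,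
            Finset.card_range, nsmul_eq_mul]
          rw [ENNReal.ofReal_mul (p := (N : ℝ) + 1) (by positivity)]
          gcongr
          rw [show (N : ℝ) + 1 = ((N + 1 : ℕ) : ℝ) by push_cast; rfl,
            ENNReal.ofReal_natCast]
    rw [← ENNReal.ofReal_toReal hfin, ← ENNReal.ofReal_add hTs.le (by positivity),
      ← ENNReal.ofReal_add ENNReal.toReal_nonneg (by positivity),
      ENNReal.ofReal_le_ofReal_iff (by positivity)] at hle
    linarith
end

section
/- Let the partition defining the quantizer be finite and let the quantizer vanish near the origin. Let F be a finite family of real n×n matrices and E a bounded subset of ℝⁿ. Then there exists α₀ > 0 such that ‖M·Q(x)‖ ≤ α₀·‖x‖ for every M ∈ F and every x ∈ E. -/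
/-- Existence of the constant `α₀` of inequality (eq. 8) of the paper.  Let `Q` be a
static quantizer given by a finite partition `{cell j}` of `ℝⁿ` with values `q j`,
vanishing near the origin.  For every finite family `F` of matrices (operators on
Euclidean space, with the operator norm induced by the Euclidean norm) and every
bounded set `E ⊆ ℝⁿ`, there exists `α₀ > 0` such that `‖M (Q x)‖ ≤ α₀ ‖x‖` for all
`M ∈ F` and all `x ∈ E`. -/
theorem quantizer_gain_bound {n : ℕ}
    {S : Type*}
    (cell : S → Set (EuclideanSpace ℝ (Fin n)))
    (q : S → EuclideanSpace ℝ (Fin n))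
    (hne : ∀ j, (cell j).Nonempty)
    (hdisj : ∀ i j, i ≠ j → Disjoint (cell i) (cell j))
    (hcover : (⋃ j, cell j) = Set.univ)
    (Q : EuclideanSpace ℝ (Fin n) → EuclideanSpace ℝ (Fin n))
    (hQ : ∀ j, ∀ x ∈ cell j, Q x = q j)
    (hfin : ∀ B : Set (EuclideanSpace ℝ (Fin n)), Bornology.IsBounded B →
      ∃ Sf : Finset S, B ⊆ ⋃ j ∈ Sf, cell j)
    (hzero : ∀ j, (0 : EuclideanSpace ℝ (Fin n)) ∈ closure (cell j) → q j = 0)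
    (F : Finset (EuclideanSpace ℝ (Fin n) →L[ℝ] EuclideanSpace ℝ (Fin n)))
    (E : Set (EuclideanSpace ℝ (Fin n))) (hE : Bornology.IsBounded E) :
    ∃ α₀ > (0 : ℝ), ∀ M ∈ F, ∀ x ∈ E, ‖M (Q x)‖ ≤ α₀ * ‖x‖ := by
  have key : ∀ (M : EuclideanSpace ℝ (Fin n) →L[ℝ] EuclideanSpace ℝ (Fin n)) (j : S),
      ∃ a : ℝ, 0 ≤ a ∧ ∀ x ∈ cell j, ‖M (q j)‖ ≤ a * ‖x‖ := by
    intro M j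
    by_cases h : (0 : EuclideanSpace ℝ (Fin n)) ∈ closure (cell j)
    · exact ⟨0, le_rfl, fun x _ => by simp [hzero j h]⟩
    · rw [Metric.mem_closure_iff] at h
      push Not at h
      obtain ⟨ε, hε, h⟩ := h
      refine ⟨‖M (q j)‖ / ε, by positivity, fun x hx => ?_⟩
      have h1 := h x hx
      rw [dist_zero_left] at h1
      rw [div_mul_eq_mul_div, le_div_iff₀ hε]
      exact mul_le_mul_of_nonneg_left h1 (norm_nonneg _)
  choose a ha0 ha using key
  obtain ⟨Sf, hSf⟩ := hfin E hE
  have hs : ∀ M, 0 ≤ ∑ j ∈ Sf, a M j := fun M => Finset.sum_nonneg fun j _ => ha0 M j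
  have hss : 0 ≤ ∑ M ∈ F, ∑ j ∈ Sf, a M j := Finset.sum_nonneg fun M _ => hs M
  refine ⟨1 + ∑ M ∈ F, ∑ j ∈ Sf, a M j, by positivity, fun M hM x hx => ?_⟩
  have hx' := hSf hx
  simp only [Set.mem_iUnion] at hx'
  obtain ⟨j, hj, hxj⟩ := hx'
  rw [hQ j x hxj]
  refine (ha M j x hxj).trans (mul_le_mul_of_nonneg_right ?_ (norm_nonneg _))
  have h1 : a M j ≤ ∑ j ∈ Sf, a M j :=
    Finset.single_le_sum (f := fun j => a M j) (fun j _ => ha0 M j) hj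
  have h2 : ∑ j ∈ Sf, a M j ≤ ∑ M ∈ F, ∑ j ∈ Sf, a M j :=
    Finset.single_le_sum (f := fun M => ∑ j ∈ Sf, a M j) (fun M _ => hs M) hM
  linarith
end

section
/- Let the partition defining the quantizer be finite and let the quantizer vanish near the origin. Let M be a real n×n matrix and E a bounded subset of ℝⁿ. Then there exists γ₀ > 0 such that ‖M·(Q(x) − x)‖ ≤ γ₀·‖x‖ for every x ∈ E. -/
/-- Existence of the constant `γ₀` of inequality (eq. 19) of the paper (cf. Remark 3
(3)).  Let `Q` be a static quantizer given by a finite partition `{cell j}` of `ℝⁿ`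
with values `q j`, vanishing near the origin.  For every matrix `M` (an operator on
Euclidean space, with the operator norm induced by the Euclidean norm) and every
bounded set `E ⊆ ℝⁿ`, there exists `γ₀ > 0` such that `‖M (Q x − x)‖ ≤ γ₀ ‖x‖` for
all `x ∈ E`. -/
theorem quantizer_error_gain_bound {n : ℕ}
    {S : Type*}
    (cell : S → Set (EuclideanSpace ℝ (Fin n)))
    (q : S → EuclideanSpace ℝ (Fin n))
    (hne : ∀ j, (cell j).Nonempty)
    (hdisj : ∀ i j, i ≠ j → Disjoint (cell i) (cell j))
    (hcover : (⋃ j, cell j) = Set.univ)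
    (Q : EuclideanSpace ℝ (Fin n) → EuclideanSpace ℝ (Fin n))
    (hQ : ∀ j, ∀ x ∈ cell j, Q x = q j)
    (hfin : ∀ B : Set (EuclideanSpace ℝ (Fin n)), Bornology.IsBounded B →
      ∃ Sf : Finset S, B ⊆ ⋃ j ∈ Sf, cell j)
    (hzero : ∀ j, (0 : EuclideanSpace ℝ (Fin n)) ∈ closure (cell j) → q j = 0)
    (M : EuclideanSpace ℝ (Fin n) →L[ℝ] EuclideanSpace ℝ (Fin n))
    (E : Set (EuclideanSpace ℝ (Fin n))) (hE : Bornology.IsBounded E) :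
    ∃ γ₀ > (0 : ℝ), ∀ x ∈ E, ‖M (Q x - x)‖ ≤ γ₀ * ‖x‖ := by
  have key : ∀ j, ∃ c : ℝ, 0 ≤ c ∧ ∀ x ∈ cell j, ‖q j‖ ≤ c * ‖x‖ := by
    intro j
    by_cases h : (0 : EuclideanSpace ℝ (Fin n)) ∈ closure (cell j)
    · exact ⟨0, le_rfl, fun x _ => by simp [hzero j h]⟩
    · rw [Metric.mem_closure_iff] at h
      push Not at h
      obtain ⟨ε, hε, h⟩ := h
      refine ⟨‖q j‖ / ε, by positivity, fun x hx => ?_⟩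
      have h1 := h x hx
      rw [dist_zero_left] at h1
      calc ‖q j‖ = ‖q j‖ / ε * ε := by field_simp
        _ ≤ ‖q j‖ / ε * ‖x‖ := by gcongr
  choose c hc0 hc using key
  obtain ⟨Sf, hSf⟩ := hfin E hE
  have hsum : 0 ≤ ∑ j ∈ Sf, c j := Finset.sum_nonneg fun j _ => hc0 j
  refine ⟨‖M‖ * (∑ j ∈ Sf, c j + 1) + 1, by positivity, fun x hx => ?_⟩
  obtain ⟨j, hj, hxj⟩ := Set.mem_iUnion₂.1 (hSf hx)
  have h1 : c j ≤ ∑ j ∈ Sf, c j :=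
    Finset.single_le_sum (f := c) (fun j _ => hc0 j) hj
  have h2 : ‖Q x - x‖ ≤ (∑ j ∈ Sf, c j + 1) * ‖x‖ := by
    rw [hQ j x hxj]
    calc ‖q j - x‖ ≤ ‖q j‖ + ‖x‖ := norm_sub_le _ _
      _ ≤ c j * ‖x‖ + ‖x‖ := by gcongr; exact hc j x hxj
      _ ≤ (∑ j ∈ Sf, c j) * ‖x‖ + ‖x‖ := by gcongr
      _ = _ := by ring
  calc ‖M (Q x - x)‖ ≤ ‖M‖ * ‖Q x - x‖ := M.le_opNorm _
    _ ≤ ‖M‖ * ((∑ j ∈ Sf, c j + 1) * ‖x‖) := by gcongr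
    _ ≤ (‖M‖ * (∑ j ∈ Sf, c j + 1) + 1) * ‖x‖ := by
      nlinarith [norm_nonneg x]
end
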